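/- Let l ≥ 5 be an odd integer, q ∈ ℂ a primitive l-th root of unity (so q is not a cubic root of unity), and n ≥ 3. Then the Temperley–Lieb algebra Tl_n(q) is isomorphic as a ℂ-algebra to the quotient of the level-one cyclotomic Khovanov–Lauda–Rouquier algebra R_n^{(1)} by the two-sided ideal generated by all idempotents e(i) with i ∈ (ℤ/lℤ)^n satisfying (i_1, i_2, i_3) ≡ (0, 1, 2) (mod l). In particular, since these generators are homogeneous of degree 0, Tl_n(q) inherits a ℤ-grading. -/

import Mathlib

noncomputable section

namespace Statement3

/-- The generator `U_i` of the Temperley–Lieb algebra in the free algebra on `U_1, …, U_{n-1}`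
(0-indexed). -/
def UT (q : ℂ) (n : ℕ) (i : Fin (n - 1)) : FreeAlgebra ℂ (Fin (n - 1)) :=
  FreeAlgebra.ι ℂ i

/-- The defining relations of the Temperley–Lieb algebra `Tl_n(q)`. -/
inductive TLRel (q : ℂ) (n : ℕ) :
    FreeAlgebra ℂ (Fin (n - 1)) → FreeAlgebra ℂ (Fin (n - 1)) → Prop
  | Usq (i : Fin (n - 1)) : TLRel q n (UT q n i * UT q n i) ((-(q + q⁻¹)) • UT q n i)
  | UUU (i j : Fin (n - 1)) (h : i.val + 1 = j.val ∨ j.val + 1 = i.val) :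
      TLRel q n (UT q n i * UT q n j * UT q n i) (UT q n i)
  | Ucomm (i j : Fin (n - 1)) (h : i.val + 1 < j.val ∨ j.val + 1 < i.val) :
      TLRel q n (UT q n i * UT q n j) (UT q n j * UT q n i)

/-- The Temperley–Lieb algebra `Tl_n(q)`. -/
abbrev TL (q : ℂ) (n : ℕ) := RingQuot (TLRel q n)

/-- The image of `U_i` in the Temperley–Lieb algebra. -/
def UmkTL (q : ℂ) (n : ℕ) (i : Fin (n - 1)) : TL q n :=
  RingQuot.mkAlgHom ℂ (TLRel q n) (UT q n i)

/-- Residue sequences of length `n` with values in `ℤ/lℤ`. -/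
abbrev Res (l n : ℕ) := Fin n → ZMod l

/-- Generators of the Khovanov–Lauda–Rouquier algebra. -/
inductive KLRGen (l n : ℕ) : Type
  | e : Res l n → KLRGen l n
  | y : Fin n → KLRGen l n
  | psi : Fin (n - 1) → KLRGen l n

/-- The generator `e(i)` in the free algebra. -/
def eG (l n : ℕ) (i : Res l n) : FreeAlgebra ℂ (KLRGen l n) :=
  FreeAlgebra.ι ℂ (KLRGen.e i)

/-- The generator `y_r` in the free algebra. -/
def yG (l n : ℕ) (r : Fin n) : FreeAlgebra ℂ (KLRGen l n) :=
  FreeAlgebra.ι ℂ (KLRGen.y r)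

/-- The generator `ψ_r` in the free algebra. -/
def pG (l n : ℕ) (r : Fin (n - 1)) : FreeAlgebra ℂ (KLRGen l n) :=
  FreeAlgebra.ι ℂ (KLRGen.psi r)

/-- The position `r` as an element of `Fin n`. -/
def lo {n : ℕ} (r : Fin (n - 1)) : Fin n := ⟨r.val, by have := r.2; omega⟩

/-- The position `r + 1` as an element of `Fin n`. -/
def hi {n : ℕ} (r : Fin (n - 1)) : Fin n := ⟨r.val + 1, by have := r.2; omega⟩

/-- The defining relations of the cyclotomic KLR algebra, where `Lam ⊆ ℤ/lℤ` is the set of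
residues allowed at the first position (the multiset of cyclotomic parameters). -/
inductive KLRRel (l n : ℕ) [NeZero l] (Lam : Set (ZMod l)) :
    FreeAlgebra ℂ (KLRGen l n) → FreeAlgebra ℂ (KLRGen l n) → Prop
  | cyc1 (i : Res l n) (r : Fin n) (hr : r.val = 0) (h : i r ∉ Lam) :
      KLRRel l n Lam (eG l n i) 0
  | cyc2 (i : Res l n) (r : Fin n) (hr : r.val = 0) (h : i r ∈ Lam) :
      KLRRel l n Lam (yG l n r * eG l n i) 0
  | orth (i j : Res l n) (h : i ≠ j) : KLRRel l n Lam (eG l n i * eG l n j) 0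
  | idem (i : Res l n) : KLRRel l n Lam (eG l n i * eG l n i) (eG l n i)
  | sum1 : KLRRel l n Lam (∑ i : Res l n, eG l n i) 1
  | ye (r : Fin n) (i : Res l n) :
      KLRRel l n Lam (yG l n r * eG l n i) (eG l n i * yG l n r)
  | psie (r : Fin (n - 1)) (i : Res l n) :
      KLRRel l n Lam (pG l n r * eG l n i) (eG l n (i ∘ Equiv.swap (lo r) (hi r)) * pG l n r)
  | yy (r s : Fin n) : KLRRel l n Lam (yG l n r * yG l n s) (yG l n s * yG l n r)
  | psiy (r : Fin (n - 1)) (s : Fin n) (h1 : s.val ≠ r.val) (h2 : s.val ≠ r.val + 1) :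
      KLRRel l n Lam (pG l n r * yG l n s) (yG l n s * pG l n r)
  | pp (r s : Fin (n - 1)) (h : r.val + 1 < s.val ∨ s.val + 1 < r.val) :
      KLRRel l n Lam (pG l n r * pG l n s) (pG l n s * pG l n r)
  | py (r : Fin (n - 1)) (i : Res l n) :
      KLRRel l n Lam (pG l n r * (yG l n (hi r) * eG l n i))
        ((yG l n (lo r) * pG l n r + if i (lo r) = i (hi r) then 1 else 0) * eG l n i)
  | yp (r : Fin (n - 1)) (i : Res l n) :
      KLRRel l n Lam (yG l n (hi r) * (pG l n r * eG l n i))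
        ((pG l n r * yG l n (lo r) + if i (lo r) = i (hi r) then 1 else 0) * eG l n i)
  | psisq (r : Fin (n - 1)) (i : Res l n) :
      KLRRel l n Lam (pG l n r * pG l n r * eG l n i)
        ((if i (hi r) = i (lo r) then 0
          else if i (hi r) = i (lo r) + 1 then yG l n (hi r) - yG l n (lo r)
          else if i (hi r) = i (lo r) - 1 then yG l n (lo r) - yG l n (hi r)
          else 1) * eG l n i)
  | braid (r s : Fin (n - 1)) (h : s.val = r.val + 1) (i : Res l n) :
      KLRRel l n Lam (pG l n r * pG l n s * pG l n r * eG l n i)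
        ((pG l n s * pG l n r * pG l n s +
          (if i (hi s) = i (lo r) ∧ i (lo s) = i (lo r) + 1 then 1
           else if i (hi s) = i (lo r) ∧ i (lo s) = i (lo r) - 1 then -1
           else 0)) * eG l n i)

/-- The cyclotomic KLR algebra with cyclotomic residue set `Lam`. -/
abbrev KLR (l n : ℕ) [NeZero l] (Lam : Set (ZMod l)) := RingQuot (KLRRel l n Lam)

/-- The relation identifying the chosen KLR idempotents `e(i)`, `i ∈ bad`, with `0`;
quotienting by it is the same as quotienting by the two-sided ideal they generate. -/
def quotRel (l n : ℕ) [NeZero l] (Lam : Set (ZMod l)) (bad : Set (Res l n)) :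
    KLR l n Lam → KLR l n Lam → Prop := fun a b =>
  b = 0 ∧ ∃ i ∈ bad, a = RingQuot.mkAlgHom ℂ (KLRRel l n Lam) (eG l n i)

/-- The quotient of the cyclotomic KLR algebra by the two-sided ideal generated by the
idempotents `e(i)`, `i ∈ bad`. -/
abbrev BQuot (l n : ℕ) [NeZero l] (Lam : Set (ZMod l)) (bad : Set (Res l n)) :=
  RingQuot (quotRel l n Lam bad)

/-- The canonical map from the free algebra onto the quotient. -/
def bmk (l n : ℕ) [NeZero l] (Lam : Set (ZMod l)) (bad : Set (Res l n)) :
    FreeAlgebra ℂ (KLRGen l n) →ₐ[ℂ] BQuot l n Lam bad :=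
  (RingQuot.mkAlgHom ℂ (quotRel l n Lam bad)).comp (RingQuot.mkAlgHom ℂ (KLRRel l n Lam))

/-- The entries of the Cartan matrix of type `A_{l-1}^{(1)}`. -/
def cartan (l : ℕ) (i j : ZMod l) : ℤ :=
  if i = j then 2 else if j = i + 1 ∨ j = i - 1 then -1 else 0

/-- The level-one cyclotomic set `{0} ⊆ ℤ/lℤ`. -/
def Lam1 (l : ℕ) : Set (ZMod l) := {0}

/-- The residue sequences `i` with `(i₁, i₂, i₃) ≡ (0, 1, 2) (mod l)`. -/
def badSet1 (l n : ℕ) (hn : 3 ≤ n) : Set (Res l n) :=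
  {i | i ⟨0, by omega⟩ = 0 ∧ i ⟨1, by omega⟩ = 1 ∧ i ⟨2, by omega⟩ = 2}

set_option linter.unusedSimpArgs false

/-- The arithmetic of `ℤ/lℤ` used throughout: `2` is cancellable and `3 ≠ 0`. -/
structure OddModulus (l : ℕ) : Prop where
  two : ∀ x : ZMod l, 2 * x = 0 → x = 0
  ne3 : (3 : ZMod l) ≠ 0

namespace OddModulus
variable {l : ℕ}

theorem eq_of_two (hl : OddModulus l) {x y : ZMod l} (h : 2 * x = 2 * y) : x = y :=
  sub_eq_zero.1 (hl.two _ (by linear_combination h))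

theorem ne1 (hl : OddModulus l) : (1 : ZMod l) ≠ 0 := fun h => hl.ne3 (by linear_combination 3 * h)

theorem ne2 (hl : OddModulus l) : (2 : ZMod l) ≠ 0 :=
  fun h => hl.ne1 (hl.two _ (by linear_combination h))

theorem ne4 (hl : OddModulus l) : (4 : ZMod l) ≠ 0 :=
  fun h => hl.ne2 (hl.two _ (by linear_combination h))

theorem ne6 (hl : OddModulus l) : (6 : ZMod l) ≠ 0 :=
  fun h => hl.ne3 (hl.two _ (by linear_combination h))

theorem eq_zero_or (hl : OddModulus l) (x : ZMod l) : x = 0 ∨ 2 * x ≠ 0 := by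
  by_cases h : x = 0
  · exact .inl h
  · exact .inr fun h' => h (hl.two _ h')

/-- The facts needed to solve linear equations in `x` with small coefficients. -/
theorem arith (hl : OddModulus l) (x : ZMod l) :
    ((1 : ZMod l) ≠ 0 ∧ (2 : ZMod l) ≠ 0 ∧ (3 : ZMod l) ≠ 0 ∧ (4 : ZMod l) ≠ 0 ∧
      (6 : ZMod l) ≠ 0) ∧ (x = 0 ∨ 2 * x ≠ 0) ∧ (x - 1 = 0 ∨ 2 * (x - 1) ≠ 0) ∧
      (x + 1 = 0 ∨ 2 * (x + 1) ≠ 0) ∧ (x - 2 = 0 ∨ 2 * (x - 2) ≠ 0) ∧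
      (x + 2 = 0 ∨ 2 * (x + 2) ≠ 0) :=
  ⟨⟨hl.ne1, hl.ne2, hl.ne3, hl.ne4, hl.ne6⟩, hl.eq_zero_or _, hl.eq_zero_or _, hl.eq_zero_or _,
    hl.eq_zero_or _, hl.eq_zero_or _⟩

end OddModulus

/-- The effect of a transposition of neighbouring residues on the shifted weights
`2 i_r + r - 1`. -/
def sw {l : ℕ} (p : ℕ) (w : ℕ → ZMod l) : ℕ → ZMod l :=
  fun m => if m = p then w (p + 1) - 1 else if m = p + 1 then w p + 1 else w m

section sw
variable {l : ℕ} (p : ℕ) (w : ℕ → ZMod l)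

@[simp] theorem sw_self : sw p w p = w (p + 1) - 1 := by simp [sw]
@[simp] theorem sw_succ : sw p w (p + 1) = w p + 1 := by simp [sw]
theorem sw_of_ne {m : ℕ} (h1 : m ≠ p) (h2 : m ≠ p + 1) : sw p w m = w m := by simp [sw, h1, h2]
@[simp] theorem sw_pred : sw (p + 1) w p = w p := sw_of_ne _ _ (by omega) (by omega)
@[simp] theorem sw_next : sw p w (p + 1 + 1) = w (p + 1 + 1) :=
  sw_of_ne _ _ (by omega) (by omega)
@[simp] theorem sw_next' : sw p w (p + 1 + 1 + 1) = w (p + 1 + 1 + 1) :=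
  sw_of_ne _ _ (by omega) (by omega)

theorem sw_sw : sw p (sw p w) = w := by
  funext m
  simp only [sw]
  split_ifs <;> simp_all

theorem sw_eq_self (h : w (p + 1) = w p + 1) : sw p w = w := by
  funext m
  simp only [sw]
  split_ifs <;> simp_all

end sw

/-- A left action of the Khovanov–Lauda–Rouquier relations on weight vectors inside an algebra. -/
structure KAct (l n : ℕ) (A : Type*) [Ring A] [Algebra ℂ A] where
  On : (ℕ → ZMod l) → A → Prop
  y : ℕ → A
  P : ℕ → A
  on_y : ∀ {w a r}, r < n → On w a → On w (y r * a)
  on_P : ∀ {w a r}, r + 1 < n → On w a → On (sw r w) (P r * a)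
  on_add : ∀ {w a b}, On w a → On w b → On w (a + b)
  on_sub : ∀ {w a b}, On w a → On w b → On w (a - b)
  on_smul : ∀ {w a} (c : ℂ), On w a → On w (c • a)
  ext : ∀ {x : A}, (∀ w a, On w a → x * a = 0) → x = 0
  glue : ∀ {r}, r + 1 < n → ∀ F : ZMod l → ZMod l → A,
    ∃ x : A, ∀ w a, On w a → x * a = F (w r) (w (r + 1)) * a
  cyc : ∀ {w a}, On w a → w 0 ≠ -1 → a = 0
  y_zero : y 0 = 0
  bad : ∀ {w a}, On w a → w 0 = -1 → w 1 = 2 → w 2 = 5 → a = 0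
  yy : ∀ r s, y r * y s = y s * y r
  Py_far : ∀ {r s}, r + 1 < n → s < n → s ≠ r → s ≠ r + 1 → P r * y s = y s * P r
  PP_far : ∀ {r s}, r + 1 < s → s + 1 < n → P r * P s = P s * P r
  Py_eq : ∀ {w a r}, r + 1 < n → On w a → w (r + 1) = w r + 1 →
    P r * (y (r + 1) * a) = y r * (P r * a) + a
  yP_eq : ∀ {w a r}, r + 1 < n → On w a → w (r + 1) = w r + 1 →
    y (r + 1) * (P r * a) = P r * (y r * a) + a
  Py_ne : ∀ {w a r}, r + 1 < n → On w a → w (r + 1) ≠ w r + 1 →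
    P r * (y (r + 1) * a) = y r * (P r * a)
  yP_ne : ∀ {w a r}, r + 1 < n → On w a → w (r + 1) ≠ w r + 1 →
    y (r + 1) * (P r * a) = P r * (y r * a)
  sq_eq : ∀ {w a r}, r + 1 < n → On w a → w (r + 1) = w r + 1 → P r * (P r * a) = 0
  sq_up : ∀ {w a r}, r + 1 < n → On w a → w (r + 1) = w r + 3 →
    P r * (P r * a) = y (r + 1) * a - y r * a
  sq_down : ∀ {w a r}, r + 1 < n → On w a → w (r + 1) = w r - 1 →
    P r * (P r * a) = y r * a - y (r + 1) * a
  sq_far : ∀ {w a r}, r + 1 < n → On w a → w (r + 1) ≠ w r + 1 → w (r + 1) ≠ w r + 3 →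
    w (r + 1) ≠ w r - 1 → P r * (P r * a) = a
  braid_up : ∀ {w a r}, r + 2 < n → On w a → w (r + 1) = w r + 3 → w (r + 2) = w r + 2 →
    P r * (P (r + 1) * (P r * a)) = P (r + 1) * (P r * (P (r + 1) * a)) + a
  braid_down : ∀ {w a r}, r + 2 < n → On w a → w (r + 1) = w r - 1 → w (r + 2) = w r + 2 →
    P r * (P (r + 1) * (P r * a)) = P (r + 1) * (P r * (P (r + 1) * a)) - a

namespace KAct
variable {l n : ℕ} {A : Type*} [Ring A] [Algebra ℂ A] (K : KAct l n A)

theorem y_left_comm (r s : ℕ) (a : A) : K.y r * (K.y s * a) = K.y s * (K.y r * a) := by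
  rw [← mul_assoc, K.yy, mul_assoc]

theorem Py_left (r s : ℕ) (a : A) (hr : r + 1 < n) (hs : s < n) (h1 : s ≠ r) (h2 : s ≠ r + 1) :
    K.P r * (K.y s * a) = K.y s * (K.P r * a) := by
  rw [← mul_assoc, K.Py_far hr hs h1 h2, mul_assoc]

/-- If two neighbouring residues agree and `y_p` acts by something commuting with `ψ_p`,
the weight space vanishes. -/
theorem nilHecke_left {p : ℕ} (hp : p + 1 < n) {w : ℕ → ZMod l} (hw : w (p + 1) = w p + 1)
    {z : A} (hz : K.P p * z = z * K.P p) (h : ∀ b, K.On w b → K.y p * b = z * b)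
    {a : A} (ha : K.On w a) : a = 0 := by
  have hP : ∀ b, K.On w b → K.On w (K.P p * b) := fun b hb => by
    have := K.on_P hp hb
    rwa [sw_eq_self p w hw] at this
  have key : ∀ b, K.On w b → K.y (p + 1) * (K.P p * b) = z * (K.P p * b) + b := fun b hb => by
    rw [K.yP_eq hp hb hw, h b hb, ← mul_assoc, hz, mul_assoc]
  have h1 := key _ (hP a ha)
  rw [K.sq_eq hp ha hw] at h1
  have h2 : K.P p * a = 0 := by simpa using h1.symm
  have h3 := key a ha
  rw [h2] at h3
  simpa using h3.symm

theorem nilHecke_right {p : ℕ} (hp : p + 1 < n) {w : ℕ → ZMod l} (hw : w (p + 1) = w p + 1)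
    {z : A} (hz : K.P p * z = z * K.P p) (h : ∀ b, K.On w b → K.y (p + 1) * b = z * b)
    {a : A} (ha : K.On w a) : a = 0 := by
  have hP : ∀ b, K.On w b → K.On w (K.P p * b) := fun b hb => by
    have := K.on_P hp hb
    rwa [sw_eq_self p w hw] at this
  have key : ∀ b, K.On w b → z * (K.P p * b) = K.y p * (K.P p * b) + b := fun b hb => by
    rw [← K.Py_eq hp hb hw, h b hb, ← mul_assoc, ← mul_assoc, hz]
  have h1 := key _ (hP a ha)
  rw [K.sq_eq hp ha hw] at h1
  have h2 : K.P p * a = 0 := by simpa using h1.symm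
  have h3 := key a ha
  rw [h2] at h3
  simpa using h3.symm

/-- The possible neighbouring weights at positions `p, p + 1`, and the resulting relation
between `y_p` and `y_{p+1}`. -/
structure Step (p : ℕ) : Prop where
  zero : ∀ {w a}, K.On w a → w (p + 1) ≠ w p - 1 → w (p + 1) ≠ 1 - w p → a = 0
  same : ∀ {w a}, K.On w a → w (p + 1) = w p - 1 → w p ≠ 1 → K.y (p + 1) * a = K.y p * a
  opp : ∀ {w a}, K.On w a → w (p + 1) = 1 - w p → w p ≠ 1 → K.y (p + 1) * a = -(K.y p * a)

end KAct

namespace KAct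
variable {l n : ℕ} {A : Type*} [Ring A] [Algebra ℂ A] {K : KAct l n A}

theorem Step.valid {p : ℕ} (h : K.Step p) {w a} (ha : K.On w a) :
    a = 0 ∨ w (p + 1) = w p - 1 ∨ w (p + 1) = 1 - w p := by
  by_contra! hc
  exact hc.1 (h.zero ha hc.2.1 hc.2.2)

theorem down_of_step (hl : OddModulus l) {p : ℕ} (hp : p + 1 < n)
    (ih : ∀ m < p, K.Step m) {w a} (ha : K.On w a)
    (h : w (p + 1) = w p - 1) (hk : w p ≠ 1) : K.y (p + 1) * a = K.y p * a := by
  suffices hP : K.P p * a = 0 by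
    have := K.sq_down hp ha h
    rw [hP, mul_zero, eq_comm, sub_eq_zero] at this
    exact this.symm
  have hb := K.on_P hp ha
  have ar := hl.arith (w p)
  obtain _ | m := p
  · rcases eq_or_ne (w 0) (-1) with h0 | h0
    · refine K.cyc hb ?_
      simp only [sw_self]
      grind
    · rw [K.cyc ha h0, mul_zero]
  · have hm := ih m (by omega)
    rcases hm.valid ha with h0 | hv
    · rw [h0, mul_zero]
    · refine hm.zero hb ?_ ?_ <;> simp only [sw_self, sw_pred] <;> grind

theorem eq_of_step (hl : OddModulus l) {p : ℕ} (hp : p + 1 < n)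
    (ih : ∀ m < p, K.Step m) {w a} (ha : K.On w a)
    (h : w (p + 1) = w p + 1) : (w p ≠ 0 → a = 0) ∧ K.y (p + 1) * a = - (K.y p * a) := by
  have ar := hl.arith (w p)
  obtain _ | m := p
  · suffices a = 0 by simp [this]
    exact K.nilHecke_left hp h (z := 0) (by simp) (fun b hb => by simp [K.y_zero]) ha
  have hm := ih m (by omega)
  have ne1 : m ≠ m + 1 := by omega
  have ne2 : m ≠ m + 1 + 1 := by omega
  have hPy := K.Py_far hp (s := m) (by omega) ne1 ne2
  by_cases hjk : w m = 1 ∧ w (m + 1) = 0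
  · refine ⟨fun h0 => absurd hjk.2 h0, ?_⟩
    obtain ⟨hj, hk⟩ := hjk
    have h2 : w (m + 1 + 1) = 1 := by rw [h, hk, zero_add]
    have hsw := sw_eq_self (m + 1) w h
    have onP : ∀ b, K.On w b → K.On w (K.P (m + 1) * b) := fun b hb => by
      have := K.on_P hp hb
      rwa [hsw] at this
    have dn : ∀ b, K.On (sw m w) b → K.y (m + 1 + 1) * b = K.y (m + 1) * b := fun b hb => by
      refine down_of_step hl hp ih hb ?_ ?_ <;> simp only [sw_succ, sw_next] <;> grind
    have op : ∀ b, K.On (sw m w) b → K.y (m + 1) * b = - (K.y m * b) := fun b hb => by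
      refine hm.opp hb ?_ ?_ <;> simp only [sw_succ, sw_self] <;> grind
    have key : ∀ b, K.On w b →
        (K.y (m + 1) + K.y (m + 1 + 1)) * (K.P (m + 1) * b) = 0 := fun b hb => by
      have hPb := onP b hb
      have hc := K.on_P (r := m) (by omega) hPb
      have e1 : (K.y m + K.y (m + 1 + 1)) * (K.P m * (K.P (m + 1) * b)) = 0 := by
        rw [add_mul, dn _ hc, op _ hc, add_neg_cancel]
      have e2 := K.yP_ne (r := m) (by omega) hc (by simp only [sw_succ, sw_self]; grind)
      have e3 := K.Py_left m (m + 1 + 1) (K.P m * (K.P (m + 1) * b)) (by omega) (by omega)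
        (by omega) (by omega)
      have e4 := K.sq_down (r := m) (by omega) hPb (by grind)
      have hd := K.on_P (r := m) (by omega) hc
      rw [sw_sw] at hd
      have e5 := K.Py_eq hp hd h
      have e6 := K.yP_eq hp hd h
      have e7 := K.yP_eq hp hPb h
      have e8 := K.Py_left (m + 1) m (K.P (m + 1) * b) hp (by omega) ne1 ne2
      have e9 := K.sq_eq hp hb h
      linear_combination (norm := noncomm_ring) e6 - e5 + K.P (m + 1) * e2 - K.P (m + 1) * e3 +
        K.P (m + 1) * K.P m * e1 + (K.y (m + 1) + K.y (m + 1 + 1)) *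
          (K.y (m + 1 + 1) * e9 - K.P (m + 1) * e4 - e8 - K.y m * e9 - e7)
    have e1 := K.Py_eq hp ha h
    have e2 := key _ (K.on_y hp ha)
    have e3 := key _ ha
    have e4 := K.yy (m + 1) (m + 1 + 1)
    linear_combination (norm := noncomm_ring) e2 - (K.y (m + 1) + K.y (m + 1 + 1)) * e1 -
      K.y (m + 1) * e3 + e4 * (K.P (m + 1) * a)
  · suffices a = 0 by simp [this]
    rcases hm.valid ha with h0 | hv | hv
    · exact h0
    · refine K.nilHecke_left hp h hPy (fun b hb => hm.same hb hv ?_) ha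
      grind
    · refine K.nilHecke_left hp h (z := - K.y m) (by simp [hPy])
        (fun b hb => by rw [neg_mul]; exact hm.opp hb hv (by grind)) ha

theorem far_of_step (hl : OddModulus l) {p : ℕ} (hp : p + 1 < n)
    (ih : ∀ m < p, K.Step m) {w a} (ha : K.On w a) (h1 : w (p + 1) ≠ w p + 1)
    (h2 : w (p + 1) ≠ w p + 3) (h3 : w (p + 1) ≠ w p - 1) :
    (w (p + 1) ≠ 1 - w p → a = 0) ∧
      (w (p + 1) = 1 - w p → K.y (p + 1) * a = - (K.y p * a)) := by
  have hsq := K.sq_far hp ha h1 h2 h3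
  have hb := K.on_P hp ha
  have ar := hl.arith (w p)
  have of_zero : K.P p * a = 0 → a = 0 := fun h => by rw [← hsq, h, mul_zero]
  obtain _ | m := p
  · suffices a = 0 by simp [this]
    rcases eq_or_ne (w 0) (-1) with h0 | h0
    · refine of_zero (K.cyc hb ?_)
      simp only [sw_self]
      grind
    · exact K.cyc ha h0
  · have hm := ih m (by omega)
    have hyP := K.yP_ne hp hb (by simp only [sw_self, sw_succ]; grind)
    rw [hsq] at hyP
    have hPy := K.Py_left (m + 1) m (K.P (m + 1) * a) hp (by omega) (by omega) (by omega)
    rw [hsq] at hPy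
    rcases hm.valid ha with h0 | hv
    · simp [h0]
    rcases hm.valid hb with h0 | hv'
    · simp [of_zero h0]
    simp only [sw_self, sw_pred] at hv'
    refine ⟨fun h => ?_, fun h => ?_⟩
    · exfalso
      grind
    · rcases hv with hv | hv
      · have e1 := hm.same ha hv (by grind)
        have e2 := hm.opp hb (by simp only [sw_self, sw_pred]; grind)
          (by simp only [sw_pred]; grind)
        rw [hyP, e2, mul_neg, hPy, e1]
      · have e1 := hm.opp ha hv (by grind)
        have e2 := hm.same hb (by simp only [sw_self, sw_pred]; grind)
          (by simp only [sw_pred]; grind)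
        rw [hyP, e2, hPy, e1, neg_neg]

theorem psi_up_eq_zero (hl : OddModulus l) {m : ℕ} (hp : m + 1 + 1 < n)
    (ih : ∀ t < m + 1, K.Step t) {w a} (ha : K.On w a)
    (h : w (m + 1 + 1) = w (m + 1) + 3) (hk : w (m + 1) ≠ -1) : K.P (m + 1) * a = 0 := by
  have hb := K.on_P hp ha
  have hm := ih m (by omega)
  have ar := hl.arith (w m)
  rcases hm.valid ha with h0 | hv
  · simp [h0]
  refine hm.zero hb ?_ ?_ <;> simp only [sw_self, sw_pred] <;> grind

theorem up_of_down (hl : OddModulus l) {m : ℕ} (hp : m + 1 + 1 < n)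
    (ih : ∀ t < m + 1, K.Step t) {w a} (ha : K.On w a)
    (h : w (m + 1 + 1) = w (m + 1) + 3) (hk : w (m + 1) ≠ -1) (hj : w (m + 1) = w m - 1) :
    a = 0 := by
  have hP := psi_up_eq_zero hl hp ih ha h hk
  have hbr := K.braid_down hp ha hj (by grind)
  have hb := K.on_P (r := m) (by omega) ha
  have hm := ih m (by omega)
  have ar := hl.arith (w (m + 1))
  suffices h0 : K.P m * a = 0 by
    rw [hP, h0] at hbr
    simpa using hbr.symm
  by_cases h0 : w (m + 1) = 0
  · refine (eq_of_step hl hp ih hb ?_).1 ?_ <;> simp only [sw_succ, sw_next] <;> grind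
  · refine hm.zero hb ?_ ?_ <;> simp only [sw_self, sw_succ] <;> grind

theorem up_eq_zero (hl : OddModulus l) {m : ℕ} (hp : m + 1 + 1 < n)
    (ih : ∀ t < m + 1, K.Step t) {w a} (ha : K.On w a)
    (h : w (m + 1 + 1) = w (m + 1) + 3) (hk : w (m + 1) ≠ -1) : a = 0 := by
  have ar := hl.arith (w (m + 1))
  have hm := ih m (by omega)
  have hb := K.on_P (r := m) (by omega) ha
  rcases hm.valid ha with h0 | hj | hj
  · exact h0
  · exact up_of_down hl hp ih ha h hk hj
  have h4 : w m = 0 ∨ w m = -1 ∨ w m = 1 ∨ (w m ≠ 0 ∧ w m ≠ -1 ∧ w m ≠ 1) := by tauto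
  rcases h4 with h0 | h0 | h0 | ⟨h0, h1, h2⟩
  · refine K.nilHecke_right (p := m) (by omega) (by grind) (z := K.y (m + 1 + 1))
      (K.Py_far (by omega) (by omega) (by omega) (by omega)) (fun b hb => ?_) ha
    have e1 := psi_up_eq_zero hl hp ih hb h hk
    have e2 := K.sq_up hp hb h
    rw [e1, mul_zero, eq_comm, sub_eq_zero] at e2
    exact e2.symm
  · obtain _ | t := m
    · exact K.bad ha h0 (by grind) (by grind)
    have ht := ih t (by omega)
    have hc := K.on_P (r := t) (by omega) ha
    rcases ht.valid ha with h3 | hh | hh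
    · exact h3
    · have e1 : K.P t * a = 0 := by
        refine ht.zero hc ?_ ?_ <;> simp only [sw_self, sw_succ] <;> grind
      have e2 := K.braid_down (r := t) (by omega) ha hh (by grind)
      have e3 : K.P (t + 1 + 1) * (K.P (t + 1) * a) = 0 := by
        refine hm.zero (K.on_P hp hb) ?_ ?_ <;>
          simp only [sw_self, sw_pred, sw_next] <;> grind
      have e4 : K.P (t + 1) * a = 0 := by
        rw [← K.sq_far hp hb, e3, mul_zero] <;> simp only [sw_succ, sw_next] <;> grind
      rw [e1, e4] at e2
      simpa using e2.symm
    · have e1 : K.P t * a = 0 := by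
        refine up_of_down hl hp ih hc ?_ ?_ ?_ <;>
          simp only [sw_succ, sw_next, sw_next'] <;> grind
      rw [← K.sq_far (r := t) (by omega) ha (by grind) (by grind) (by grind), e1, mul_zero]
  · exact up_of_down hl hp ih ha h hk (by grind)
  · have e1 : K.P (m + 1) * (K.P m * a) = 0 := by
      refine hm.zero (K.on_P hp hb) ?_ ?_ <;>
        simp only [sw_self, sw_pred, sw_next] <;> grind
    have e2 : K.P m * a = 0 := by
      rw [← K.sq_far hp hb, e1, mul_zero] <;> simp only [sw_succ, sw_next] <;> grind
    rw [← K.sq_far (r := m) (by omega) ha (by grind) (by grind) (by grind), e2, mul_zero]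


theorem up_opp (hl : OddModulus l) {m : ℕ} (hp : m + 1 + 1 < n)
    (ih : ∀ t < m + 1, K.Step t) {w a} (ha : K.On w a)
    (h : w (m + 1 + 1) = w (m + 1) + 3) (hk : w (m + 1) = -1) :
    K.y (m + 1 + 1) * a = - (K.y (m + 1) * a) := by
  have ar := hl.arith (w (m + 1))
  have hm := ih m (by omega)
  have hb := K.on_P (r := m) (by omega) ha
  rcases hm.valid ha with h0 | hj | hj
  · simp [h0]
  · have e1 : K.P m * a = 0 := by
      refine hm.zero hb ?_ ?_ <;> simp only [sw_self, sw_succ] <;> grind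
    have e2 := K.braid_down hp ha hj (by grind)
    have hc := K.on_P hp ha
    have hd := K.on_P (r := m) (by omega) hc
    have e3 := hm.opp hc (by simp only [sw_self, sw_succ, sw_pred, sw_next]; grind)
      (by simp only [sw_self, sw_succ, sw_pred, sw_next]; grind)
    have e4 := K.yP_ne hp hd (by simp only [sw_self, sw_succ, sw_pred, sw_next]; grind)
    have e5 := hm.opp hd (by simp only [sw_self, sw_succ, sw_pred, sw_next]; grind)
      (by simp only [sw_self, sw_succ, sw_pred, sw_next]; grind)
    have e6 := K.Py_left (m + 1) m (K.P m * (K.P (m + 1) * a)) hp (by omega) (by omega) (by omega)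
    have e7 := hm.same ha hj (by grind)
    rw [e1, mul_zero, mul_zero, eq_comm, sub_eq_zero] at e2
    rw [e5, mul_neg, e6, e2] at e4
    rw [e4, e7]
  · have e1 := K.sq_far (r := m) (by omega) ha (by grind) (by grind) (by grind)
    have e2 := down_of_step hl hp ih hb (by simp only [sw_succ, sw_next]; grind)
      (by simp only [sw_succ]; grind)
    have e3 := K.Py_left m (m + 1 + 1) (K.P m * a) (by omega) hp (by omega) (by omega)
    have e4 := K.Py_ne (r := m) (by omega) hb (by simp only [sw_self, sw_succ]; grind)
    have e5 := hm.opp ha hj (by grind)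
    rw [e1, e2, e4, e1] at e3
    rw [← e3, e5, neg_neg]



theorem up_of_step (hl : OddModulus l) {p : ℕ} (hp : p + 1 < n)
    (ih : ∀ m < p, K.Step m) {w a} (ha : K.On w a) (h : w (p + 1) = w p + 3) :
    (w p ≠ -1 → a = 0) ∧ (w p = -1 → K.y (p + 1) * a = - (K.y p * a)) := by
  have hsq := K.sq_up hp ha h
  have ar := hl.arith (w p)
  obtain _ | m := p
  · refine ⟨K.cyc ha, fun h0 => ?_⟩
    have hP : K.P 0 * a = 0 := K.cyc (K.on_P hp ha) (by simp only [sw_self]; grind)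
    rw [hP, mul_zero, K.y_zero, zero_mul, sub_zero] at hsq
    rw [← hsq, K.y_zero, zero_mul, neg_zero]
  · exact ⟨up_eq_zero hl hp ih ha h, up_opp hl hp ih ha h⟩

/-- Neighbouring weights on a nonzero weight space satisfy `w_{p+1} = ±(w_p - 1)`. -/
theorem step (hl : OddModulus l) : ∀ p, p + 1 < n → K.Step p := by
  intro p
  induction p using Nat.strong_induction_on with
  | _ p ih' =>
    intro hp
    have ih : ∀ m < p, K.Step m := fun m hm => ih' m hm (by omega)
    refine ⟨fun {w a} ha h1 h2 => ?_, fun ha h hk => down_of_step hl hp ih ha h hk,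
      fun {w a} ha h hk => ?_⟩ <;> have ar := hl.arith (w p)
    · by_cases h3 : w (p + 1) = w p + 1
      · exact (eq_of_step hl hp ih ha h3).1 (by grind)
      by_cases h4 : w (p + 1) = w p + 3
      · exact (up_of_step hl hp ih ha h4).1 (by grind)
      exact (far_of_step hl hp ih ha h3 h4 h1).1 h2
    · by_cases h3 : w (p + 1) = w p + 1
      · exact (eq_of_step hl hp ih ha h3).2
      by_cases h4 : w (p + 1) = w p + 3
      · exact (up_of_step hl hp ih ha h4).2 (by grind)
      exact (far_of_step hl hp ih ha h3 h4 (by grind)).2 h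

/-- At the special weights `1, 0` the difference and the sum of neighbouring `y`'s are
orthogonal. -/
theorem sub_mul_add_eq_zero (hl : OddModulus l) {p : ℕ} (hp : p + 1 < n) {w a}
    (ha : K.On w a) (h : w p = 1) (h' : w (p + 1) = 0) :
    (K.y p - K.y (p + 1)) * ((K.y p + K.y (p + 1)) * a) = 0 := by
  have ar := hl.arith (w p)
  have hb := K.on_P hp ha
  have hne : sw p w (p + 1) ≠ sw p w p + 1 := by simp only [sw_self, sw_succ]; grind
  have e1 := (K.step hl p hp).opp hb (by simp only [sw_self, sw_succ]; grind)
    (by simp only [sw_self]; grind)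
  have hab : K.On w ((K.y p + K.y (p + 1)) * a) := by
    rw [add_mul]
    exact K.on_add (K.on_y (by omega) ha) (K.on_y hp ha)
  have e2 := K.sq_down hp hab (by grind)
  have e3 := K.Py_ne hp ha (by grind)
  have e4 := K.yP_ne hp ha (by grind)
  linear_combination (norm := noncomm_ring) -e2 + K.P p * (e3 + e1 - e4)

theorem y_sq (hl : OddModulus l) :
    ∀ p, p < n → K.y p * K.y p = 0 := by
  intro p
  induction p with
  | zero => simp [K.y_zero]
  | succ p ih =>
    intro hp
    refine K.ext fun w a ha => ?_
    have ih := ih (by omega)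
    have st := K.step hl p hp
    by_cases hk : w p = 1 ∧ w (p + 1) = 0
    · have e1 := sub_mul_add_eq_zero hl hp ha hk.1 hk.2
      have e2 := K.yy p (p + 1)
      linear_combination (norm := noncomm_ring) ih * a + e2 * a - e1
    · have hya := K.on_y (r := p) (by omega) ha
      have hya' := K.on_y hp ha
      rcases st.valid ha with h0 | h | h
      · simp [h0]
      · have e := st.same ha h (by grind)
        have e' := st.same hya' h (by grind)
        rw [mul_assoc, e', e, ← mul_assoc, ih, zero_mul]
      · have e := st.opp ha h (by grind)
        have e' := st.opp hya' h (by grind)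
        rw [mul_assoc, e', e, mul_neg, neg_neg, ← mul_assoc, ih, zero_mul]

end KAct

/-- The shifted quantum integers attached to a character of `ℤ/lℤ`. -/
def sinh {l : ℕ} (χ : AddChar (ZMod l) ℂ) (k : ZMod l) : ℂ := χ k - χ (-k)

section coefficients
variable {l : ℕ} (χ : AddChar (ZMod l) ℂ)

/-- The constant coefficient of the weight-`k` renormalisation of `ψ`. -/
def coefConst (k : ZMod l) : ℂ :=
  if k = 0 then - sinh χ 1 else if k = 1 then - (sinh χ 1)⁻¹ else - sinh χ (k - 1) / sinh χ k

/-- The linear coefficient of the weight-`k` renormalisation of `ψ`. -/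
def coefLin (k : ZMod l) : ℂ :=
  if k = 0 then χ 1 + χ (-1) else if k = 1 then (χ 1 + χ (-1)) / sinh χ 1 ^ 2
  else - 2 * sinh χ 1 / sinh χ k ^ 2

variable {χ}

theorem sinh_ne_zero (hl : OddModulus l) (hχ : ∀ k, χ k = 1 → k = 0) {k : ZMod l} (hk : k ≠ 0) :
    sinh χ k ≠ 0 := by
  intro h
  refine hk (hl.two k (hχ _ ?_))
  rw [sinh, sub_eq_zero] at h
  rw [two_mul, AddChar.map_add_eq_mul]
  nth_rewrite 1 [h]
  rw [← AddChar.map_add_eq_mul, neg_add_cancel, AddChar.map_zero_eq_one]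

theorem char_ne_zero (k : ZMod l) : χ k ≠ 0 := fun h => by
  have := AddChar.map_add_eq_mul χ k (-k)
  rw [add_neg_cancel, AddChar.map_zero_eq_one, h, zero_mul] at this
  exact one_ne_zero this

theorem char_neg (k : ZMod l) : χ (-k) = (χ k)⁻¹ :=
  eq_inv_of_mul_eq_one_left (by rw [← AddChar.map_add_eq_mul, neg_add_cancel,
    AddChar.map_zero_eq_one])

theorem char_sub (k j : ZMod l) : χ (k - j) = χ k * (χ j)⁻¹ := by
  rw [sub_eq_add_neg, AddChar.map_add_eq_mul, char_neg]

theorem sinh_neg (k : ZMod l) : sinh χ (-k) = - sinh χ k := by simp [sinh]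

theorem coefConst_mul (hl : OddModulus l) (hχ : ∀ k, χ k = 1 → k = 0) (k : ZMod l) :
    coefConst χ (1 - k) * coefConst χ k = 1 := by
  have h1 := sinh_ne_zero hl hχ hl.ne1
  have n1 := hl.ne1
  unfold coefConst
  by_cases hk : k = 0
  · simp [hk, n1, h1]
  by_cases hk' : k = 1
  · simp [hk', n1, h1]
  have e1 : 1 - k ≠ 0 := sub_ne_zero.2 (Ne.symm hk')
  have e2 := sinh_ne_zero hl hχ hk
  have e3 : 1 - k - 1 = - k := by ring
  have e4 : sinh χ (k - 1) ≠ 0 := sinh_ne_zero hl hχ (sub_ne_zero.2 hk')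
  have e5 : sinh χ (1 - k) = - sinh χ (k - 1) := by rw [← sinh_neg]; congr 1; ring
  simp only [hk, hk', e1, if_false, e3, e5, sinh_neg, sub_eq_self]
  field_simp

theorem coefLin_cross (hl : OddModulus l) (hχ : ∀ k, χ k = 1 → k = 0) (k : ZMod l) :
    coefLin χ (1 - k) * coefConst χ k = coefConst χ (1 - k) * coefLin χ k := by
  have h1 := sinh_ne_zero hl hχ hl.ne1
  have n1 := hl.ne1
  unfold coefConst coefLin
  by_cases hk : k = 0
  · simp only [hk, n1, sub_zero, if_true, if_false]
    field_simp
  by_cases hk' : k = 1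
  · simp only [hk', n1, sub_self, if_true, if_false]
    field_simp
  have e1 : 1 - k ≠ 0 := sub_ne_zero.2 (Ne.symm hk')
  have e2 := sinh_ne_zero hl hχ hk
  have e3 : 1 - k - 1 = - k := by ring
  have e4 : sinh χ (k - 1) ≠ 0 := sinh_ne_zero hl hχ (sub_ne_zero.2 hk')
  have e5 : sinh χ (1 - k) = - sinh χ (k - 1) := by rw [← sinh_neg]; congr 1; ring
  simp only [hk, hk', e1, if_false, e3, e5, sinh_neg, sub_eq_self]
  field_simp

theorem coefConst_add_neg (hl : OddModulus l) (hχ : ∀ k, χ k = 1 → k = 0) {k : ZMod l}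
    (h0 : k ≠ 0) (h1 : k ≠ 1) (h2 : k ≠ -1) :
    coefConst χ k + coefConst χ (-k) = -(χ 1 + χ (-1)) := by
  have e2 := sinh_ne_zero hl hχ h0
  have h3 : -k ≠ 1 := fun h => h2 (by rw [← h, neg_neg])
  simp only [coefConst, h0, h1, h3, neg_eq_zero, if_false, sinh_neg]
  field_simp
  have e4 : -k - 1 = -(k + 1) := by ring
  rw [e4, sinh_neg]
  simp only [sinh, char_neg, char_sub, AddChar.map_add_eq_mul]
  have := char_ne_zero (χ := χ) k
  have := char_ne_zero (χ := χ) 1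
  field_simp
  ring

theorem coefLin_neg {k : ZMod l} (h0 : k ≠ 0) (h1 : k ≠ 1) (h2 : k ≠ -1) :
    coefLin χ (-k) = coefLin χ k := by
  have h3 : -k ≠ 1 := fun h => h2 (by rw [← h, neg_neg])
  simp only [coefLin, h0, h1, h3, neg_eq_zero, if_false, sinh_neg, even_two, Even.neg_pow]

theorem neg_one_ne_one (hl : OddModulus l) : (-1 : ZMod l) ≠ 1 := fun h =>
  hl.ne2 (by linear_combination -h)

theorem coefConst_neg_one (hl : OddModulus l) (hχ : ∀ k, χ k = 1 → k = 0) :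
    coefConst χ (-1) = -(χ 1 + χ (-1)) := by
  have h1 := sinh_ne_zero hl hχ hl.ne1
  have e1 : (-1 : ZMod l) - 1 = -(1 + 1) := by ring
  rw [coefConst, if_neg (neg_ne_zero.2 hl.ne1), if_neg (neg_one_ne_one hl), e1, sinh_neg, sinh_neg]
  field_simp
  simp only [sinh, char_neg, AddChar.map_add_eq_mul]
  have := char_ne_zero (χ := χ) 1
  field_simp
  ring

theorem coefLin_neg_one (hl : OddModulus l) (hχ : ∀ k, χ k = 1 → k = 0) :
    coefLin χ (-1) = 2 * coefConst χ 1 := by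
  have h1 := sinh_ne_zero hl hχ hl.ne1
  rw [coefLin, if_neg (neg_ne_zero.2 hl.ne1), if_neg (neg_one_ne_one hl), coefConst,
    if_neg hl.ne1, if_pos rfl, sinh_neg]
  field_simp

theorem char_one_sub (k : ZMod l) : χ (1 - k) = χ 1 * χ (-k) := by
  rw [sub_eq_add_neg, AddChar.map_add_eq_mul]

theorem sinh_coefConst_one (hl : OddModulus l) (hχ : ∀ k, χ k = 1 → k = 0) :
    χ 1 * coefConst χ 1 - χ (-1) * coefConst χ 1 = -1 := by
  have s1 := sinh_ne_zero hl hχ hl.ne1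
  rw [coefConst, if_neg hl.ne1, if_pos rfl, ← sub_mul, ← sinh]
  field_simp

theorem sinh_coefLin_one (hl : OddModulus l) (hχ : ∀ k, χ k = 1 → k = 0) :
    χ 1 * coefConst χ 1 + χ (-1) * coefConst χ 1 + χ 1 * coefLin χ 1
      - χ (-1) * coefLin χ 1 = 0 := by
  have s1 := sinh_ne_zero hl hχ hl.ne1
  rw [coefConst, if_neg hl.ne1, if_pos rfl, coefLin, if_neg hl.ne1, if_pos rfl]
  have : χ (-1) = χ 1 - sinh χ 1 := by rw [sinh]; ring
  rw [this]
  field_simp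
  ring

theorem sinh_coefConst (hl : OddModulus l) (hχ : ∀ k, χ k = 1 → k = 0) {k : ZMod l}
    (h0 : k ≠ 0) (h1 : k ≠ 1) :
    χ k * coefConst χ k - χ (-k) * coefConst χ k + χ (-1) * χ k - χ 1 * χ (-k) = 0 := by
  have s1 := sinh_ne_zero hl hχ h0
  rw [coefConst, if_neg h0, if_neg h1, ← sub_mul, ← sinh]
  have e1 : χ (-(k - 1)) = χ 1 * χ (-k) := by rw [neg_sub, char_one_sub]
  have e2 : χ (k - 1) = χ (-1) * χ k := by
    rw [sub_eq_add_neg, AddChar.map_add_eq_mul, mul_comm]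
  field_simp
  rw [sinh, e1, e2]
  ring

theorem sinh_coefLin (hl : OddModulus l) (hχ : ∀ k, χ k = 1 → k = 0) {k : ZMod l}
    (h0 : k ≠ 0) (h1 : k ≠ 1) :
    χ k * coefConst χ k + χ (-k) * coefConst χ k + χ k * coefLin χ k
      - χ (-k) * coefLin χ k + χ (-1) * χ k + χ 1 * χ (-k) = 0 := by
  have s1 := sinh_ne_zero hl hχ h0
  have c1 := char_ne_zero (χ := χ) k
  have c2 := char_ne_zero (χ := χ) 1
  rw [coefConst, if_neg h0, if_neg h1, coefLin, if_neg h0, if_neg h1]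
  field_simp
  simp only [sinh, sub_eq_add_neg k, AddChar.map_add_eq_mul, char_neg]
  field_simp
  ring

end coefficients

namespace KAct
variable {l n : ℕ} {A : Type*} [Ring A] [Algebra ℂ A] (K : KAct l n A) (χ : AddChar (ZMod l) ℂ)

/-- The unit by which `ψ_p` is renormalised at weight `k`. -/
def V (p : ℕ) (k : ZMod l) : A := coefConst χ k • 1 + coefLin χ k • K.y p

/-- The diagonal part of the Temperley–Lieb generator at weight `k`. -/
def C (p : ℕ) (k : ZMod l) : A :=
  if k = 0 then 0 else if k = 1 then K.y p - K.y (p + 1) else 1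

theorem exists_U (p : ℕ) (hp : p + 1 < n) : ∃ x : A, ∀ w a, K.On w a →
    x * a = (if w (p + 1) = 1 - w p then (K.P p + K.C p (w p)) * K.V χ p (w p) else 0) * a :=
  K.glue hp fun k k' => if k' = 1 - k then (K.P p + K.C p k) * K.V χ p k else 0

open Classical in
/-- The Temperley–Lieb generators. -/
def U (p : ℕ) : A := if hp : p + 1 < n then (K.exists_U χ p hp).choose else 0

variable {K χ}

theorem U_apply {p : ℕ} (hp : p + 1 < n) {w a} (ha : K.On w a) : K.U χ p * a =
    (if w (p + 1) = 1 - w p then (K.P p + K.C p (w p)) * K.V χ p (w p) else 0) * a := by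
  rw [U, dif_pos hp]
  exact (K.exists_U χ p hp).choose_spec w a ha

theorem U_of_ne {p : ℕ} (hp : p + 1 < n) {w a} (ha : K.On w a) (h : w (p + 1) ≠ 1 - w p) :
    K.U χ p * a = 0 := by
  rw [U_apply hp ha, if_neg h, zero_mul]

theorem U_of_eq {p : ℕ} (hp : p + 1 < n) {w a} (ha : K.On w a) (h : w (p + 1) = 1 - w p) :
    K.U χ p * a = K.P p * (K.V χ p (w p) * a) + K.C p (w p) * (K.V χ p (w p) * a) := by
  rw [U_apply hp ha, if_pos h, mul_assoc, add_mul]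

theorem on_V {p : ℕ} (hp : p < n) {w a} (k : ZMod l) (ha : K.On w a) :
    K.On w (K.V χ p k * a) := by
  rw [V, add_mul, smul_mul_assoc, smul_mul_assoc, one_mul]
  exact K.on_add (K.on_smul _ ha) (K.on_smul _ (K.on_y hp ha))

theorem V_mul (p : ℕ) (k : ZMod l) (a : A) :
    K.V χ p k * a = coefConst χ k • a + coefLin χ k • (K.y p * a) := by
  simp [V, add_mul]

theorem y_V (r p : ℕ) (k : ZMod l) (a : A) :
    K.y r * (K.V χ p k * a) = K.V χ p k * (K.y r * a) := by
  simp only [V_mul, mul_add, mul_smul_comm, K.y_left_comm r p]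

theorem V_cancel (hl : OddModulus l) (hχ : ∀ k, χ k = 1 → k = 0) {p r : ℕ} (hp : p < n)
    (k : ZMod l) {a : A} (h : K.y r * a = - (K.y p * a)) :
    K.V χ r (1 - k) * (K.V χ p k * a) = a := by
  have h1 := coefConst_mul hl hχ k
  have h2 := coefLin_cross hl hχ k
  have h3 : K.y p * (K.y p * a) = 0 := by rw [← mul_assoc, K.y_sq hl p hp, zero_mul]
  have h4 : K.y r * (K.y p * a) = 0 := by rw [K.y_left_comm, h, mul_neg, h3, neg_zero]
  simp only [V_mul, mul_add, mul_smul_comm, smul_add, h4, h, smul_zero, add_zero]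
  linear_combination (norm := module) h1 • a - h2 • (K.y p * a)

theorem P_V_opp {p : ℕ} (hp : p + 1 < n) {w a} (ha : K.On w a) (hne : w (p + 1) ≠ w p + 1)
    (k : ZMod l) : K.V χ p k * (K.P p * a) = K.P p * (K.V χ (p + 1) k * a) := by
  simp only [V_mul, mul_add, mul_smul_comm, K.Py_ne hp ha hne]

theorem U_sq (hl : OddModulus l) (hχ : ∀ k, χ k = 1 → k = 0) {p : ℕ} (hp : p + 1 < n) :
    K.U χ p * K.U χ p = -(χ 1 + χ (-1)) • K.U χ p := by
  rw [← sub_eq_zero]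
  refine K.ext fun w a ha => ?_
  rw [sub_mul, sub_eq_zero, mul_assoc, smul_mul_assoc]
  have ar := hl.arith (w p)
  have st := K.step hl p hp
  by_cases h : w (p + 1) = 1 - w p
  swap
  · simp [U_of_ne hp ha h]
  have hv := on_V (χ := χ) (p := p) (by omega) (w p) ha
  have hPv := K.on_P hp hv
  rw [U_of_eq hp ha h]
  generalize hvdef : K.V χ p (w p) * a = v at *
  have hys : ∀ b : A, K.y p * (K.y p * b) = 0 := fun b => by
    rw [← mul_assoc, K.y_sq hl p (by omega), zero_mul]
  have hys' : ∀ b : A, K.y (p + 1) * (K.y (p + 1) * b) = 0 := fun b => by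
    rw [← mul_assoc, K.y_sq hl (p + 1) (by omega), zero_mul]
  have e0 := U_of_eq (χ := χ) hp hPv (by simp only [sw_self, sw_succ]; grind)
  rw [sw_self] at e0
  by_cases hk0 : w p = 0
  · have e1 : w (p + 1) - 1 = 0 := by rw [h, hk0]; ring
    have hw : w (p + 1) = w p + 1 := by rw [h, hk0]; ring
    have c0 : K.C p 0 = 0 := if_pos rfl
    have e2 := K.Py_eq hp hv hw
    have e3 := K.sq_eq hp hv hw
    have e4 := K.sq_eq hp (K.on_y hp hv) hw
    rw [e1, c0, zero_mul, add_zero, V_mul, coefLin, if_pos rfl] at e0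
    rw [hk0, c0, zero_mul, add_zero, e0]
    linear_combination (norm := skip) coefConst χ 0 • e3 - (χ 1 + χ (-1)) • (K.P p * e2) +
      (χ 1 + χ (-1)) • e4
    simp only [mul_add, mul_smul_comm, mul_sub]
    module
  by_cases hk1 : w p = 1
  · have hw : w (p + 1) = w p - 1 := by rw [h, hk1]
    have e1 : w (p + 1) - 1 = -1 := by rw [h, hk1]; ring
    have c1 : K.C p 1 = K.y p - K.y (p + 1) := by simp [C, hl.ne1]
    have c2 : K.C p (-1) = 1 := by simp [C, hl.ne1, neg_one_ne_one hl]
    rw [e1, c2, one_mul, P_V_opp hp hv (by grind),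
      K.sq_down hp (on_V hp _ hv) hw, V_mul, coefConst_neg_one hl hχ, coefLin_neg_one hl hχ] at e0
    have hd := K.on_sub (K.on_y (r := p) (by omega) hv) (K.on_y hp hv)
    have e2 := U_of_eq (χ := χ) hp hd h
    have b1 := K.Py_ne hp ha (by grind)
    have b2 := K.yP_ne hp ha (by grind)
    have b3 := st.opp (K.on_P hp ha) (by simp only [sw_self, sw_succ]; grind)
      (by simp only [sw_self]; grind)
    rw [hk1, c1, V_mul] at e2
    have h1 := hvdef
    rw [hk1, V_mul] at h1
    rw [hk1, c1, mul_add, e0, sub_mul, e2, ← h1]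
    have b4 : K.P p * (K.y p * a) = -(K.P p * (K.y (p + 1) * a)) := by rw [← b2, b3, b1]
    simp only [mul_add, mul_sub, sub_mul, mul_smul_comm, smul_add, smul_sub, hys, hys',
      K.y_left_comm (p + 1) p, mul_zero, smul_zero, sub_zero, add_zero, zero_sub, mul_neg, b4]
    module
  by_cases hk2 : w p = -1
  · have hw : w (p + 1) = w p + 3 := by rw [h, hk2]; ring
    have e1 : w (p + 1) - 1 = 1 := by rw [h, hk2]; ring
    have c1 : K.C p 1 = K.y p - K.y (p + 1) := by simp [C, hl.ne1]
    have c2 : K.C p (-1) = 1 := by simp [C, hl.ne1, neg_one_ne_one hl]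
    have op := st.opp hv h hk1
    have e2 := U_of_eq (χ := χ) hp hv h
    rw [e1, c1, P_V_opp hp hv (by grind), K.sq_up hp (on_V hp _ hv) hw, V_mul, op, sub_mul] at e0
    rw [hk2, c2, one_mul, V_mul, coefConst_neg_one hl hχ, coefLin_neg_one hl hχ] at e2
    have b1 := K.Py_ne hp (on_V (χ := χ) hp 1 hv) (by grind)
    have b2 := K.yP_ne hp (on_V (χ := χ) hp 1 hv) (by grind)
    rw [V_mul, op] at b1 b2
    rw [hk2, c2, one_mul, mul_add, e0, e2, b2, ← b1]
    simp only [mul_add, mul_sub, sub_mul, mul_smul_comm, smul_add, smul_sub, hys, hys',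
      K.y_left_comm (p + 1) p, mul_zero, smul_zero, sub_zero, add_zero, zero_sub, mul_neg, op,
      smul_neg, neg_zero]
    module
  have e1 : w (p + 1) - 1 = - w p := by rw [h]; ring
  have c1 := coefConst_add_neg hl hχ hk0 hk1 hk2
  have c2 := coefLin_neg (χ := χ) hk0 hk1 hk2
  have c3 : K.C p (w p) = 1 := by simp [C, hk0, hk1]
  have c4 : K.C p (- w p) = 1 := by
    rw [C, if_neg (neg_ne_zero.2 hk0), if_neg (by grind)]
  have c5 := K.sq_far hp hv (by grind) (by grind) (by grind)
  have c6 := st.opp hv h hk1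
  have c7 := U_of_eq (χ := χ) hp hv h
  rw [e1, P_V_opp hp hv (by grind)] at e0
  rw [c3, one_mul] at c7 ⊢
  rw [c4, one_mul] at e0
  rw [mul_add, e0, c7]
  have c8 : K.V χ (p + 1) (- w p) * v = -(χ 1 + χ (-1)) • v - K.V χ p (w p) * v := by
    rw [V_mul, V_mul, c6, c2, ← c1]
    module
  have c9 := K.on_sub (K.on_smul (-(χ 1 + χ (-1))) hv) (on_V (χ := χ) (p := p) (by omega) (w p) hv)
  rw [c8, K.sq_far hp c9 (by grind) (by grind) (by grind)]
  simp only [mul_sub, mul_smul_comm, smul_add]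
  abel

end KAct

namespace KAct
variable {l n : ℕ} {A : Type*} [Ring A] [Algebra ℂ A] {K : KAct l n A} {χ : AddChar (ZMod l) ℂ}

theorem C_zero (p : ℕ) : K.C p 0 = 0 := if_pos rfl

theorem C_one (hl : OddModulus l) (p : ℕ) : K.C p 1 = K.y p - K.y (p + 1) := by
  simp [C, hl.ne1]

theorem C_of_ne (p : ℕ) {k : ZMod l} (h0 : k ≠ 0) (h1 : k ≠ 1) : K.C p k = 1 := by
  simp [C, h0, h1]

theorem on_C {p : ℕ} (hp : p + 1 < n) {w a} (k : ZMod l) (ha : K.On w a) :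
    K.On w (K.C p k * a) := by
  have h1 := K.on_smul 0 ha
  rw [zero_smul] at h1
  rw [C]
  split_ifs
  · simpa using h1
  · rw [sub_mul]
    exact K.on_sub (K.on_y (by omega) ha) (K.on_y hp ha)
  · simpa using ha

theorem P_V_far {p r : ℕ} (hr : r + 1 < n) (hp : p < n) (h1 : p ≠ r) (h2 : p ≠ r + 1)
    (k : ZMod l) (a : A) : K.V χ p k * (K.P r * a) = K.P r * (K.V χ p k * a) := by
  simp only [V_mul, mul_add, mul_smul_comm, K.Py_left r p a hr hp h1 h2]

/-- Away from the weights `0` and `-1`, `ψ_p²` acts as the diagonal part of the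
Temperley–Lieb generator. -/
theorem P_P_eq_C (hl : OddModulus l) {p : ℕ} (hp : p + 1 < n) {w a} (ha : K.On w a)
    (h : w (p + 1) = 1 - w p) (h0 : w p ≠ 0) (h2 : w p ≠ -1) :
    K.P p * (K.P p * a) = K.C p (w p) * a := by
  have ar := hl.arith (w p)
  by_cases h1 : w p = 1
  · rw [h1, C_one hl, K.sq_down hp ha (by grind), sub_mul]
  · rw [C_of_ne _ h0 h1, K.sq_far hp ha (by grind) (by grind) (by grind), one_mul]

theorem opp_P (hl : OddModulus l) {p : ℕ} (hp : p + 1 < n) {w a} (ha : K.On w a)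
    (h : w (p + 1) = 1 - w p) :
    w p ≠ 0 → K.y p * (K.P p * a) = -(K.y (p + 1) * (K.P p * a)) := fun h0 => by
  have ar := hl.arith (w p)
  have st := K.step hl p hp
  by_cases h1 : w p = 1
  · rw [st.opp (K.on_P hp ha) (by simp only [sw_succ, sw_self]; grind)
      (by simp only [sw_self]; grind), neg_neg]
  · rw [K.yP_ne hp ha (by grind), ← K.Py_ne hp ha (by grind), st.opp ha h h1, mul_neg]

theorem UUU_left (hl : OddModulus l) (hχ : ∀ k, χ k = 1 → k = 0) {p : ℕ} (hp : p + 1 + 1 < n)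
    {w a} (ha : K.On w a) :
    K.U χ p * (K.U χ (p + 1) * (K.U χ p * a)) = K.U χ p * a := by
  have ar := hl.arith (w p)
  have hp' : p + 1 < n := by omega
  have st := K.step hl p hp'
  have st' := K.step hl (p + 1) hp
  by_cases h : w (p + 1) = 1 - w p
  swap
  · simp [U_of_ne hp' ha h]
  have hv := on_V (χ := χ) (p := p) (by omega) (w p) ha
  have hPv := K.on_P hp' hv
  have hU := U_of_eq (χ := χ) hp' ha h
  by_cases h3 : w (p + 1 + 1) = w p
  swap
  · by_cases h3' : w (p + 1 + 1) = - w p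
    swap
    · rw [st'.zero ha (by grind) (by grind)]
      simp
    have hk0 : w p ≠ 0 := by grind
    generalize hvdef : K.V χ p (w p) * a = v at *
    have e1 : K.U χ (p + 1) * (K.C p (w p) * v) = 0 :=
      U_of_ne hp (on_C hp' _ hv) (by grind)
    have e2 := U_of_eq (χ := χ) hp hPv (by simp only [sw_succ, sw_next]; grind)
    have on2 := on_V (χ := χ) (p := p + 1) (by omega) (w p + 1) hPv
    have c1 := V_cancel (K := K) (χ := χ) (p := p + 1) (r := p) hl hχ (by omega) (w p + 1)
      (a := K.P p * v) (opp_P hl hp' hv h hk0)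
    rw [show 1 - (w p + 1) = - w p by ring] at c1
    rw [sw_succ] at e2
    by_cases hk : w p = -1
    swap
    · rw [C_of_ne _ (by grind) (by grind), one_mul] at e2
      have e3 := U_of_ne (χ := χ) hp' (K.on_P hp on2)
        (by simp only [sw_pred, sw_self, sw_succ, sw_next]; grind)
      have e4 := U_of_eq (χ := χ) hp' on2 (by simp only [sw_self, sw_succ]; grind)
      rw [sw_self, show w (p + 1) - 1 = - w p by rw [h]; ring, c1,
        C_of_ne _ (by grind) (by grind), one_mul, P_P_eq_C hl hp' hv h hk0 hk] at e4
      rw [hU, mul_add, e1, add_zero, e2, mul_add, e3, zero_add, e4, add_comm]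
    · rw [show w p + 1 = 0 by rw [hk]; ring] at *
      rw [C_zero, zero_mul, add_zero] at e2
      rw [hk, neg_neg] at c1
      have e3 := U_of_eq (χ := χ) hp' (K.on_P hp on2)
        (by simp only [sw_pred, sw_self, sw_succ, sw_next]; grind)
      rw [sw_pred, sw_self, show w (p + 1) - 1 = 1 by rw [h, hk]; ring,
        P_V_far hp (by omega) (by omega) (by omega), c1, C_one hl] at e3
      have z : K.P (p + 1) * v = 0 :=
        st.zero (K.on_P hp hv) (by simp only [sw_pred, sw_self]; grind)
          (by simp only [sw_pred, sw_self]; grind)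
      have b1 := K.braid_up hp hv (by grind) (by grind)
      rw [z, mul_zero, mul_zero, zero_add] at b1
      rw [hU, mul_add, e1, add_zero, e2, e3, b1, hk, C_of_ne _ (by grind) (by grind), one_mul,
        sub_mul]
      have b2 := K.Py_eq hp hPv (by simp only [sw_succ, sw_next]; grind)
      have b3 := K.Py_left (p + 1) p (K.P p * v) hp (by omega) (by omega) (by omega)
      have b4 := K.Py_left p (p + 1 + 1) v hp' (by omega) (by omega) (by omega)
      have b5 := st'.same hv (by grind) (by grind)
      have b6 := K.Py_ne hp' hv (by grind)
      rw [← b3, ← b6, ← b5, b4, b2]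
      abel
  by_cases hk0 : w p = 0
  · have c1 := V_cancel (K := K) (χ := χ) (p := p + 1) (r := p) hl hχ (by omega) 1
      (a := K.P p * (K.V χ p (w p) * a)) (by
        rw [st.opp hPv (by simp only [sw_succ, sw_self]; grind) (by simp only [sw_self]; grind),
          neg_neg])
    have e1 := U_of_eq (χ := χ) hp hPv (by simp only [sw_succ, sw_next]; grind)
    rw [sw_succ, hk0, zero_add, C_one hl] at e1
    rw [sub_self] at c1
    have on2 := on_V (χ := χ) (p := p + 1) (by omega) 1 hPv
    have e2 := U_of_ne (χ := χ) hp' (K.on_P hp on2)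
      (by simp only [sw_pred, sw_self, sw_succ, sw_next]; grind)
    have on3 := K.on_sub (K.on_y (r := p + 1) (by omega) on2)
      (K.on_y (r := p + 1 + 1) (by omega) on2)
    have e3 := U_of_eq (χ := χ) hp' on3 (by simp only [sw_self, sw_succ]; grind)
    rw [sw_self, show w (p + 1) - 1 = 0 by rw [h, hk0]; ring, C_zero, zero_mul, add_zero] at e3
    rw [hk0, C_zero, zero_mul, add_zero] at hU
    rw [hk0] at e2 e3 hPv c1 hv
    generalize K.V χ p 0 * a = v at *
    have e4 : K.V χ p 0 * (K.y (p + 1) * (K.V χ (p + 1) 1 * (K.P p * v)) -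
        K.y (p + 1 + 1) * (K.V χ (p + 1) 1 * (K.P p * v))) =
        K.y (p + 1) * (K.P p * v) - K.y (p + 1 + 1) * (K.P p * v) := by
      rw [mul_sub, ← y_V, ← y_V, c1]
    have b1 := K.Py_eq hp' hPv (by simp only [sw_self, sw_succ]; grind)
    have b2 := K.sq_eq hp' hv (by grind)
    rw [hU, e1, mul_add, e2, zero_add, sub_mul, e3, e4, mul_sub, b1, b2,
      K.Py_left p (p + 1 + 1) _ hp' (by omega) (by omega) (by omega), b2]
    simp
  have e1 : K.U χ (p + 1) * (K.P p * (K.V χ p (w p) * a)) = 0 :=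
    U_of_ne hp hPv (by simp only [sw_succ, sw_next]; grind)
  by_cases hk1 : w p = 1
  · rw [hk1, C_one hl] at hU
    rw [hk1] at e1 hv hPv
    generalize K.V χ p 1 * a = v at *
    have hu := K.on_sub (K.on_y (r := p) (by omega) hv) (K.on_y (r := p + 1) (by omega) hv)
    have e2 := U_of_eq (χ := χ) hp hu (by grind)
    rw [show w (p + 1) = 0 by rw [h, hk1]; ring, C_zero, zero_mul, add_zero] at e2
    have on2 := on_V (χ := χ) (p := p + 1) (by omega) 0 hu
    have e3 := U_of_eq (χ := χ) hp' (K.on_P hp on2) (by simp only [sw_pred, sw_self]; grind)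
    have hys : ∀ b : A, K.y p * (K.y p * b) = 0 := fun b => by
      rw [← mul_assoc, K.y_sq hl p (by omega), zero_mul]
    have hys' : ∀ b : A, K.y (p + 1) * (K.y (p + 1) * b) = 0 := fun b => by
      rw [← mul_assoc, K.y_sq hl (p + 1) (by omega), zero_mul]
    have c1 := V_cancel (K := K) (χ := χ) (p := p + 1) (r := p) hl hχ (by omega) 0
      (a := K.y p * v - K.y (p + 1) * v) (by
        rw [mul_sub, mul_sub, hys, hys', K.y_left_comm p]; abel)
    rw [sub_zero] at c1
    rw [sw_pred, hk1, P_V_far hp (by omega) (by omega) (by omega), c1, C_one hl, ← e2] at e3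
    have b1 := K.Py_eq hp hv (by grind)
    have b2 := st'.opp hv (by grind) (by grind)
    have b3 := K.Py_left (p + 1) p v hp (by omega) (by omega) (by omega)
    have hx := K.on_P hp hv
    have b4 := K.Py_ne hp' hx (by simp only [sw_pred, sw_self]; grind)
    have b5 := K.yP_ne hp' hx (by simp only [sw_pred, sw_self]; grind)
    have b6 := st.opp (K.on_P hp' hx) (by simp only [sw_pred, sw_self, sw_succ]; grind)
      (by simp only [sw_pred, sw_self, sw_succ]; grind)
    have b7 : K.P (p + 1) * (K.y p * v - K.y (p + 1) * v) =
        K.y p * (K.P (p + 1) * v) + K.y (p + 1) * (K.P (p + 1) * v) + v := by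
      rw [mul_sub, b3]
      rw [b2, mul_neg] at b1
      linear_combination (norm := abel) b1
    have b8 : K.P p * (K.y p * (K.P (p + 1) * v)) = - (K.P p * (K.y (p + 1) * (K.P (p + 1) * v)))
        := by rw [← b5, b6, b4]
    rw [hU, mul_add, e1, zero_add, sub_mul, e3, b7]
    simp only [mul_add, sub_mul, b8, hys, hys', K.y_left_comm (p + 1) p]
    abel
  rw [C_of_ne _ hk0 hk1, one_mul] at hU
  have c1 := V_cancel (K := K) (χ := χ) (p := p) (r := p + 1) hl hχ (by omega) (w p)
    (st.opp ha h hk1)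
  have e2 := U_of_eq (χ := χ) hp hv (by grind)
  rw [h, c1, C_of_ne _ (by grind) (by grind), one_mul] at e2
  have e3 := U_of_ne (χ := χ) hp' (K.on_P hp ha) (by simp only [sw_pred, sw_self]; grind)
  nth_rw 1 [hU]
  rw [mul_add, e1, zero_add, e2, mul_add, e3, zero_add]

end KAct

namespace KAct
variable {l n : ℕ} {A : Type*} [Ring A] [Algebra ℂ A] {K : KAct l n A} {χ : AddChar (ZMod l) ℂ}

theorem UUU_right_neg_one (hl : OddModulus l) (hχ : ∀ k, χ k = 1 → k = 0) {p : ℕ}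
    (hp : p + 1 + 1 < n) {w v} (hv : K.On w v) (h0 : w p = 0) (h1 : w (p + 1) = -1)
    (h2 : w (p + 1 + 1) = 2) :
    K.U χ (p + 1) * (K.U χ p * (K.P (p + 1) * v)) = v + K.P (p + 1) * v := by
  have ar := hl.arith (w p)
  have hp' : p + 1 < n := by omega
  have st := K.step hl p hp'
  have st' := K.step hl (p + 1) hp
  have ht := K.on_P hp hv
  have z : K.P p * v = 0 :=
    st'.zero (K.on_P hp' hv) (by simp only [sw_succ, sw_next]; grind)
      (by simp only [sw_succ, sw_next]; grind)
  have b1 := K.braid_down hp hv (by grind) (by grind)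
  rw [z, mul_zero, mul_zero, eq_comm, sub_eq_zero] at b1
  have z' : K.P p * (K.y p * v) = 0 :=
    st'.zero (K.on_P hp' (K.on_y (by omega) hv)) (by simp only [sw_succ, sw_next]; grind)
      (by simp only [sw_succ, sw_next]; grind)
  have b1' := K.braid_down hp (K.on_y (r := p) (by omega) hv) (by grind) (by grind)
  rw [z', mul_zero, mul_zero, eq_comm, sub_eq_zero,
    K.Py_left (p + 1) p _ hp (by omega) (by omega) (by omega)] at b1'
  have b2 := K.sq_up hp hv (by grind)
  have b3 := st'.opp hv (by grind) (by grind)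
  have b4 := st.same hv (by grind) (by grind)
  rw [b3, b4] at b2
  have b5 := K.yP_ne hp hv (by grind)
  rw [b4, K.Py_left (p + 1) p _ hp (by omega) (by omega) (by omega)] at b5
  have b6 := st.opp ht (by simp only [sw_pred, sw_self]; grind) (by simp only [sw_pred]; grind)
  have hys : ∀ b : A, K.y p * (K.y p * b) = 0 := fun b => by
    rw [← mul_assoc, K.y_sq hl p (by omega), zero_mul]
  have b7 : K.P (p + 1) * (K.y p * (K.P (p + 1) * v)) = 0 := by
    rw [K.Py_left (p + 1) p _ hp (by omega) (by omega) (by omega), b2, mul_sub, mul_neg, hys]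
    simp
  generalize htdef : K.P (p + 1) * v = t at *
  have hx := on_V (χ := χ) (p := p) (by omega) 0 ht
  have hPx := K.on_P hp' hx
  have e1 := U_of_eq (χ := χ) hp' ht (by simp only [sw_pred, sw_self]; grind)
  rw [sw_pred, h0, C_zero, zero_mul, add_zero] at e1
  have e2 := U_of_eq (χ := χ) hp hPx
    (by simp only [sw_pred, sw_succ, sw_self, sw_next]; grind)
  rw [sw_succ, sw_pred, h0, zero_add, C_one hl] at e2
  have c1 := coefLin_cross hl hχ (0 : ZMod l)
  have c2 := coefConst_mul hl hχ (0 : ZMod l)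
  rw [sub_zero] at c1 c2
  have yPt : ∀ b, K.On (sw (p + 1) w) b → K.y (p + 1) * (K.P p * b) = K.P p * (K.y p * b) + b :=
    fun b hb => K.yP_eq hp' hb (by simp only [sw_pred, sw_self]; grind)
  have e3 : K.V χ (p + 1) 1 * (K.P p * (K.V χ p 0 * t)) =
      K.P p * t + (2 * coefConst χ 0 * coefLin χ 1) • (K.P p * (K.y p * t)) +
        coefLin χ 1 • (K.V χ p 0 * t) := by
    rw [V_mul (p + 1), yPt _ hx]
    simp only [V_mul, mul_add, mul_smul_comm, hys, smul_add, smul_zero, mul_zero]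
    linear_combination (norm := module) c2 • (K.P p * t) - c1 • (K.P p * (K.y p * t))
  have b8 : K.y (p + 1 + 1) * (K.y p * t) = 0 := by rw [K.y_left_comm, b5, hys]
  have b9 : K.y (p + 1) * (K.y p * t) = 0 := by rw [K.y_left_comm, b6, mul_neg, hys, neg_zero]
  have yP3 := fun b => K.Py_left p (p + 1 + 1) b hp' (by omega) (by omega) (by omega)
  rw [e1, e2, e3]
  simp only [V_mul, mul_add, mul_smul_comm, sub_mul, b1, b1', b2, b7, yPt _ ht,
    yPt _ (K.on_y (r := p) (by omega) ht), ← yP3, b5, b6, b8, b9, hys, mul_zero]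
  module

theorem UUU_right (hl : OddModulus l) (hχ : ∀ k, χ k = 1 → k = 0) {p : ℕ} (hp : p + 1 + 1 < n)
    {w a} (ha : K.On w a) :
    K.U χ (p + 1) * (K.U χ p * (K.U χ (p + 1) * a)) = K.U χ (p + 1) * a := by
  have ar := hl.arith (w (p + 1))
  have hp' : p + 1 < n := by omega
  have st := K.step hl p hp'
  have st' := K.step hl (p + 1) hp
  by_cases h : w (p + 1 + 1) = 1 - w (p + 1)
  swap
  · simp [U_of_ne hp ha h]
  have hv := on_V (χ := χ) (p := p + 1) (by omega) (w (p + 1)) ha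
  have hPv := K.on_P hp hv
  have hU := U_of_eq (χ := χ) hp ha h
  have hys : ∀ b : A, K.y p * (K.y p * b) = 0 := fun b => by
    rw [← mul_assoc, K.y_sq hl p (by omega), zero_mul]
  have hys' : ∀ b : A, K.y (p + 1) * (K.y (p + 1) * b) = 0 := fun b => by
    rw [← mul_assoc, K.y_sq hl (p + 1) (by omega), zero_mul]
  have hys'' : ∀ b : A, K.y (p + 1 + 1) * (K.y (p + 1 + 1) * b) = 0 := fun b => by
    rw [← mul_assoc, K.y_sq hl (p + 1 + 1) (by omega), zero_mul]
  by_cases h3 : w p = 1 + w (p + 1)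
  swap
  · by_cases h3' : w p = 1 - w (p + 1)
    swap
    · rw [st.zero ha (by grind) (by grind)]
      simp
    have hk0 : w (p + 1) ≠ 0 := by grind
    have e1 := U_of_ne (χ := χ) hp' hPv (by simp only [sw_pred, sw_self]; grind)
    have c1 := fun b (hb : K.On w b) =>
      V_cancel (K := K) (χ := χ) (p := p + 1) (r := p) hl hχ (by omega)
      (w (p + 1)) (a := b) (by
        rw [st.opp (w := w) hb (by grind) (by grind), neg_neg])
    by_cases hk1 : w (p + 1) = 1
    swap
    · have e2 := U_of_eq (χ := χ) hp' hv (by grind)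
      rw [h3', c1 a ha, C_of_ne _ (by grind) (by grind), one_mul] at e2
      have e3 := U_of_ne (χ := χ) hp (K.on_P hp' ha) (by simp only [sw_succ, sw_next]; grind)
      rw [C_of_ne _ hk0 hk1, one_mul] at hU
      nth_rw 1 [hU]
      rw [mul_add, e1, zero_add, e2, mul_add, e3, zero_add]
    · rw [hk1] at c1 e1
      have e2 := U_of_eq (χ := χ) hp' (on_C hp (w (p + 1)) hv) (by grind)
      rw [hk1, C_one hl, sub_mul] at hU e2
      have e5 : K.V χ p 0 * (K.y (p + 1) * (K.V χ (p + 1) 1 * a) -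
          K.y (p + 1 + 1) * (K.V χ (p + 1) 1 * a)) = K.y (p + 1) * a - K.y (p + 1 + 1) * a := by
        rw [mul_sub, ← y_V, ← y_V, ← sub_self (1 : ZMod l), c1 a ha]
      rw [show w p = 0 by grind, C_zero, zero_mul, add_zero, e5] at e2
      have b1 := K.Py_eq hp' ha (by grind)
      have hx := K.on_P hp' ha
      rw [sw_eq_self _ _ (by grind)] at hx
      have b2 := st.opp hx (by grind) (by grind)
      have b3 := K.Py_left p (p + 1 + 1) a hp' (by omega) (by omega) (by omega)
      have e3 : K.P p * (K.y (p + 1) * a - K.y (p + 1 + 1) * a) =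
          a - (K.y (p + 1) * (K.P p * a) + K.y (p + 1 + 1) * (K.P p * a)) := by
        rw [mul_sub, b1, b3, b2]
        abel
      have e4 : K.U χ (p + 1) *
          (K.y (p + 1) * (K.P p * a) + K.y (p + 1 + 1) * (K.P p * a)) = 0 := by
        generalize K.P p * a = x at *
        have hx1 := K.on_add (K.on_y (r := p + 1) (by omega) hx)
          (K.on_y (r := p + 1 + 1) (by omega) hx)
        have hz := on_V (χ := χ) (p := p + 1) (by omega) 1 hx
        have b5 := K.Py_ne hp hz (by grind)
        have b6 := K.yP_ne hp hz (by grind)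
        have b7 := st'.opp (K.on_P hp hz) (by simp only [sw_self, sw_succ]; grind)
          (by simp only [sw_self]; grind)
        rw [U_of_eq hp hx1 h, hk1, mul_add, ← y_V, ← y_V, C_one hl, mul_add, b5, ← b6, b7]
        simp only [mul_add, sub_mul, hys', hys'', K.y_left_comm (p + 1 + 1) (p + 1)]
        abel
      nth_rw 1 [hU]
      rw [mul_add, e1, zero_add, e2, e3, mul_sub, e4, sub_zero]
  have e1 : w (p + 1) ≠ 0 → K.U χ p * (K.C (p + 1) (w (p + 1)) *
      (K.V χ (p + 1) (w (p + 1)) * a)) = 0 :=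
    fun h0 => U_of_ne hp' (on_C hp _ hv) (by grind)
  by_cases hk0 : w (p + 1) = 0
  · rw [hk0, C_zero, zero_mul, add_zero] at hU
    rw [hk0] at hv hPv
    generalize K.V χ (p + 1) 0 * a = v at *
    have e2 := U_of_eq (χ := χ) hp' hPv (by simp only [sw_pred, sw_self]; grind)
    have e4 := K.yP_eq hp hv (by grind)
    have e5 := st'.opp hPv (by simp only [sw_self, sw_succ]; grind) (by simp only [sw_self]; grind)
    have e6 := K.sq_eq hp (K.on_y (r := p + 1) (by omega) hv) (by grind)
    have e7 := K.Py_left (p + 1) p (K.P (p + 1) * v) hp (by omega) (by omega) (by omega)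
    have e8 := K.sq_eq hp hv (by grind)
    have e10 : K.P (p + 1) * (K.y (p + 1) * (K.P (p + 1) * v)) = - (K.P (p + 1) * v) := by
      rw [← neg_neg (K.y (p + 1) * (K.P (p + 1) * v)), ← e5, e4, mul_neg, mul_add, e6, zero_add]
    generalize K.P (p + 1) * v = t at *
    have on1 := on_V (χ := χ) (p := p) (by omega) 1 hPv
    have e3 := U_of_ne (χ := χ) hp (K.on_P hp' on1)
      (by simp only [sw_succ, sw_pred, sw_next]; grind)
    have on2 := K.on_sub (K.on_y (r := p) (by omega) on1) (K.on_y (r := p + 1) (by omega) on1)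
    have e9 := U_of_eq (χ := χ) hp on2 (by simp only [sw_self, sw_succ]; grind)
    have c1 := V_cancel (K := K) (χ := χ) (p := p) (r := p + 1) hl hχ (by omega) 1
      (a := K.y p * t - K.y (p + 1) * t) (by
        rw [mul_sub, mul_sub, hys, hys', K.y_left_comm p]; abel)
    rw [sub_self, mul_sub (K.V χ p 1), ← y_V, ← y_V] at c1
    rw [sw_self, show w (p + 1 + 1) - 1 = 0 by rw [h, hk0]; ring, C_zero, zero_mul, add_zero, c1,
      mul_sub (K.P (p + 1)), e7, e8] at e9
    rw [sw_pred, h3, hk0, add_zero, C_one hl, sub_mul] at e2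
    rw [hU, e2, mul_add, e3, e9, e10]
    simp
  by_cases hk : w (p + 1) = -1
  · rw [hU, mul_add, e1 hk0, add_zero, UUU_right_neg_one hl hχ hp hv (by grind) hk (by grind), hk,
      C_of_ne _ (by grind) (by grind), one_mul, add_comm]
  have e2 := U_of_eq (χ := χ) hp' hPv (by simp only [sw_pred, sw_self]; grind)
  rw [sw_pred, h3, C_of_ne _ (by grind) (by grind), one_mul] at e2
  have on1 := on_V (χ := χ) (p := p) (by omega) (1 + w (p + 1)) hPv
  have e3 := U_of_ne (χ := χ) hp (K.on_P hp' on1)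
    (by simp only [sw_succ, sw_pred, sw_next]; grind)
  have e4 := U_of_eq (χ := χ) hp on1 (by simp only [sw_self, sw_succ]; grind)
  have c1 := V_cancel (K := K) (χ := χ) (p := p) (r := p + 1) hl hχ (by omega) (1 + w (p + 1))
    (a := K.P (p + 1) * (K.V χ (p + 1) (w (p + 1)) * a))
    (st.opp hPv (by simp only [sw_pred, sw_self]; grind) (by simp only [sw_pred]; grind))
  rw [show 1 - (1 + w (p + 1)) = w (p + 1 + 1) - 1 by rw [h]; ring] at c1
  rw [sw_self, c1, C_of_ne _ (by grind) (by grind), one_mul,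
    P_P_eq_C hl hp hv h hk0 hk] at e4
  rw [hU, mul_add, e1 hk0, add_zero, e2, mul_add, e3, zero_add, e4, add_comm]

end KAct

namespace KAct
variable {l n : ℕ} {A : Type*} [Ring A] [Algebra ℂ A] {K : KAct l n A} {χ : AddChar (ZMod l) ℂ}

variable (K χ) in
/-- The element by which the Temperley–Lieb generator acts at weights `k, k'`. -/
def X (p : ℕ) (k k' : ZMod l) : A := if k' = 1 - k then (K.P p + K.C p k) * K.V χ p k else 0

theorem U_X {p : ℕ} (hp : p + 1 < n) {w a} (ha : K.On w a) :
    K.U χ p * a = K.X χ p (w p) (w (p + 1)) * a := U_apply hp ha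

theorem commute_V {z : A} {p : ℕ} (k : ZMod l) (h : Commute z (K.y p)) :
    Commute z (K.V χ p k) := by
  unfold V
  exact ((Commute.one_right z).smul_right _).add_right (h.smul_right _)

theorem commute_C {z : A} {p : ℕ} (k : ZMod l) (h : Commute z (K.y p))
    (h' : Commute z (K.y (p + 1))) : Commute z (K.C p k) := by
  unfold C
  split_ifs
  exacts [Commute.zero_right z, h.sub_right h', Commute.one_right z]

theorem commute_X {z : A} {p : ℕ} (k k' : ZMod l) (h : Commute z (K.y p))
    (h' : Commute z (K.y (p + 1))) (hP : Commute z (K.P p)) : Commute z (K.X χ p k k') := by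
  unfold X
  split_ifs
  exacts [(hP.add_right (commute_C k h h')).mul_right (commute_V k h), Commute.zero_right z]

theorem X_comm {r s : ℕ} (h : r + 1 < s) (hs : s + 1 < n) (k k' j j' : ZMod l) :
    Commute (K.X χ r k k') (K.X χ s j j') := by
  have yy : ∀ r s, Commute (K.y r) (K.y s) := K.yy
  have far : ∀ m, m = s ∨ m = s + 1 → Commute (K.y m) (K.X χ r k k') := fun m hm =>
    commute_X k k' (yy _ _) (yy _ _)
      (Commute.symm (K.Py_far (by omega) (by omega) (by omega) (by omega)))
  refine commute_X j j' (far _ (.inl rfl)).symm (far _ (.inr rfl)).symm (Commute.symm ?_)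
  refine commute_X k k' (K.Py_far (by omega) (by omega) (by omega) (by omega))
    (K.Py_far (by omega) (by omega) (by omega) (by omega)) (K.PP_far h hs).symm

theorem U_U_apply {r s : ℕ} (hr : r + 1 < n) (hs : s + 1 < n) (h : r + 1 < s ∨ s + 1 < r)
    {w a} (ha : K.On w a) : K.U χ r * (K.U χ s * a) =
      K.X χ r (w r) (w (r + 1)) * (K.X χ s (w s) (w (s + 1)) * a) := by
  rw [U_X hs ha, X]
  split_ifs
  · have hV := on_V (χ := χ) (p := s) (by omega) (w s) ha
    rw [mul_assoc, add_mul, mul_add, mul_add, U_X hr (on_C hs _ hV), U_X hr (K.on_P hs hV),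
      sw_of_ne, sw_of_ne] <;> omega
  · simp

theorem U_comm {r s : ℕ} (h : r + 1 < s) (hs : s + 1 < n) :
    K.U χ r * K.U χ s = K.U χ s * K.U χ r := by
  rw [← sub_eq_zero]
  refine K.ext fun w a ha => ?_
  rw [sub_mul, mul_assoc, mul_assoc, U_U_apply (by omega) hs (.inl h) ha,
    U_U_apply hs (by omega) (.inr h) ha, ← mul_assoc, (X_comm h hs _ _ _ _).eq, mul_assoc,
    sub_self]

variable (K) in
/-- The homomorphism from the Temperley–Lieb algebra defined by a Khovanov–Lauda–Rouquier
action. -/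
def ofTL (hl : OddModulus l) (hχ : ∀ k, χ k = 1 → k = 0) : TL (χ 1) n →ₐ[ℂ] A :=
  RingQuot.liftAlgHom ℂ ⟨FreeAlgebra.lift ℂ fun i : Fin (n - 1) => K.U χ i, fun x y h => by
    have uuu : ∀ p, p + 1 + 1 < n → K.U χ p * K.U χ (p + 1) * K.U χ p = K.U χ p ∧
        K.U χ (p + 1) * K.U χ p * K.U χ (p + 1) = K.U χ (p + 1) := fun p hp => by
      constructor <;> rw [← sub_eq_zero] <;> refine K.ext fun w a ha => ?_
      · rw [sub_mul, mul_assoc, mul_assoc, UUU_left hl hχ hp ha, sub_self]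
      · rw [sub_mul, mul_assoc, mul_assoc, UUU_right hl hχ hp ha, sub_self]
    cases h with
    | Usq i => simpa [UT, char_neg] using U_sq hl hχ (by omega)
    | UUU i j h =>
      simp only [UT, map_mul, FreeAlgebra.lift_ι_apply]
      rcases h with h | h <;> rw [← h]
      exacts [(uuu _ (by omega)).1, (uuu _ (by omega)).2]
    | Ucomm i j h =>
      simp only [UT, map_mul, FreeAlgebra.lift_ι_apply]
      rcases h with h | h
      exacts [U_comm h (by omega), (U_comm h (by omega)).symm]⟩

theorem ofTL_U (hl : OddModulus l) (hχ : ∀ k, χ k = 1 → k = 0) (i : Fin (n - 1)) :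
    K.ofTL hl hχ (UmkTL (χ 1) n i) = K.U χ i := by
  simp [ofTL, UmkTL, UT]

end KAct

section spec
variable {l : ℕ} {A : Type*} [Ring A] [Algebra ℂ A] {χ : AddChar (ZMod l) ℂ}

theorem isPrimitive (hχ : ∀ k, χ k = 1 → k = 0) : χ.IsPrimitive := fun a ha h => by
  have := DFunLike.congr_fun h 1
  rw [AddChar.mulShift_apply, mul_one, AddChar.one_apply] at this
  exact ha (hχ a this)

theorem pow_mul_eq {S a : A} {c : ℂ} (h : S * a = c • a) (m : ℕ) : S ^ m * a = c ^ m • a := by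
  induction m with
  | zero => simp
  | succ m ih => rw [pow_succ, mul_assoc, h, mul_smul_comm, ih, smul_smul, pow_succ']

variable [NeZero l] (χ)

/-- The projection onto the `χ k`-eigenspace of an operator `S` with `S ^ l = 1`. -/
def spec (S : A) (k : ZMod l) : A := (l : ℂ)⁻¹ • ∑ j : ZMod l, χ (-(j * k)) • S ^ j.val

variable {χ}

theorem char_sum (hχ : ∀ k, χ k = 1 → k = 0) (b : ZMod l) :
    ∑ j, χ (j * b) = if b = 0 then (l : ℂ) else 0 := by
  rw [AddChar.sum_mulShift b (isPrimitive hχ), ZMod.card]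
  split_ifs <;> simp

theorem char_pow_val (k j : ZMod l) : χ k ^ j.val = χ (j * k) := by
  rw [← AddChar.map_nsmul_eq_pow, nsmul_eq_mul, ZMod.natCast_zmod_val]

theorem spec_mul (hχ : ∀ k, χ k = 1 → k = 0) {S a : A} {k : ZMod l} (h : S * a = χ k • a)
    (k' : ZMod l) : spec χ S k' * a = if k = k' then a else 0 := by
  have h1 : ∀ j : ZMod l, χ (-(j * k')) • S ^ j.val * a = χ (j * (k - k')) • a := fun j => by
    rw [smul_mul_assoc, pow_mul_eq h, char_pow_val, smul_smul, ← AddChar.map_add_eq_mul]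
    congr 2
    ring
  rw [spec, smul_mul_assoc, Finset.sum_mul, Finset.sum_congr rfl fun j _ => h1 j,
    ← Finset.sum_smul, char_sum hχ]
  simp only [sub_eq_zero]
  have : (l : ℂ) ≠ 0 := NeZero.ne _
  split_ifs
  · rw [smul_smul, inv_mul_cancel₀ this, one_smul]
  · simp

theorem sum_spec (hχ : ∀ k, χ k = 1 → k = 0) (S : A) : ∑ k, spec χ S k = 1 := by
  have h1 : ∀ j : ZMod l, ∑ k, χ (-(j * k)) • S ^ j.val = if j = 0 then (l : ℂ) • 1 else 0 :=
    fun j => by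
      rw [← Finset.sum_smul, Finset.sum_congr rfl fun k _ => show χ (-(j * k)) = χ (k * -j) by
        congr 1; ring, char_sum hχ]
      simp only [neg_eq_zero]
      split_ifs with h
      · rw [h, ZMod.val_zero, pow_zero]
      · simp
  have : (l : ℂ) ≠ 0 := NeZero.ne _
  simp only [spec]
  rw [← Finset.smul_sum, Finset.sum_comm, Finset.sum_congr rfl fun j _ => h1 j]
  simp [smul_smul, this]

theorem mul_spec {S : A} (hS : S ^ l = 1) (k : ZMod l) : S * spec χ S k = χ k • spec χ S k := by
  have hp : ∀ j : ZMod l, S ^ (j + 1).val = S * S ^ j.val := fun j => by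
    rw [← pow_succ', ZMod.val_add, ZMod.val_one_eq_one_mod, Nat.add_mod_mod]
    conv_rhs => rw [← Nat.mod_add_div (j.val + 1) l, pow_add, pow_mul, hS, one_pow, mul_one]
  have key : S * ∑ j : ZMod l, χ (-(j * k)) • S ^ j.val =
      χ k • ∑ j : ZMod l, χ (-(j * k)) • S ^ j.val := by
    rw [Finset.mul_sum, Finset.smul_sum]
    refine Fintype.sum_equiv (Equiv.addRight 1) _ _ fun j => ?_
    rw [Equiv.coe_addRight, hp, mul_smul_comm, smul_smul, ← AddChar.map_add_eq_mul]
    congr 2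
    ring
  rw [spec, mul_smul_comm, smul_comm (χ k), key]

theorem commute_spec {z S : A} (h : Commute z S) (k : ZMod l) : Commute z (spec χ S k) :=
  Commute.smul_right (Commute.sum_right _ _ _ fun _ _ => (h.pow_right _).smul_right _) _

theorem spec_mem {R : Subalgebra ℂ A} {S : A} (h : S ∈ R) (k : ZMod l) : spec χ S k ∈ R :=
  R.smul_mem (R.sum_mem fun _ _ => R.smul_mem (R.pow_mem h _) _) _

end spec

namespace KAct
variable {l n : ℕ} {A : Type*} [Ring A] [Algebra ℂ A] {K : KAct l n A} {χ : AddChar (ZMod l) ℂ}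

variable (K χ) in
/-- The Jucys–Murphy elements and their inverses. -/
def GH : ℕ → A × A
  | 0 => (χ (-1) • 1, χ 1 • 1)
  | p + 1 => ((GH p).1 * K.U χ p - K.U χ p * (GH p).2 + χ (-1) • (GH p).1,
      χ 1 • (GH p).2 - (GH p).1 * K.U χ p + K.U χ p * (GH p).2)

theorem y_add_P (hl : OddModulus l) {p : ℕ} (hp : p + 1 < n) {w a} (ha : K.On w a)
    (h : w (p + 1) = 1 - w p) (h0 : w p ≠ 0) :
    K.y p * (K.P p * a) = -(K.P p * (K.y p * a)) := by
  have ar := hl.arith (w p)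
  rw [opp_P hl hp ha h h0, K.yP_ne hp ha (by grind)]

theorem GH_step (hl : OddModulus l) (hχ : ∀ k, χ k = 1 → k = 0) {p : ℕ} (hp : p + 1 < n)
    {G H : A} (hG : ∀ w a, K.On w a → G * a = χ (w p) • (a + K.y p * a))
    (hH : ∀ w a, K.On w a → H * a = χ (-w p) • (a - K.y p * a)) {w a} (ha : K.On w a) :
    G * (K.U χ p * a) - K.U χ p * (H * a) + χ (-1) • (G * a) =
      χ (w (p + 1)) • (a + K.y (p + 1) * a) := by
  have st := K.step hl p hp
  have ar := hl.arith (w p)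
  have hya := K.on_y (r := p) (by omega) ha
  have hHa : K.On w (H * a) := by
    rw [hH w a ha]
    exact K.on_smul _ (K.on_sub ha hya)
  by_cases h : w (p + 1) = 1 - w p
  swap
  · rw [U_of_ne hp ha h, U_of_ne hp hHa h, hG w a ha]
    by_cases h' : w (p + 1) = w p - 1
    · rw [st.same ha h' (by grind), h', sub_eq_add_neg (w p), AddChar.map_add_eq_mul, mul_zero]
      module
    · rw [st.zero ha h' h]
      simp
  have hys : ∀ b : A, K.y p * (K.y p * b) = 0 := fun b => by
    rw [← mul_assoc, K.y_sq hl p (by omega), zero_mul]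
  have hv := on_V (χ := χ) (p := p) (by omega) (w p) ha
  have hVH : K.V χ p (w p) * (H * a) =
      χ (-w p) • (K.V χ p (w p) * a - K.y p * (K.V χ p (w p) * a)) := by
    rw [hH w a ha, mul_smul_comm, mul_sub, y_V]
  rw [U_of_eq hp ha h, U_of_eq hp hHa h, hVH, mul_add, hG _ _ (K.on_P hp hv),
    hG _ _ (on_C hp _ hv), hG w a ha, sw_self, show w (p + 1) - 1 = -w p by rw [h]; ring, h]
  rw [char_one_sub]
  by_cases h0 : w p = 0
  · have b1 := K.Py_eq hp hv (by grind)
    rw [h0] at b1 hv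
    have b2 := st.opp hv (by rw [h, h0]) (by grind)
    rw [b2] at b1
    have b3 := st.opp ha h (by grind)
    rw [h0, C_zero, b3]
    simp only [mul_sub, mul_smul_comm, zero_mul, neg_zero, AddChar.map_zero_eq_one]
    have b4 : K.V χ p 0 * a = (-(χ 1 - χ (-1))) • a + (χ 1 + χ (-1)) • (K.y p * a) := by
      rw [V_mul, coefConst, if_pos rfl, coefLin, if_pos rfl, sinh]
    linear_combination (norm := skip) -b1 - b4
    simp only [mul_neg, mul_zero, sub_zero]
    module
  have b1 := y_add_P hl hp hv h h0
  by_cases h1 : w p = 1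
  · have s1 := sinh_ne_zero hl hχ hl.ne1
    have hys' : ∀ b : A, K.y (p + 1) * (K.y (p + 1) * b) = 0 := fun b => by
      rw [← mul_assoc, K.y_sq hl (p + 1) (by omega), zero_mul]
    have c3 : χ 1 * χ (-1) = 1 := by rw [char_neg, mul_inv_cancel₀ (char_ne_zero 1)]
    have c4 := sinh_coefConst_one hl hχ
    have c5 := sinh_coefLin_one hl hχ
    rw [b1]
    rw [h1, C_one hl, V_mul]
    simp only [mul_sub, sub_mul, mul_add, mul_smul_comm, hys, hys', K.y_left_comm (p + 1) p,
      smul_add, smul_sub, smul_neg, smul_zero, mul_zero, smul_smul, c3, mul_comm (χ (-1)) (χ 1)]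
    linear_combination (norm := module) (c4 • (K.y p * a) - c4 • (K.y (p + 1) * a)
      - c5 • (K.y p * (K.y (p + 1) * a)))
  have c3 := sinh_coefConst hl hχ h0 h1
  have c4 := sinh_coefLin hl hχ h0 h1
  rw [b1, C_of_ne _ h0 h1, one_mul, one_mul, V_mul, st.opp ha h h1]
  simp only [mul_sub, sub_mul, mul_add, mul_smul_comm, hys, smul_add, smul_sub, smul_neg,
    smul_zero, mul_zero, smul_smul]
  linear_combination (norm := module) c3 • a + c4 • (K.y p * a)

theorem GH_apply (hl : OddModulus l) (hχ : ∀ k, χ k = 1 → k = 0) {p : ℕ} (hp : p < n) :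
    (∀ w a, K.On w a → (K.GH χ p).1 * a = χ (w p) • (a + K.y p * a)) ∧
      ∀ w a, K.On w a → (K.GH χ p).2 * a = χ (-w p) • (a - K.y p * a) := by
  induction p with
  | zero =>
    constructor <;> intro w a ha <;> by_cases h : w 0 = -1
    · simp [GH, K.y_zero, h]
    · simp [K.cyc ha h]
    · simp [GH, K.y_zero, h]
    · simp [K.cyc ha h]
  | succ p ih =>
    obtain ⟨hG, hH⟩ := ih (by omega)
    have key := fun w a (ha : K.On w a) => GH_step hl hχ hp hG hH ha
    refine ⟨fun w a ha => ?_, fun w a ha => ?_⟩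
    · rw [← key w a ha, GH]
      simp [add_mul, sub_mul, mul_assoc]
    have h1 := key w a ha
    have st := K.step hl p hp
    have ar := hl.arith (w p)
    have h2 : (K.GH χ (p + 1)).2 * a = χ 1 • ((K.GH χ p).2 * a) + χ (-1) • ((K.GH χ p).1 * a)
        - χ (w (p + 1)) • (a + K.y (p + 1) * a) := by
      rw [← h1, GH]
      simp only [sub_mul, add_mul, smul_mul_assoc, mul_assoc]
      abel
    rw [h2, hG w a ha, hH w a ha]
    have c0 : χ (1 - w p) = χ 1 * χ (- w p) := by rw [sub_eq_add_neg, AddChar.map_add_eq_mul]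
    have c1 : χ (w p - 1) = χ (-1) * χ (w p) := by
      rw [sub_eq_add_neg, AddChar.map_add_eq_mul, mul_comm]
    by_cases h' : w (p + 1) = 1 - w p
    · by_cases h1 : w p = 1
      · rw [h', h1, sub_self, neg_zero, char_neg]
        have := char_ne_zero (χ := χ) 1
        simp only [smul_smul, mul_inv_cancel₀ this, inv_mul_cancel₀ this,
          AddChar.map_zero_eq_one]
        module
      · rw [h', st.opp ha h' h1, neg_sub, c0, c1]
        module
    by_cases h'' : w (p + 1) = w p - 1
    · rw [h'', st.same ha h'' (by grind), neg_sub, c0, c1]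
      module
    · rw [st.zero ha h'' h']
      simp

section range
variable [NeZero l] {R : Subalgebra ℂ A}

theorem y_mem (hl : OddModulus l) (hχ : ∀ k, χ k = 1 → k = 0)
    (hU : ∀ p, p + 1 < n → K.U χ p ∈ R) {p : ℕ} (hp : p < n) :
    K.y p ∈ R ∧ ∃ S ∈ R, ∀ w a, K.On w a → S * a = χ (w p) • a := by
  have hG : ∀ p, p < n → (K.GH χ p).1 ∈ R ∧ (K.GH χ p).2 ∈ R := fun p => by
    induction p with
    | zero => exact fun _ => ⟨R.smul_mem R.one_mem _, R.smul_mem R.one_mem _⟩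
    | succ p ih =>
      intro hp
      obtain ⟨h1, h2⟩ := ih (by omega)
      have h3 := hU p hp
      exact ⟨R.add_mem (R.sub_mem (R.mul_mem h1 h3) (R.mul_mem h3 h2)) (R.smul_mem h1 _),
        R.add_mem (R.sub_mem (R.smul_mem h2 _) (R.mul_mem h1 h3)) (R.mul_mem h3 h2)⟩
  obtain ⟨h1, -⟩ := GH_apply (K := K) hl hχ hp
  have hys : ∀ b : A, K.y p * (K.y p * b) = 0 := fun b => by
    rw [← mul_assoc, K.y_sq hl p (by omega), zero_mul]
  set G := (K.GH χ p).1
  have hl0 : (l : ℂ) ≠ 0 := NeZero.ne _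
  have hpow : ∀ (m : ℕ) w a, K.On w a → G ^ m * a = χ (w p) ^ m • (a + (m : ℂ) • (K.y p * a)) :=
    fun m => by
      induction m with
      | zero => simp
      | succ m ih =>
        intro w a ha
        rw [pow_succ', mul_assoc, ih w a ha, mul_smul_comm, mul_add, mul_smul_comm, h1 w a ha,
          h1 w _ (K.on_y hp ha), hys]
        push_cast
        module
  have hyR : K.y p ∈ R := by
    have : K.y p = (l : ℂ)⁻¹ • (G ^ l - 1) := by
      rw [← sub_eq_zero]
      refine K.ext fun w a ha => ?_
      have hc : χ (w p) ^ l = 1 := by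
        rw [← AddChar.map_nsmul_eq_pow, nsmul_eq_mul, ZMod.natCast_self, zero_mul,
          AddChar.map_zero_eq_one]
      rw [sub_mul, smul_mul_assoc, sub_mul, hpow l w a ha, hc, one_smul, one_mul,
        add_sub_cancel_left, smul_smul, inv_mul_cancel₀ hl0, one_smul, sub_self]
    rw [this]
    exact R.smul_mem (R.sub_mem (R.pow_mem (hG p hp).1 _) R.one_mem) _
  refine ⟨hyR, G * (1 - K.y p), R.mul_mem (hG p hp).1 (R.sub_mem R.one_mem hyR),
    fun w a ha => ?_⟩
  rw [mul_assoc, sub_mul, one_mul, h1 w _ (K.on_sub ha (K.on_y hp ha)), mul_sub, hys]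
  simp

theorem proj_mem (hl : OddModulus l) (hχ : ∀ k, χ k = 1 → k = 0)
    (hU : ∀ p, p + 1 < n → K.U χ p ∈ R) {p : ℕ} (hp : p < n) (k : ZMod l) :
    ∃ E ∈ R, ∀ w a, K.On w a → E * a = if w p = k then a else 0 := by
  obtain ⟨-, S, hS, h⟩ := y_mem hl hχ hU hp
  exact ⟨spec χ S k, spec_mem hS k, fun w a ha => spec_mul hχ (h w a ha) k⟩

theorem P_mem (hl : OddModulus l) (hχ : ∀ k, χ k = 1 → k = 0)
    (hU : ∀ p, p + 1 < n → K.U χ p ∈ R) {p : ℕ} (hp : p + 1 < n) : K.P p ∈ R := by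
  have hy := (y_mem hl hχ hU (p := p) (by omega)).1
  have hy' := (y_mem hl hχ hU hp).1
  choose E hE hE' using proj_mem hl hχ hU (p := p) (by omega)
  choose E₁ hE₁ hE₁' using proj_mem hl hχ hU hp
  have hsm : ∀ {x : A} (c : ℂ), x ∈ R → c • x ∈ R := fun c hx => R.smul_mem hx c
  let W : ZMod l → A := fun k => coefConst χ (1 - k) • 1 - coefLin χ (1 - k) • K.y p
  have hW : ∀ k, W k ∈ R := fun k => R.sub_mem (hsm _ R.one_mem) (hsm _ hy)
  have hC : ∀ k, K.C p k ∈ R := fun k => by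
    unfold C
    split_ifs
    exacts [R.zero_mem, R.sub_mem hy hy', R.one_mem]
  have key : K.P p = ∑ k, (K.U χ p * W k - K.C p k) * (E₁ (1 - k) * E k) := by
    rw [← sub_eq_zero]
    refine K.ext fun w a ha => ?_
    have hya := K.on_y (r := p) (by omega) ha
    rw [sub_mul, sub_eq_zero, Finset.sum_mul, Finset.sum_eq_single (w p)]
    · rw [mul_assoc, mul_assoc, hE' _ w a ha, if_pos rfl, hE₁' _ w a ha]
      split_ifs with h
      · have hWa : W (w p) * a =
            coefConst χ (1 - w p) • a - coefLin χ (1 - w p) • (K.y p * a) := by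
          simp [W, sub_mul]
        have hys : ∀ b : A, K.y p * (K.y p * b) = 0 := fun b => by
          rw [← mul_assoc, K.y_sq hl p (by omega), zero_mul]
        have hVW : K.V χ p (w p) * (W (w p) * a) = a := by
          have c1 := coefConst_mul hl hχ (w p)
          have c2 := coefLin_cross hl hχ (w p)
          rw [hWa, V_mul]
          simp only [mul_sub, mul_smul_comm, hys, smul_zero, sub_zero]
          linear_combination (norm := module) c1 • a - c2 • (K.y p * a)
        have on : K.On w (W (w p) * a) := by
          rw [hWa]
          exact K.on_sub (K.on_smul _ ha) (K.on_smul _ hya)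
        rw [sub_mul, mul_assoc, U_of_eq hp on h, hVW, add_sub_cancel_right]
      · rw [mul_zero]
        have ar := hl.arith (w p)
        have st := K.step hl p hp
        by_cases h' : w (p + 1) = w p - 1
        · exact st.zero (K.on_P hp ha) (by simp only [sw_self, sw_succ]; grind)
            (by simp only [sw_self, sw_succ]; grind)
        · rw [st.zero ha h' h, mul_zero]
    · intro k _ hk
      rw [mul_assoc, mul_assoc, hE' _ w a ha, if_neg (Ne.symm hk), mul_zero, mul_zero]
    · simp
  rw [key]
  exact R.sum_mem fun k _ => R.mul_mem (R.sub_mem (R.mul_mem (hU p hp) (hW k)) (hC k))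
    (R.mul_mem (hE₁ _) (hE _))

end range
end KAct

namespace Rep
section general
variable {l n : ℕ} {A : Type*} [Ring A] [Algebra ℂ A]
  (φ : FreeAlgebra ℂ (KLRGen l n) →ₐ[ℂ] A)

/-- The image of the idempotent `e(i)`. -/
def e (i : Res l n) : A := φ (eG l n i)

/-- The image of `y_r`, `0` if `r` is out of range. -/
def y (r : ℕ) : A := if h : r < n then φ (yG l n ⟨r, h⟩) else 0

/-- The image of `ψ_r`, `0` if `r` is out of range. -/
def psi (r : ℕ) : A := if h : r < n - 1 then φ (pG l n ⟨r, h⟩) else 0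

end general

/-- A representation of the quotient of the cyclotomic algebra in a ring `A`. -/
structure _root_.Statement3.IsRep {l n : ℕ} [NeZero l] (hn : 3 ≤ n) {A : Type*} [Ring A]
    [Algebra ℂ A] (φ : FreeAlgebra ℂ (KLRGen l n) →ₐ[ℂ] A) : Prop where
  rel : ∀ {a b}, KLRRel l n (Lam1 l) a b → φ a = φ b
  bad : ∀ {i}, i ∈ badSet1 l n hn → φ (eG l n i) = 0

section rels
variable {l n : ℕ} {A : Type*} [Ring A] [Algebra ℂ A]
  {φ : FreeAlgebra ℂ (KLRGen l n) →ₐ[ℂ] A}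

@[simp] theorem map_eG (i) : φ (eG l n i) = e φ i := rfl

theorem map_yG {r : ℕ} (h : r < n) : φ (yG l n ⟨r, h⟩) = y φ r := by
  rw [y, dif_pos h]

theorem map_pG {r : ℕ} (h : r < n - 1) : φ (pG l n ⟨r, h⟩) = psi φ r := by
  rw [psi, dif_pos h]

theorem map_mem {R : Subalgebra ℂ A} (he : ∀ i, e φ i ∈ R) (hy : ∀ r < n, y φ r ∈ R)
    (hψ : ∀ r, r + 1 < n → psi φ r ∈ R) (x) : φ x ∈ R := by
  induction x using FreeAlgebra.induction with
  | grade0 c => rw [AlgHom.commutes]; exact R.algebraMap_mem c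
  | grade1 g =>
    cases g with
    | e i => exact he i
    | y r => exact map_yG (φ := φ) r.2 ▸ hy r r.2
    | psi r => exact map_pG (φ := φ) r.2 ▸ hψ r (by omega)
  | mul a b ha hb => rw [map_mul]; exact R.mul_mem ha hb
  | add a b ha hb => rw [map_add]; exact R.add_mem ha hb

variable [NeZero l] {hn : 3 ≤ n}

theorem e_cyc (hφ : IsRep hn φ) {i} (h : 0 < n) (hi : i ⟨0, h⟩ ∉ Lam1 l) : e φ i = 0 := by
  simpa using hφ.rel (.cyc1 i ⟨0, h⟩ rfl hi)

theorem e_mul (hφ : IsRep hn φ) (i j) : e φ i * e φ j = if i = j then e φ i else 0 := by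
  split_ifs with h
  · subst h
    simpa using hφ.rel (.idem i)
  · simpa using hφ.rel (.orth i j h)

theorem sum_e (hφ : IsRep hn φ) : ∑ i, e φ i = 1 := by
  simpa using hφ.rel (.sum1 (l := l) (n := n) )

theorem y_e (hφ : IsRep hn φ) (r i) : y φ r * e φ i = e φ i * y φ r := by
  rw [y]
  split_ifs with h
  · simpa using hφ.rel (.ye ⟨r, h⟩ i)
  · simp

theorem y_y (hφ : IsRep hn φ) (r s) : y φ r * y φ s = y φ s * y φ r := by
  rw [y, y]
  split_ifs with h h'
  · simpa using hφ.rel (.yy (l := l) ⟨r, h⟩ ⟨s, h'⟩)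
  all_goals simp

theorem psi_e (hφ : IsRep hn φ) {r} (h : r + 1 < n) (i) :
    psi φ r * e φ i = e φ (i ∘ Equiv.swap ⟨r, by omega⟩ ⟨r + 1, h⟩) * psi φ r := by
  have h' : r < n - 1 := by omega
  rw [← map_pG h']
  simpa [lo, hi] using hφ.rel (.psie ⟨r, h'⟩ i)

theorem psi_y (hφ : IsRep hn φ) {r s} (h : r + 1 < n) (hs : s < n) (h1 : s ≠ r) (h2 : s ≠ r + 1) :
    psi φ r * y φ s = y φ s * psi φ r := by
  have h' : r < n - 1 := by omega
  rw [← map_pG h', ← map_yG hs]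
  simpa using hφ.rel (.psiy (l := l) ⟨r, h'⟩ ⟨s, hs⟩ h1 h2)

theorem psi_psi (hφ : IsRep hn φ) {r s} (h : r + 1 < s) (hs : s + 1 < n) :
    psi φ r * psi φ s = psi φ s * psi φ r := by
  have h' : r < n - 1 := by omega
  have hs' : s < n - 1 := by omega
  rw [← map_pG h', ← map_pG hs']
  simpa using hφ.rel (.pp (l := l) ⟨r, h'⟩ ⟨s, hs'⟩ (.inl h))

theorem psi_y_succ (hφ : IsRep hn φ) {r} (h : r + 1 < n) (i : Res l n) :
    psi φ r * (y φ (r + 1) * e φ i) =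
      (y φ r * psi φ r + if i ⟨r, by omega⟩ = i ⟨r + 1, h⟩ then 1 else 0) * e φ i := by
  have h' : r < n - 1 := by omega
  rw [← map_pG h', ← map_yG h, ← map_yG (show r < n by omega)]
  have := hφ.rel (.py (l := l) ⟨r, h'⟩ i)
  simp only [map_mul, map_add, map_sub, map_neg, map_one, map_zero, apply_ite φ] at this
  exact this

theorem y_succ_psi (hφ : IsRep hn φ) {r} (h : r + 1 < n) (i : Res l n) :
    y φ (r + 1) * (psi φ r * e φ i) =
      (psi φ r * y φ r + if i ⟨r, by omega⟩ = i ⟨r + 1, h⟩ then 1 else 0) * e φ i := by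
  have h' : r < n - 1 := by omega
  rw [← map_pG h', ← map_yG h, ← map_yG (show r < n by omega)]
  have := hφ.rel (.yp (l := l) ⟨r, h'⟩ i)
  simp only [map_mul, map_add, map_sub, map_neg, map_one, map_zero, apply_ite φ] at this
  exact this

theorem psi_sq (hφ : IsRep hn φ) {r} (h : r + 1 < n) (i : Res l n) :
    psi φ r * psi φ r * e φ i =
      (if i ⟨r + 1, h⟩ = i ⟨r, by omega⟩ then 0
        else if i ⟨r + 1, h⟩ = i ⟨r, by omega⟩ + 1 then y φ (r + 1) - y φ r
        else if i ⟨r + 1, h⟩ = i ⟨r, by omega⟩ - 1 then y φ r - y φ (r + 1)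
        else 1) * e φ i := by
  have h' : r < n - 1 := by omega
  rw [← map_pG h', ← map_yG h, ← map_yG (show r < n by omega)]
  have := hφ.rel (.psisq (l := l) ⟨r, h'⟩ i)
  simp only [map_mul, map_add, map_sub, map_neg, map_one, map_zero, apply_ite φ] at this
  exact this

theorem braid (hφ : IsRep hn φ) {r} (h : r + 2 < n) (i : Res l n) :
    psi φ r * psi φ (r + 1) * psi φ r * e φ i = (psi φ (r + 1) * psi φ r * psi φ (r + 1) +
      (if i ⟨r + 2, h⟩ = i ⟨r, by omega⟩ ∧ i ⟨r + 1, by omega⟩ = i ⟨r, by omega⟩ + 1 then 1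
       else if i ⟨r + 2, h⟩ = i ⟨r, by omega⟩ ∧ i ⟨r + 1, by omega⟩ = i ⟨r, by omega⟩ - 1 then -1
       else 0)) * e φ i := by
  have h' : r < n - 1 := by omega
  have h'' : r + 1 < n - 1 := by omega
  rw [← map_pG h', ← map_pG h'']
  have := hφ.rel (.braid (l := l) ⟨r, h'⟩ ⟨r + 1, h''⟩ rfl i)
  simp only [map_mul, map_add, map_sub, map_neg, map_one, map_zero, apply_ite φ] at this
  exact this

end rels

section weight
variable {l n : ℕ}

/-- The weight of a residue sequence at a given position. -/
def IsWt (w : ℕ → ZMod l) (i : Res l n) : Prop := ∀ p (h : p < n), w p = 2 * i ⟨p, h⟩ + p - 1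

variable (n) in
/-- The residue sequence `i` written as the sequence of shifted residues `2 i_p + p - 1`. -/
def wt (i : Res l n) : ℕ → ZMod l := fun p => if h : p < n then 2 * i ⟨p, h⟩ + p - 1 else 0

theorem isWt_wt (i : Res l n) : IsWt (wt n i) i := fun p h => by rw [wt, dif_pos h]

theorem IsWt.sw {w : ℕ → ZMod l} {i : Res l n} (h : IsWt w i) {r} (hr : r + 1 < n) :
    IsWt (sw r w) (i ∘ Equiv.swap ⟨r, by omega⟩ ⟨r + 1, hr⟩) := fun p hp => by
  by_cases h1 : p = r
  · subst h1
    rw [sw_self, h _ hr, Function.comp_apply, Equiv.swap_apply_left]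
    push_cast
    ring
  by_cases h2 : p = r + 1
  · subst h2
    rw [sw_succ, h r (by omega), Function.comp_apply, Equiv.swap_apply_right]
    push_cast
    ring
  rw [sw_of_ne _ _ h1 h2, h p hp, Function.comp_apply,
    Equiv.swap_apply_of_ne_of_ne (by simpa using h1) (by simpa using h2)]

theorem IsWt.inj (hl : OddModulus l) {w : ℕ → ZMod l} {i j : Res l n} (hi : IsWt w i)
    (hj : IsWt w j) : i = j := funext fun p => hl.eq_of_two (by
  linear_combination (hj p.1 p.2) - (hi p.1 p.2))

section
variable {w : ℕ → ZMod l} {i : Res l n} {r : ℕ}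

theorem IsWt.succ_eq_iff (hl : OddModulus l) (h : IsWt w i) (hr : r + 1 < n) :
    i ⟨r, by omega⟩ = i ⟨r + 1, hr⟩ ↔ w (r + 1) = w r + 1 := by
  rw [h _ hr, h r (by omega)]
  push_cast
  exact ⟨fun h => by linear_combination -2 * h, fun h => hl.eq_of_two (by linear_combination -h)⟩

theorem IsWt.succ_up_iff (hl : OddModulus l) (h : IsWt w i) (hr : r + 1 < n) :
    i ⟨r + 1, hr⟩ = i ⟨r, by omega⟩ + 1 ↔ w (r + 1) = w r + 3 := by
  rw [h _ hr, h r (by omega)]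
  push_cast
  exact ⟨fun h => by linear_combination 2 * h, fun h => hl.eq_of_two (by linear_combination h)⟩

theorem IsWt.succ_down_iff (hl : OddModulus l) (h : IsWt w i) (hr : r + 1 < n) :
    i ⟨r + 1, hr⟩ = i ⟨r, by omega⟩ - 1 ↔ w (r + 1) = w r - 1 := by
  rw [h _ hr, h r (by omega)]
  push_cast
  exact ⟨fun h => by linear_combination 2 * h, fun h => hl.eq_of_two (by linear_combination h)⟩

theorem IsWt.succ_succ_iff (hl : OddModulus l) (h : IsWt w i) (hr : r + 2 < n) :
    i ⟨r + 2, hr⟩ = i ⟨r, by omega⟩ ↔ w (r + 2) = w r + 2 := by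
  rw [h _ hr, h r (by omega)]
  push_cast
  exact ⟨fun h => by linear_combination 2 * h, fun h => hl.eq_of_two (by linear_combination h)⟩

end


end weight

section act
variable {l n : ℕ} [NeZero l] {hn : 3 ≤ n} {A : Type*} [Ring A] [Algebra ℂ A]
  {φ : FreeAlgebra ℂ (KLRGen l n) →ₐ[ℂ] A}

variable (φ) in
/-- The elements of weight `w`. -/
def On (w : ℕ → ZMod l) (a : A) : Prop := ∃ i, IsWt w i ∧ e φ i * a = a

theorem sum_mul_e (hφ : IsRep hn φ) {M : Res l n → A} (j) (a : A) (h : e φ j * a = a) :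
    (∑ i, M i * e φ i) * a = M j * a := by
  rw [Finset.sum_mul, Finset.sum_eq_single j]
  · rw [mul_assoc, h]
  · intro i _ hi
    rw [← h, mul_assoc, ← mul_assoc (e φ i), e_mul hφ, if_neg hi, zero_mul, mul_zero]
  · simp

theorem e_zero_of_cyc (hφ : IsRep hn φ) {w : ℕ → ZMod l} {i : Res l n} (hw : IsWt w i)
    (h : w 0 ≠ -1) : e φ i = 0 :=
  e_cyc hφ (by omega) fun h' => h (by
    rw [hw 0 (by omega), show i ⟨0, by omega⟩ = 0 from h']
    simp)

theorem y_zero (hφ : IsRep hn φ) : y φ 0 = 0 := by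
  have h : 0 < n := by omega
  rw [← mul_one (y φ 0), ← sum_e hφ, Finset.mul_sum]
  refine Finset.sum_eq_zero fun i _ => ?_
  by_cases h' : i ⟨0, h⟩ ∈ Lam1 l
  · rw [← map_yG h]
    simpa using hφ.rel (.cyc2 i ⟨0, h⟩ rfl h')
  · rw [e_cyc hφ h h', mul_zero]

/-- A representation acts on the ring it takes values in. -/
def act (hφ : IsRep hn φ) (hl : OddModulus l) : KAct l n A where
  On := On φ
  y := y φ
  P := psi φ
  on_y {w a r} _ := fun ⟨i, hi, ha⟩ => ⟨i, hi, by rw [← mul_assoc, ← y_e hφ, mul_assoc, ha]⟩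
  on_P {w a r} hr := fun ⟨i, hi, ha⟩ =>
    ⟨_, hi.sw hr, by rw [← mul_assoc, ← psi_e hφ, mul_assoc, ha]⟩
  on_add {w a b} := fun ⟨i, hi, ha⟩ ⟨j, hj, hb⟩ => ⟨i, hi, by
    rw [mul_add, ha, hi.inj hl hj, hb]⟩
  on_sub {w a b} := fun ⟨i, hi, ha⟩ ⟨j, hj, hb⟩ => ⟨i, hi, by
    rw [mul_sub, ha, hi.inj hl hj, hb]⟩
  on_smul {w a} c := fun ⟨i, hi, ha⟩ => ⟨i, hi, by rw [mul_smul_comm, ha]⟩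
  ext {x} h := by
    rw [← mul_one x, ← sum_e hφ, Finset.mul_sum]
    exact Finset.sum_eq_zero fun i _ => h (wt n i) _ ⟨i, isWt_wt i, by rw [e_mul hφ, if_pos rfl]⟩
  glue {r} hr F := ⟨∑ i, F (wt n i r) (wt n i (r + 1)) * e φ i, fun w a ⟨i, hi, ha⟩ => by
    rw [sum_mul_e hφ i a ha, isWt_wt i r (by omega), isWt_wt i (r + 1) hr, ← hi r (by omega),
      ← hi (r + 1) hr]⟩
  cyc {w a} := fun ⟨i, hi, ha⟩ h => by rw [← ha, e_zero_of_cyc hφ hi h, zero_mul]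
  y_zero := y_zero hφ
  bad {w a} := fun ⟨i, hi, ha⟩ h0 h1 h2 => by
    rw [← ha, e, hφ.bad, zero_mul]
    rw [hi 0 (by omega)] at h0
    rw [hi 1 (by omega)] at h1
    rw [hi 2 (by omega)] at h2
    push_cast at h0 h1 h2
    exact ⟨hl.eq_of_two (by linear_combination h0), hl.eq_of_two (by linear_combination h1),
      hl.eq_of_two (by linear_combination h2)⟩
  yy := y_y hφ
  Py_far := psi_y hφ
  PP_far := psi_psi hφ
  Py_eq {w a r} hr := fun ⟨i, hi, ha⟩ h => by
    have := psi_y_succ hφ hr i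
    rw [if_pos ((hi.succ_eq_iff hl hr).2 h)] at this
    simpa only [mul_assoc, add_mul, ha, one_mul] using congrArg (· * a) this
  yP_eq {w a r} hr := fun ⟨i, hi, ha⟩ h => by
    have := y_succ_psi hφ hr i
    rw [if_pos ((hi.succ_eq_iff hl hr).2 h)] at this
    simpa only [mul_assoc, add_mul, ha, one_mul] using congrArg (· * a) this
  Py_ne {w a r} hr := fun ⟨i, hi, ha⟩ h => by
    have := psi_y_succ hφ hr i
    rw [if_neg (mt (hi.succ_eq_iff hl hr).1 h)] at this
    simpa only [mul_assoc, add_mul, ha, zero_mul, add_zero] using congrArg (· * a) this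
  yP_ne {w a r} hr := fun ⟨i, hi, ha⟩ h => by
    have := y_succ_psi hφ hr i
    rw [if_neg (mt (hi.succ_eq_iff hl hr).1 h)] at this
    simpa only [mul_assoc, add_mul, ha, zero_mul, add_zero] using congrArg (· * a) this
  sq_eq {w a r} hr := fun ⟨i, hi, ha⟩ h => by
    have := psi_sq hφ hr i
    rw [if_pos ((hi.succ_eq_iff hl hr).2 h).symm] at this
    simpa only [mul_assoc, ha, zero_mul] using congrArg (· * a) this
  sq_up {w a r} hr := fun ⟨i, hi, ha⟩ h => by
    have := psi_sq hφ hr i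
    rw [if_neg (mt Eq.symm <| mt (hi.succ_eq_iff hl hr).1 fun h' => hl.ne2 (by grind)),
      if_pos ((hi.succ_up_iff hl hr).2 h)] at this
    simpa only [mul_assoc, sub_mul, ha] using congrArg (· * a) this
  sq_down {w a r} hr := fun ⟨i, hi, ha⟩ h => by
    have := psi_sq hφ hr i
    rw [if_neg (mt Eq.symm <| mt (hi.succ_eq_iff hl hr).1 fun h' => hl.ne2 (by grind)),
      if_neg (mt (hi.succ_up_iff hl hr).1 fun h' => hl.ne4 (by grind)),
      if_pos ((hi.succ_down_iff hl hr).2 h)] at this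
    simpa only [mul_assoc, sub_mul, ha] using congrArg (· * a) this
  sq_far {w a r} hr := fun ⟨i, hi, ha⟩ h1 h2 h3 => by
    have := psi_sq hφ hr i
    rw [if_neg (mt Eq.symm <| mt (hi.succ_eq_iff hl hr).1 h1),
      if_neg (mt (hi.succ_up_iff hl hr).1 h2), if_neg (mt (hi.succ_down_iff hl hr).1 h3)] at this
    simpa only [mul_assoc, ha, one_mul] using congrArg (· * a) this
  braid_up {w a r} hr := fun ⟨i, hi, ha⟩ h1 h2 => by
    have := braid hφ hr i
    rw [if_pos ⟨(hi.succ_succ_iff hl hr).2 h2, (hi.succ_up_iff hl _).2 h1⟩] at this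
    simpa only [mul_assoc, add_mul, ha, one_mul] using congrArg (· * a) this
  braid_down {w a r} hr := fun ⟨i, hi, ha⟩ h1 h2 => by
    have := braid hφ hr i
    rw [if_neg fun h => hl.ne4 (by have := (hi.succ_up_iff hl (by omega)).1 h.2; grind),
      if_pos ⟨(hi.succ_succ_iff hl hr).2 h2, (hi.succ_down_iff hl _).2 h1⟩] at this
    simpa only [mul_assoc, add_mul, ha, sub_mul, one_mul, ← sub_eq_add_neg] using
      congrArg (· * a) this

end act
end Rep

namespace Rep
variable {l n : ℕ} [NeZero l] {hn : 3 ≤ n} {A : Type*} [Ring A] [Algebra ℂ A]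
  {φ : FreeAlgebra ℂ (KLRGen l n) →ₐ[ℂ] A} {χ : AddChar (ZMod l) ℂ}

theorem e_mem (hφ : IsRep hn φ) (hl : OddModulus l) (hχ : ∀ k, χ k = 1 → k = 0)
    {R : Subalgebra ℂ A} (hU : ∀ p, p + 1 < n → (act hφ hl).U χ p ∈ R) (i : Res l n) :
    e φ i ∈ R := by
  have key : ∀ m ≤ n, ∃ x ∈ R, ∀ w a, On φ w a →
      x * a = if ∀ p < m, w p = wt n i p then a else 0 := fun m => by
    induction m with
    | zero => exact fun _ => ⟨1, R.one_mem, fun w a _ => by simp⟩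
    | succ m ih =>
      intro hm
      obtain ⟨x, hx, h⟩ := ih (by omega)
      obtain ⟨E, hE, h'⟩ := (act hφ hl).proj_mem hl hχ hU (p := m) (by omega) (wt n i m)
      refine ⟨x * E, R.mul_mem hx hE, fun w a ha => ?_⟩
      rw [mul_assoc, h' w a ha]
      by_cases hw : w m = wt n i m
      · rw [if_pos hw, h w a ha]
        simp only [Nat.lt_succ_iff_lt_or_eq, or_imp, forall_and, forall_eq, hw, and_true]
      · rw [if_neg hw, mul_zero, if_neg fun h => hw (h m (by omega))]
  obtain ⟨x, hx, h⟩ := key n le_rfl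
  convert hx
  refine (sub_eq_zero.1 ((act hφ hl).ext fun w a ha => ?_))
  obtain ⟨j, hj, ha'⟩ := ha
  rw [sub_mul, h w a ⟨j, hj, ha'⟩, sub_eq_zero]
  split_ifs with hw
  · have : IsWt w i := fun p hp => by rw [hw p hp, isWt_wt i p hp]
    rw [this.inj hl hj, ha']
  · rw [← ha', ← mul_assoc, e_mul hφ, if_neg, zero_mul]
    rintro rfl
    exact hw fun p hp => by rw [hj p hp, isWt_wt i p hp]

/-- Any subalgebra which contains the Temperley–Lieb generators contains everything. -/
theorem map_mem_of_U (hφ : IsRep hn φ) (hl : OddModulus l) (hχ : ∀ k, χ k = 1 → k = 0)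
    {R : Subalgebra ℂ A} (hU : ∀ p, p + 1 < n → (act hφ hl).U χ p ∈ R) (x) : φ x ∈ R :=
  map_mem (e_mem hφ hl hχ hU) (fun _ hr => ((act hφ hl).y_mem hl hχ hU hr).1)
    (fun _ hr => (act hφ hl).P_mem hl hχ hU hr) x

end Rep

/-- The relations between a Temperley–Lieb generator `U` and a Jucys–Murphy element `G` with
inverse `H`. -/
structure JMStep {A : Type*} [Ring A] [Algebra ℂ A] (t s : ℂ) (U G H : A) : Prop where
  ts : t * s = 1
  sq : U * U = -(t + s) • U
  GH : G * H = 1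
  HG : H * G = 1
  comm : H * U = U * G + U * H - G * U
  UGU : U * (G * U) = -s • (U * G + U * H)
  UHU : U * (H * U) = -t • (U * G + U * H)

namespace JMStep
variable {A : Type*} [Ring A] [Algebra ℂ A] {t s : ℂ} {U G H : A}

/-- The next Jucys–Murphy element. -/
def nextG (s : ℂ) (U G H : A) : A := G * U - U * H + s • G
/-- The inverse of the next Jucys–Murphy element. -/
def nextH (t : ℂ) (U G H : A) : A := t • H - G * U + U * H

theorem nextG_add_nextH (t s : ℂ) (U G H : A) :
    nextG s U G H + nextH t U G H = s • G + t • H := by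
  rw [nextG, nextH]
  abel

theorem sq_left (j : JMStep t s U G H) (a : A) : U * (U * a) = -(t + s) • (U * a) := by
  rw [← mul_assoc, j.sq, smul_mul_assoc]
theorem GH_left (j : JMStep t s U G H) (a : A) : G * (H * a) = a := by
  rw [← mul_assoc, j.GH, one_mul]
theorem HG_left (j : JMStep t s U G H) (a : A) : H * (G * a) = a := by
  rw [← mul_assoc, j.HG, one_mul]
theorem comm_left (j : JMStep t s U G H) (a : A) :
    H * (U * a) = U * (G * a) + U * (H * a) - G * (U * a) := by
  rw [← mul_assoc, j.comm]
  simp only [add_mul, sub_mul, mul_assoc]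
theorem UGU_left (j : JMStep t s U G H) (a : A) :
    U * (G * (U * a)) = -s • (U * (G * a) + U * (H * a)) := by
  rw [← mul_assoc G, ← mul_assoc, j.UGU]
  simp only [add_mul, smul_mul_assoc, mul_assoc]

theorem nextG_eq (j : JMStep t s U G H) : nextG s U G H = U * G - H * U + s • G := by
  rw [nextG, j.comm]
  abel

theorem U_nextG (j : JMStep t s U G H) : U * nextG s U G H = t • (U * H) := by
  rw [nextG]
  simp only [mul_add, mul_sub, j.UGU, j.sq_left, mul_smul_comm]
  module

theorem nextG_U (j : JMStep t s U G H) : nextG s U G H * U = t • (H * U) := by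
  rw [nextG]
  simp only [add_mul, sub_mul, mul_assoc, smul_mul_assoc, j.sq, j.UGU, j.comm, mul_smul_comm,
    mul_add, mul_sub, j.sq_left]
  module

theorem U_nextH (j : JMStep t s U G H) : U * nextH t U G H = s • (U * G) := by
  rw [nextH]
  simp only [mul_add, mul_sub, j.UGU, j.sq_left, mul_smul_comm]
  module

theorem nextH_U (j : JMStep t s U G H) : nextH t U G H * U = s • (G * U) := by
  rw [nextH]
  simp only [add_mul, sub_mul, mul_assoc, smul_mul_assoc, j.sq, j.UGU, j.comm, mul_smul_comm,
    mul_add, mul_sub, j.sq_left]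
  module

theorem nextG_nextH (j : JMStep t s U G H) : nextG s U G H * nextH t U G H = 1 := by
  have h := j.ts
  have k : U = G * (U * G) + G * (U * H) - G * (G * U) := by
    conv_lhs => rw [← j.GH_left U, j.comm]
    simp only [mul_add, mul_sub]
  rw [nextG]
  simp only [add_mul, sub_mul, mul_assoc, smul_mul_assoc, j.U_nextH]
  rw [nextH]
  simp only [mul_add, mul_sub, mul_smul_comm, j.GH, j.HG, j.HG_left, j.GH_left, j.comm_left,
    j.sq_left, j.UGU_left, j.sq, j.comm, smul_add, smul_sub, smul_smul, mul_one]
  linear_combination (norm := module) h • (1 : A) - s • k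

theorem nextH_nextG (j : JMStep t s U G H) : nextH t U G H * nextG s U G H = 1 := by
  have h := j.ts
  rw [nextH]
  simp only [add_mul, sub_mul, mul_assoc, smul_mul_assoc, j.U_nextG]
  rw [nextG]
  simp only [mul_add, mul_sub, mul_smul_comm, j.GH, j.HG, j.HG_left, j.GH_left, j.comm_left,
    j.sq_left, j.UGU_left, j.sq, j.comm, smul_add, smul_sub, smul_smul, mul_one]
  linear_combination (norm := module) h • (1 : A)

theorem nextG_comm (j : JMStep t s U G H) : nextG s U G H * G = G * nextG s U G H := by
  nth_rw 2 [j.nextG_eq]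
  rw [nextG]
  simp only [add_mul, sub_mul, mul_add, mul_sub, mul_assoc, j.HG, j.GH_left, mul_one,
    mul_smul_comm, smul_mul_assoc]

/-- The relation for the next generator. -/
theorem next (j : JMStep t s U G H) {V : A} (hV : V * V = -(t + s) • V) (h2 : V * (U * V) = V)
    (hG : V * G = G * V) (hH : V * H = H * V) :
    JMStep t s V (nextG s U G H) (nextH t U G H) := by
  have h := j.ts
  have e2 : ∀ a, V * (U * (V * a)) = V * a := fun a => by
    rw [← mul_assoc U, ← mul_assoc, h2]
  have eV : ∀ a, V * (V * a) = -(t + s) • (V * a) := fun a => by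
    rw [← mul_assoc, hV, smul_mul_assoc]
  have eG : ∀ a, V * (G * a) = G * (V * a) := fun a => by
    rw [← mul_assoc, hG, mul_assoc]
  have eH : ∀ a, V * (H * a) = H * (V * a) := fun a => by
    rw [← mul_assoc, hH, mul_assoc]
  refine ⟨h, hV, j.nextG_nextH, j.nextH_nextG, ?_, ?_, ?_⟩
  · rw [eq_sub_iff_add_eq, ← add_mul, ← mul_add, add_comm (nextH t U G H), nextG_add_nextH]
    simp only [add_mul, mul_add, smul_mul_assoc, mul_smul_comm, hG, hH]
  · rw [← mul_add, nextG_add_nextH, nextG]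
    simp only [add_mul, sub_mul, mul_add, mul_sub, mul_assoc, smul_mul_assoc, mul_smul_comm, eG,
      ← hH, hV, hG, smul_add, smul_sub, smul_smul, h2, e2, eV]
    linear_combination (norm := module) h • (V * H) - h • (G * V)
  · rw [← mul_add, nextG_add_nextH, nextH]
    simp only [add_mul, sub_mul, mul_add, mul_sub, mul_assoc, smul_mul_assoc, mul_smul_comm, eG,
      ← hH, hV, hG, smul_add, smul_sub, smul_smul, h2, e2, eV]
    linear_combination (norm := module) h • (G * V) - h • (V * H)

theorem nextH_eq (j : JMStep t s U G H) : nextH t U G H = t • H - U * G + H * U := by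
  rw [nextH, j.comm]
  abel

variable {V : A}

theorem commute_nextG_nextG (j : JMStep t s U G H)
    (j' : JMStep t s V (nextG s U G H) (nextH t U G H)) (h1 : U * (V * U) = U)
    (hG : V * G = G * V) (hH : V * H = H * V) :
    Commute U (nextG s V (nextG s U G H) (nextH t U G H)) := by
  have h := j.ts
  have h1' : ∀ a, U * (V * (U * a)) = U * a := fun a => by
    rw [← mul_assoc V, ← mul_assoc, h1]
  have e1 : U * nextG s V (nextG s U G H) (nextH t U G H) = U * (V * (G * U)) := by
    rw [nextG]
    simp only [mul_add, mul_sub, mul_smul_comm, j.U_nextG]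
    rw [← mul_assoc, j.U_nextG, nextH]
    simp only [mul_add, mul_sub, mul_smul_comm, h1', smul_mul_assoc, mul_assoc, ← hH]
    linear_combination (norm := module) h • (U * H)
  have e2 : nextG s V (nextG s U G H) (nextH t U G H) * U = U * (V * (G * U)) := by
    rw [j'.nextG_eq]
    simp only [add_mul, sub_mul, smul_mul_assoc, mul_assoc, j.nextG_U]
    rw [j.nextH_eq]
    simp only [add_mul, sub_mul, mul_smul_comm, smul_mul_assoc, mul_assoc, h1]
    have e3 : ∀ a, H * (V * a) = V * (H * a) := fun a => by rw [← mul_assoc, ← hH, mul_assoc]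
    have e4 : ∀ a, G * (V * a) = V * (G * a) := fun a => by rw [← mul_assoc, ← hG, mul_assoc]
    simp only [e3, e4]
    linear_combination (norm := module) h • (H * U)
  exact e1.trans e2.symm

theorem commute_nextH_nextH (j : JMStep t s U G H)
    (j' : JMStep t s V (nextG s U G H) (nextH t U G H)) (h1 : U * (V * U) = U)
    (hG : V * G = G * V) (hH : V * H = H * V) :
    Commute U (nextH t V (nextG s U G H) (nextH t U G H)) := by
  have h := j.ts
  rw [← add_sub_cancel_left (nextG s V (nextG s U G H) (nextH t U G H)) (nextH t V _ _),
    nextG_add_nextH]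
  refine .sub_right ?_ (j.commute_nextG_nextG j' h1 hG hH)
  rw [Commute, SemiconjBy, mul_add, add_mul]
  simp only [mul_smul_comm, smul_mul_assoc, j.U_nextG, j.nextG_U, j.U_nextH, j.nextH_U, j.comm]
  module

end JMStep

/-- Elements of an algebra satisfying the Temperley–Lieb relations at the parameter `χ 1`. -/
structure TLAct {l : ℕ} (χ : AddChar (ZMod l) ℂ) (n : ℕ) (A : Type*) [Ring A]
    [Algebra ℂ A] where
  U : ℕ → A
  sq : ∀ {p}, p + 1 < n → U p * U p = -(χ 1 + χ (-1)) • U p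
  up : ∀ {p}, p + 2 < n → U p * (U (p + 1) * U p) = U p
  down : ∀ {p}, p + 2 < n → U (p + 1) * (U p * U (p + 1)) = U (p + 1)
  far : ∀ {p r}, p + 1 < r → r + 1 < n → Commute (U p) (U r)

theorem commute_inv {A : Type*} [Ring A] {x G H : A} (h : G * H = 1) (h' : H * G = 1)
    (hx : Commute x G) : Commute x H :=
  Commute.units_inv_right (u := ⟨G, H, h, h'⟩) hx

theorem pow_add_pow {A : Type*} [Ring A] {G H K L : A} (h1 : G * H = 1) (h2 : H * G = 1)
    (h3 : K * L = 1) (h4 : L * K = 1) (h : G + H = K + L) (m : ℕ) :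
    G ^ m + H ^ m = K ^ m + L ^ m := by
  have key : ∀ {G H : A}, G * H = 1 → H * G = 1 → ∀ m : ℕ,
      G ^ (m + 2) + H ^ (m + 2) = (G + H) * (G ^ (m + 1) + H ^ (m + 1)) - (G ^ m + H ^ m) := by
    intro G H h1 h2 m
    have e1 : G * H ^ (m + 1) = H ^ m := by rw [pow_succ', ← mul_assoc, h1, one_mul]
    have e2 : H * G ^ (m + 1) = G ^ m := by rw [pow_succ', ← mul_assoc, h2, one_mul]
    rw [add_mul, mul_add, mul_add, e1, e2, ← pow_succ', ← pow_succ']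
    abel
  induction m using Nat.strong_induction_on with
  | _ m ih =>
    match m with
    | 0 => simp
    | 1 => simpa using h
    | m + 2 => rw [key h1 h2, key h3 h4, ih _ (by omega), ih _ (by omega), h]

theorem one_add_pow_of_sq {A : Type*} [Ring A] {a : A} (h : a * a = 0) (m : ℕ) :
    (1 + a) ^ m = 1 + (m : A) * a := by
  induction m with
  | zero => simp
  | succ m ih =>
    rw [pow_succ, ih, add_mul, mul_add, mul_add, mul_assoc _ a a, h]
    push_cast
    noncomm_ring

namespace TLAct
variable {l n : ℕ} {A : Type*} [Ring A] [Algebra ℂ A] {χ : AddChar (ZMod l) ℂ}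

theorem char_mul_neg (χ : AddChar (ZMod l) ℂ) (k : ZMod l) : χ k * χ (-k) = 1 := by
  rw [← AddChar.map_add_eq_mul]
  simp

variable (T : TLAct χ n A)

/-- The Jucys–Murphy elements and their inverses. -/
def GH : ℕ → A × A
  | 0 => (χ (-1) • 1, χ 1 • 1)
  | r + 1 => (JMStep.nextG (χ (-1)) (T.U r) (GH r).1 (GH r).2,
      JMStep.nextH (χ 1) (T.U r) (GH r).1 (GH r).2)

/-- The Jucys–Murphy elements. -/
def G (r : ℕ) : A := (T.GH r).1
/-- The inverses of the Jucys–Murphy elements. -/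
def H (r : ℕ) : A := (T.GH r).2

theorem G_zero : T.G 0 = χ (-1) • 1 := rfl
theorem H_zero : T.H 0 = χ 1 • 1 := rfl
theorem G_succ (r) : T.G (r + 1) = JMStep.nextG (χ (-1)) (T.U r) (T.G r) (T.H r) := rfl

theorem commute_succ {x : A} {r} (hG : Commute x (T.G r)) (hH : Commute x (T.H r))
    (hU : Commute x (T.U r)) : Commute x (T.G (r + 1)) ∧ Commute x (T.H (r + 1)) :=
  ⟨((hG.mul_right hU).sub_right (hU.mul_right hH)).add_right (hG.smul_right _),
    ((hH.smul_right _).sub_right (hG.mul_right hU)).add_right (hU.mul_right hH)⟩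

theorem commute_U_GH {r j} (h : r < j) (hj : j + 1 < n) :
    Commute (T.U j) (T.G r) ∧ Commute (T.U j) (T.H r) := by
  induction r with
  | zero =>
    rw [G_zero, H_zero]
    exact ⟨(Commute.one_right _).smul_right _, (Commute.one_right _).smul_right _⟩
  | succ r ih =>
    obtain ⟨h1, h2⟩ := ih (by omega)
    exact T.commute_succ h1 h2 (T.far h hj).symm

theorem jm {r} (hr : r + 1 < n) : JMStep (χ 1) (χ (-1)) (T.U r) (T.G r) (T.H r) := by
  have h := char_mul_neg χ 1
  induction r with
  | zero =>
    rw [G_zero, H_zero]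
    refine ⟨h, T.sq hr, ?_, ?_, ?_, ?_, ?_⟩ <;>
      simp only [mul_smul_comm, smul_mul_assoc, mul_one, one_mul, T.sq hr, smul_smul, mul_comm, h,
        one_smul] <;> module
  | succ r ih =>
    obtain ⟨h1, h2⟩ := T.commute_U_GH (Nat.lt_succ_self r) hr
    exact (ih (by omega)).next (T.sq hr) (T.down hr) h1 h2

theorem GH_mul {r} (hr : r < n) : T.G r * T.H r = 1 ∧ T.H r * T.G r = 1 := by
  cases r with
  | zero => simp [G_zero, H_zero, smul_smul, mul_comm, char_mul_neg χ 1]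
  | succ r => exact ⟨(T.jm hr).nextG_nextH, (T.jm hr).nextH_nextG⟩

theorem commute_U_GH_of_lt {r m} (h : r + 2 ≤ m) (hm : m < n) :
    Commute (T.U r) (T.G m) ∧ Commute (T.U r) (T.H m) := by
  induction m, h using Nat.le_induction with
  | base =>
    obtain ⟨h1, h2⟩ := T.commute_U_GH (Nat.lt_succ_self r) hm
    have j := T.jm (r := r) (by omega)
    exact ⟨j.commute_nextG_nextG (T.jm hm) (T.up hm) h1 h2,
      j.commute_nextH_nextH (T.jm hm) (T.up hm) h1 h2⟩
  | succ m h ih =>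
    obtain ⟨h1, h2⟩ := ih (by omega)
    exact T.commute_succ h1 h2 (T.far (by omega) hm)

theorem commute_G_GH {r m} (h : r ≤ m) (hm : m < n) :
    Commute (T.G r) (T.G m) ∧ Commute (T.G r) (T.H m) := by
  induction m, h using Nat.le_induction with
  | base => exact ⟨rfl, ((T.GH_mul hm).1.trans (T.GH_mul hm).2.symm)⟩
  | succ m h ih =>
    obtain ⟨h1, h2⟩ := ih (by omega)
    rcases eq_or_lt_of_le h with rfl | h
    · have h3 : Commute (T.G r) (T.G (r + 1)) := (T.jm hm).nextG_comm.symm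
      exact ⟨h3, commute_inv (T.GH_mul hm).1 (T.GH_mul hm).2 h3⟩
    · exact T.commute_succ h1 h2 (T.commute_U_GH h hm).1.symm

theorem commute_G {r m} (hr : r < n) (hm : m < n) : Commute (T.G r) (T.G m) := by
  rcases le_total r m with h | h
  · exact (T.commute_G_GH h hm).1
  · exact (T.commute_G_GH h hr).1.symm

theorem pow_add_pow [NeZero l] {r} (hr : r < n) : T.G r ^ l + T.H r ^ l = 2 := by
  have hc : ∀ k, χ k ^ l = 1 := fun k => by
    rw [← AddChar.map_nsmul_eq_pow]
    simp
  induction r with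
  | zero =>
    rw [G_zero, H_zero, smul_pow, smul_pow, hc, hc]
    norm_num
  | succ r ih =>
    have h1 := T.GH_mul hr
    have h2 := T.GH_mul (r := r) (by omega)
    have h3 := char_mul_neg χ 1
    rw [← ih (by omega), Statement3.pow_add_pow h1.1 h1.2 (K := χ (-1) • T.G r) (L := χ 1 • T.H r)
      (by simp [smul_smul, h2, h3]) (by simp [smul_smul, h2, h3, mul_comm])
      (JMStep.nextG_add_nextH _ _ _ _ _), smul_pow, smul_pow, hc, hc, one_smul, one_smul]

/-- The nilpotent part of the Jucys–Murphy element. -/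
def y (r : ℕ) : A := if r < n then (l : ℂ)⁻¹ • (T.G r ^ l - 1) else 0

/-- The semisimple part of the Jucys–Murphy element. -/
def S (r : ℕ) : A := T.G r * (1 - T.y r)

theorem commute_y {x : A} {r} (h : r < n → Commute x (T.G r)) : Commute x (T.y r) := by
  rw [y]
  split_ifs with hr
  · exact (((h hr).pow_right l).sub_right (.one_right _)).smul_right _
  · exact Commute.zero_right x

theorem commute_S {x : A} {r} (h : Commute x (T.G r)) : Commute x (T.S r) :=
  h.mul_right ((Commute.one_right _).sub_right (T.commute_y fun _ => h))

theorem commute_y_G (r) {m} (hm : m < n) : Commute (T.y r) (T.G m) :=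
  (T.commute_y fun hr => T.commute_G hm hr).symm

theorem commute_y_y (r m) : Commute (T.y r) (T.y m) := T.commute_y fun hm => T.commute_y_G r hm

theorem commute_y_S (r) {m} (hm : m < n) : Commute (T.y r) (T.S m) :=
  T.commute_S (T.commute_y_G r hm)

theorem commute_S_S {r m} (hr : r < n) (hm : m < n) : Commute (T.S r) (T.S m) :=
  T.commute_S (T.commute_S (T.commute_G hm hr)).symm

variable [NeZero l]

theorem smul_y {r} (hr : r < n) : (l : ℂ) • T.y r = T.G r ^ l - 1 := by
  rw [y, if_pos hr, smul_smul, mul_inv_cancel₀ (NeZero.ne _), one_smul]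

theorem y_sq (r) : T.y r * T.y r = 0 := by
  by_cases hr : r < n
  swap
  · simp [y, hr]
  have hl : (l : ℂ) ≠ 0 := NeZero.ne _
  have h1 := T.pow_add_pow hr
  have h2 : T.G r ^ l * T.H r ^ l = 1 := by
    have h3 : Commute (T.G r) (T.H r) := (T.GH_mul hr).1.trans (T.GH_mul hr).2.symm
    rw [← h3.mul_pow, (T.GH_mul hr).1, one_pow]
  rw [y, if_pos hr, smul_mul_smul_comm]
  have h4 : (T.G r ^ l - 1) * (T.G r ^ l - 1) = 0 := by
    rw [← eq_sub_iff_add_eq'] at h1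
    rw [h1] at h2
    linear_combination (norm := noncomm_ring) -h2
  rw [h4, smul_zero]

theorem S_pow {r} (hr : r < n) : T.S r ^ l = 1 := by
  have h := T.smul_y hr
  have h2 := T.y_sq r
  have h3 : (-T.y r) * (-T.y r) = 0 := by rw [neg_mul_neg, h2]
  have h4 : (1 - T.y r) ^ l = 1 - (l : ℂ) • T.y r := by
    rw [sub_eq_add_neg, one_add_pow_of_sq h3, Algebra.smul_def, map_natCast]
    noncomm_ring
  have h5 : Commute (T.G r) (1 - T.y r) := (Commute.one_right _).sub_right (T.commute_y_G r hr).symm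
  rw [S, h5.mul_pow, h4, show T.G r ^ l = 1 + (l : ℂ) • T.y r by rw [h]; abel, add_mul, one_mul,
    mul_sub, smul_mul_smul_comm, h2]
  simp

end TLAct

theorem eq_zero_of_unipotent {A : Type*} [Ring A] [Algebra ℂ A] {y z b : A} {c d e f : ℂ}
    (hc : c ≠ 0) (hyz : y * z = z * y) (hy : y * y = 0) (hz : z * z = 0)
    (h : c • b + d • (y * b) + e • (z * b) + f • (y * (z * b)) = 0) : b = 0 := by
  have hy' : ∀ a, y * (y * a) = 0 := fun a => by rw [← mul_assoc, hy, zero_mul]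
  have hz' : ∀ a, z * (z * a) = 0 := fun a => by rw [← mul_assoc, hz, zero_mul]
  have hzy : ∀ a, z * (y * a) = y * (z * a) := fun a => by rw [← mul_assoc, ← hyz, mul_assoc]
  have key : ∀ a : A, c • a = 0 → a = 0 := fun a ha => (smul_eq_zero.1 ha).resolve_left hc
  have h1 : y * (z * b) = 0 := key _ (by
    simpa [mul_add, mul_smul_comm, hy', hz', hzy] using congrArg (fun x => y * (z * x)) h)
  have h2 : y * b = 0 := key _ (by
    simpa [mul_add, mul_smul_comm, hy', h1] using congrArg (fun x => y * x) h)
  have h3 : z * b = 0 := key _ (by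
    simpa [mul_add, mul_smul_comm, hz', hzy, h1] using congrArg (fun x => z * x) h)
  exact key _ (by simpa [h1, h2, h3] using h)

namespace TLAct
variable {l n : ℕ} {A : Type*} [Ring A] [Algebra ℂ A] {χ : AddChar (ZMod l) ℂ}
variable (T : TLAct χ n A)

/-- The elements of weight `w`. -/
def On (w : ℕ → ZMod l) (a : A) : Prop := ∀ p < n, T.S p * a = χ (w p) • a

variable {T}

theorem On.mul {w a} (ha : T.On w a) {x : A} (h : ∀ p < n, Commute x (T.S p)) :
    T.On w (x * a) := fun p hp => by
  rw [← mul_assoc, ← (h p hp), mul_assoc, ha p hp, mul_smul_comm]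

theorem On.add {w a b} (ha : T.On w a) (hb : T.On w b) : T.On w (a + b) := fun p hp => by
  rw [mul_add, ha p hp, hb p hp, smul_add]

theorem On.sub {w a b} (ha : T.On w a) (hb : T.On w b) : T.On w (a - b) := fun p hp => by
  rw [mul_sub, ha p hp, hb p hp, smul_sub]

theorem On.smul {w a} (c : ℂ) (ha : T.On w a) : T.On w (c • a) := fun p hp => by
  rw [mul_smul_comm, ha p hp, smul_comm]

theorem On.y {w a} (ha : T.On w a) (r) : T.On w (T.y r * a) := ha.mul fun _ => T.commute_y_S r

variable (T) in
theorem commute_U_G {p r} (hp : p + 1 < n) (hr : r < n) (h1 : r ≠ p) (h2 : r ≠ p + 1) :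
    Commute (T.U p) (T.G r) := by
  rcases lt_or_gt_of_ne h1 with h | h
  · exact (T.commute_U_GH h hp).1
  · exact (T.commute_U_GH_of_lt (by omega) hr).1

variable (T) in
theorem commute_U_S {p r} (hp : p + 1 < n) (hr : r < n) (h1 : r ≠ p) (h2 : r ≠ p + 1) :
    Commute (T.U p) (T.S r) := T.commute_S (T.commute_U_G hp hr h1 h2)

variable (T) in
theorem commute_y_H (r) {m} (hm : m < n) : Commute (T.y r) (T.H m) :=
  commute_inv (T.GH_mul hm).1 (T.GH_mul hm).2 (T.commute_y_G r hm)

variable (T) in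
theorem commute_S_H {r m} (hr : r < n) (hm : m < n) : Commute (T.S r) (T.H m) :=
  commute_inv (T.GH_mul hm).1 (T.GH_mul hm).2 (T.commute_S (T.commute_G hm hr)).symm

variable (T) in
theorem commute_G_H {r m} (hr : r < n) (hm : m < n) : Commute (T.G r) (T.H m) :=
  commute_inv (T.GH_mul hm).1 (T.GH_mul hm).2 (T.commute_G hr hm)

theorem On.G {w a} (ha : T.On w a) {p} (hp : p < n) : T.On w (T.G p * a) :=
  ha.mul fun _ hr => (T.commute_S (T.commute_G hp hr))

theorem On.H {w a} (ha : T.On w a) {p} (hp : p < n) : T.On w (T.H p * a) :=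
  ha.mul fun _ hr => (T.commute_S_H hr hp).symm

theorem y_zero (hn : 0 < n) : T.y 0 = 0 := by
  have hc : χ (-1) ^ l = 1 := by
    rw [← AddChar.map_nsmul_eq_pow]
    simp
  rw [y, if_pos hn, G_zero, smul_pow, hc, one_pow]
  simp

theorem S_zero (hn : 0 < n) : T.S 0 = χ (-1) • 1 := by
  rw [S, y_zero hn, G_zero, sub_zero, mul_one]

theorem quadratic {p} (hp : p + 1 < n) (a : A) :
    T.G (p + 1) * (T.G (p + 1) * a) + a =
      χ (-1) • (T.G (p + 1) * (T.G p * a)) + χ 1 • (T.G (p + 1) * (T.H p * a)) := by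
  have h : T.G (p + 1) + T.H (p + 1) = χ (-1) • T.G p + χ 1 • T.H p :=
    JMStep.nextG_add_nextH _ _ _ _ _
  have h2 := congrArg (fun x => T.G (p + 1) * (x * a)) h
  simp only [add_mul, mul_add, smul_mul_assoc, mul_smul_comm] at h2
  rw [← h2, ← mul_assoc _ (T.H _), (T.GH_mul hp).1, one_mul]

theorem char_ne {x y : ZMod l} (hχ : ∀ k, χ k = 1 → k = 0) (h : x ≠ y) : χ x - χ y ≠ 0 :=
  fun h' => h (sub_eq_zero.1 (hχ _ (by
    rw [sub_eq_add_neg, AddChar.map_add_eq_mul, sub_eq_zero.1 h', char_mul_neg])))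

theorem char_sq_ne (hl : OddModulus l) {x : ZMod l} (hχ : ∀ k, χ k = 1 → k = 0) (h : x ≠ 0) :
    χ x * χ x - 1 ≠ 0 := fun h' => h (by
  rw [← AddChar.map_add_eq_mul, sub_eq_zero] at h'
  exact hl.eq_of_two (by linear_combination hχ _ h'))

theorem on_cyc (hχ : ∀ k, χ k = 1 → k = 0) (hn : 0 < n) {w a} (ha : T.On w a) (h : w 0 ≠ -1) :
    a = 0 := by
  have h1 := ha 0 hn
  rw [S_zero hn, smul_mul_assoc, one_mul, ← sub_eq_zero, ← sub_smul] at h1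
  exact (smul_eq_zero.1 h1).resolve_left (char_ne hχ h.symm)

variable [NeZero l]

variable (T) in
theorem y_sq_left (p) (a : A) : T.y p * (T.y p * a) = 0 := by
  rw [← mul_assoc, T.y_sq, zero_mul]

theorem G_mul {w a} (ha : T.On w a) {p} (hp : p < n) :
    T.G p * a = χ (w p) • (a + T.y p * a) := by
  have h := (ha.add (ha.y p)) p hp
  rw [← h, S, mul_assoc, sub_mul, mul_add (T.y p), y_sq_left]
  simp

theorem H_mul {w a} (ha : T.On w a) {p} (hp : p < n) :
    T.H p * a = χ (-w p) • (a - T.y p * a) := by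
  have h := G_mul (ha.H hp) hp
  have h3 : ∀ a, T.y p * (T.H p * a) = T.H p * (T.y p * a) := fun a => by
    rw [← mul_assoc, T.commute_y_H p hp, mul_assoc]
  have h4 : ∀ a, T.G p * (T.H p * a) = a := fun a => by
    rw [← mul_assoc, (T.GH_mul hp).1, one_mul]
  rw [h4, h3] at h
  have h5 : T.y p * a = χ (w p) • (T.H p * (T.y p * a)) := by
    conv_lhs => rw [h]
    rw [mul_smul_comm, mul_add, h3, h3, y_sq_left, mul_zero, add_zero]
  have h6 : a - T.y p * a = χ (w p) • (T.H p * a) := by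
    conv_lhs => rw [h5]
    nth_rw 1 [h]
    module
  rw [h6, smul_smul, mul_comm, char_mul_neg, one_smul]

variable (T) in
theorem y_succ_U {p} (hp : p + 1 < n) : T.y (p + 1) * T.U p = - (T.y p * T.U p) := by
  have hl : (l : ℂ) ≠ 0 := NeZero.ne _
  have j := T.jm hp
  have key : ∀ m : ℕ, T.G (p + 1) ^ m * T.U p = χ 1 ^ m • (T.H p ^ m * T.U p) := by
    intro m
    induction m with
    | zero => simp
    | succ m ih =>
      have h := T.commute_G_H hp (m := p) (by omega)
      rw [pow_succ', mul_assoc, ih, mul_smul_comm, ← mul_assoc, h.pow_right m, mul_assoc,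
        show T.G (p + 1) * T.U p = _ from j.nextG_U, mul_smul_comm, smul_smul, ← mul_assoc,
        ← pow_succ,
        ← pow_succ]
  have hc : χ 1 ^ l = 1 := by
    rw [← AddChar.map_nsmul_eq_pow]
    simp
  have h1 := key l
  rw [hc, one_smul, eq_sub_of_add_eq' (T.pow_add_pow (r := p) (by omega))] at h1
  rw [y, y, if_pos hp, if_pos (by omega), smul_mul_assoc, smul_mul_assoc, ← smul_neg, sub_mul, h1]
  congr 1
  noncomm_ring

variable (T) in
theorem U_y_succ {p} (hp : p + 1 < n) : T.U p * T.y (p + 1) = - (T.U p * T.y p) := by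
  have hl : (l : ℂ) ≠ 0 := NeZero.ne _
  have j := T.jm hp
  have key : ∀ m : ℕ, T.U p * T.G (p + 1) ^ m = χ 1 ^ m • (T.U p * T.H p ^ m) := by
    intro m
    induction m with
    | zero => simp
    | succ m ih =>
      have h := T.commute_G_H hp (m := p) (by omega)
      rw [pow_succ, ← mul_assoc, ih, smul_mul_assoc, mul_assoc, ← h.pow_right m, ← mul_assoc,
        show T.U p * T.G (p + 1) = _ from j.U_nextG, smul_mul_assoc, smul_smul, mul_assoc,
        ← pow_succ',
        ← pow_succ]
  have hc : χ 1 ^ l = 1 := by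
    rw [← AddChar.map_nsmul_eq_pow]
    simp
  have h1 := key l
  rw [hc, one_smul, eq_sub_of_add_eq' (T.pow_add_pow (r := p) (by omega))] at h1
  rw [y, y, if_pos hp, if_pos (by omega), mul_smul_comm, mul_smul_comm, ← smul_neg, mul_sub, h1]
  congr 1
  noncomm_ring

theorem y_succ_U_left {p} (hp : p + 1 < n) (a : A) :
    T.y (p + 1) * (T.U p * a) = - (T.y p * (T.U p * a)) := by
  rw [← mul_assoc, T.y_succ_U hp, neg_mul, mul_assoc]

theorem U_y_succ_left {p} (hp : p + 1 < n) (a : A) :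
    T.U p * (T.y (p + 1) * a) = - (T.U p * (T.y p * a)) := by
  rw [← mul_assoc, T.U_y_succ hp, neg_mul, mul_assoc]

theorem U_of_ne (hχ : ∀ k, χ k = 1 → k = 0) {p} (hp : p + 1 < n) {w a} (ha : T.On w a)
    (h : w (p + 1) ≠ 1 - w p) : T.U p * a = 0 := by
  have hm : ∀ a, T.U p * (T.G (p + 1) * a) = χ 1 • (T.U p * (T.H p * a)) := fun a => by
    rw [← mul_assoc, show T.U p * T.G (p + 1) = _ from (T.jm hp).U_nextG, smul_mul_assoc, mul_assoc]
  have h1 := hm (a + T.y p * a)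
  rw [G_mul (ha.add (ha.y p)) hp, H_mul (ha.add (ha.y p)) (by omega)] at h1
  have hyy : T.y (p + 1) * (T.y p * a) = T.y p * (T.y (p + 1) * a) := by
    rw [← mul_assoc, T.commute_y_y, mul_assoc]
  simp only [mul_smul_comm, mul_add, mul_sub, U_y_succ_left hp, y_sq_left, mul_zero, neg_zero] at h1
  have h2 : (χ (w (p + 1)) - χ 1 * χ (-w p)) • (T.U p * a) = 0 := by
    linear_combination (norm := module) h1
  refine (smul_eq_zero.1 h2).resolve_left fun h3 => h ?_
  rw [← AddChar.map_add_eq_mul, sub_eq_zero, ← sub_eq_add_neg] at h3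
  refine sub_eq_zero.1 (hχ _ ?_)
  rw [sub_eq_add_neg, AddChar.map_add_eq_mul, h3, char_mul_neg]

theorem quadratic_on {p} (hp : p + 1 < n) {w a} (ha : T.On w a) :
    (χ (w (p + 1)) * χ (w (p + 1)) + 1) • a +
      (2 * χ (w (p + 1)) * χ (w (p + 1))) • (T.y (p + 1) * a)
    = (χ (w (p + 1)) * χ (w p - 1)) • (a + T.y p * a + T.y (p + 1) * a + T.y p * (T.y (p + 1) * a))
      + (χ (w (p + 1)) * χ (1 - w p)) •
        (a - T.y p * a + T.y (p + 1) * a - T.y p * (T.y (p + 1) * a)) := by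
  have h := quadratic (T := T) hp a
  have hyy : T.y (p + 1) * (T.y p * a) = T.y p * (T.y (p + 1) * a) := by
    rw [← mul_assoc, T.commute_y_y, mul_assoc]
  rw [G_mul (ha.G hp) hp, G_mul ha hp, G_mul (ha.G (p := p) (by omega)) hp, G_mul ha (by omega),
    H_mul ha (by omega), mul_smul_comm (χ (-w p)), G_mul (ha.sub (ha.y p)) hp] at h
  simp only [mul_smul_comm, mul_add, mul_sub, y_sq_left, hyy] at h
  have c1 : χ (w p - 1) = χ (w p) * χ (-1) := by rw [sub_eq_add_neg, AddChar.map_add_eq_mul]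
  have c2 : χ (1 - w p) = χ 1 * χ (- w p) := by rw [sub_eq_add_neg, AddChar.map_add_eq_mul]
  rw [c1, c2]
  linear_combination (norm := module) h

theorem step_zero (hχ : ∀ k, χ k = 1 → k = 0) {p} (hp : p + 1 < n) {w a} (ha : T.On w a)
    (h1 : w (p + 1) ≠ w p - 1) (h2 : w (p + 1) ≠ 1 - w p) : a = 0 := by
  have h := quadratic_on hp ha
  have c := char_mul_neg χ (w p - 1)
  rw [neg_sub] at c
  refine eq_zero_of_unipotent (mul_ne_zero (char_ne hχ h1) (char_ne hχ h2))
    (T.commute_y_y p (p + 1)) (T.y_sq p) (T.y_sq _)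
    (d := - χ (w (p + 1)) * χ (w p - 1) + χ (w (p + 1)) * χ (1 - w p))
    (e := 2 * χ (w (p + 1)) * χ (w (p + 1)) - χ (w (p + 1)) * χ (w p - 1) -
      χ (w (p + 1)) * χ (1 - w p))
    (f := - χ (w (p + 1)) * χ (w p - 1) + χ (w (p + 1)) * χ (1 - w p)) ?_
  linear_combination (norm := module) h + c • a

theorem step_same (hl : OddModulus l) (hχ : ∀ k, χ k = 1 → k = 0) {p} (hp : p + 1 < n) {w a}
    (ha : T.On w a) (h1 : w (p + 1) = w p - 1) (h2 : w p ≠ 1) :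
    T.y (p + 1) * a = T.y p * a := by
  have h := quadratic_on hp ha
  have c := char_mul_neg χ (w p - 1)
  rw [neg_sub] at c
  rw [h1] at h
  have c2 := char_sq_ne hl hχ (sub_ne_zero.2 h2)
  have e1 : (χ (w p - 1) * χ (w p - 1) - 1) •
      (T.y (p + 1) * a - T.y p * a - T.y p * (T.y (p + 1) * a)) = 0 := by
    linear_combination (norm := module) h + c • (a - T.y p * a + T.y (p + 1) * a -
      T.y p * (T.y (p + 1) * a))
  have e2 := (smul_eq_zero.1 e1).resolve_left c2
  have e3 := congrArg (T.y p * ·) e2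
  simp only [mul_sub, y_sq_left, mul_zero, sub_zero] at e3
  rw [e3, sub_zero] at e2
  exact sub_eq_zero.1 e2

theorem step_opp (hl : OddModulus l) (hχ : ∀ k, χ k = 1 → k = 0) {p} (hp : p + 1 < n) {w a}
    (ha : T.On w a) (h1 : w (p + 1) = 1 - w p) (h2 : w p ≠ 1) :
    T.y (p + 1) * a = -(T.y p * a) := by
  have h := quadratic_on hp ha
  have c := char_mul_neg χ (w p - 1)
  rw [neg_sub] at c
  rw [h1] at h
  have c2 := char_sq_ne hl hχ (sub_ne_zero.2 (Ne.symm h2))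
  have e1 : (χ (1 - w p) * χ (1 - w p) - 1) •
      (T.y (p + 1) * a + T.y p * a + T.y p * (T.y (p + 1) * a)) = 0 := by
    linear_combination (norm := module) h + c • (a + T.y p * a + T.y (p + 1) * a +
      T.y p * (T.y (p + 1) * a))
  have e2 := (smul_eq_zero.1 e1).resolve_left c2
  have e3 := congrArg (T.y p * ·) e2
  simp only [mul_add, y_sq_left, mul_zero, add_zero] at e3
  rw [e3, add_zero] at e2
  exact eq_neg_of_add_eq_zero_left e2

end TLAct

namespace TLAct
variable {l n : ℕ} {A : Type*} [Ring A] [Algebra ℂ A] {χ : AddChar (ZMod l) ℂ}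
variable (T : TLAct χ n A)

/-- The unit by which `ψ_p` is renormalised in weight `k`. -/
def V (p : ℕ) (k : ZMod l) : A := coefConst χ k • 1 + coefLin χ k • T.y p
/-- The inverse of the unit `V p k`. -/
def W (p : ℕ) (k : ZMod l) : A := coefConst χ (1 - k) • 1 - coefLin χ (1 - k) • T.y p
/-- The weight-preserving part of `U_p` in weight `k`, up to the unit `V p k`. -/
def C (p : ℕ) (k : ZMod l) : A := if k = 0 then 0 else if k = 1 then T.y p - T.y (p + 1) else 1
/-- The weight-permuting part of `U_p` in weight `k`. -/
def X (p : ℕ) (k : ZMod l) : A := T.U p - T.C p k * T.V p k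

theorem V_mul (p k) (a : A) : T.V p k * a = coefConst χ k • a + coefLin χ k • (T.y p * a) := by
  simp [V, add_mul]

theorem W_mul (p k) (a : A) :
    T.W p k * a = coefConst χ (1 - k) • a - coefLin χ (1 - k) • (T.y p * a) := by
  simp [W, sub_mul]

theorem commute_V {x : A} {p} (h : Commute x (T.y p)) (k) : Commute x (T.V p k) :=
  ((Commute.one_right _).smul_right _).add_right (h.smul_right _)

theorem commute_W {x : A} {p} (h : Commute x (T.y p)) (k) : Commute x (T.W p k) :=
  ((Commute.one_right _).smul_right _).sub_right (h.smul_right _)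

theorem commute_C {x : A} {p} (h : Commute x (T.y p)) (h' : Commute x (T.y (p + 1))) (k) :
    Commute x (T.C p k) := by
  unfold C
  split_ifs
  · exact Commute.zero_right x
  · exact h.sub_right h'
  · exact Commute.one_right x

theorem commute_X {x : A} {p} (hU : Commute x (T.U p)) (h : Commute x (T.y p))
    (h' : Commute x (T.y (p + 1))) (k) : Commute x (T.X p k) :=
  hU.sub_right ((T.commute_C h h' k).mul_right (T.commute_V h k))

variable {T} in
theorem On.V {w a} (ha : T.On w a) (p k) : T.On w (T.V p k * a) := by
  rw [V_mul]
  exact (ha.smul _).add ((ha.y p).smul _)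

variable {T} in
theorem On.W {w a} (ha : T.On w a) (p k) : T.On w (T.W p k * a) := by
  rw [W_mul]
  exact (ha.smul _).sub ((ha.y p).smul _)

variable [NeZero l]

/-- The intertwiner `ψ_p`. -/
def P (p : ℕ) : A :=
  ∑ k : ZMod l, T.X p k * T.W p k * (spec χ (T.S (p + 1)) (1 - k) * spec χ (T.S p) k)

theorem commute_P {x : A} {p} (hU : Commute x (T.U p)) (h : Commute x (T.G p))
    (h' : Commute x (T.G (p + 1))) : Commute x (T.P p) := by
  have hy := T.commute_y fun _ => h
  exact Commute.sum_right _ _ _ fun k _ =>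
    ((T.commute_X hU hy (T.commute_y fun _ => h') k).mul_right (T.commute_W hy k)).mul_right
      ((commute_spec (T.commute_S h') _).mul_right (commute_spec (T.commute_S h) _))

theorem commute_G_P {p r} (hp : p + 1 < n) (hr : r < n) (h1 : r ≠ p) (h2 : r ≠ p + 1) :
    Commute (T.G r) (T.P p) :=
  T.commute_P (T.commute_U_G hp hr h1 h2).symm (T.commute_G hr (by omega)) (T.commute_G hr hp)

theorem commute_y_P {p r} (hp : p + 1 < n) (h1 : r ≠ p) (h2 : r ≠ p + 1) :
    Commute (T.y r) (T.P p) := (T.commute_y fun hr => (T.commute_G_P hp hr h1 h2).symm).symm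

theorem commute_P_P {p r} (h : p + 1 < r) (hr : r + 1 < n) : Commute (T.P p) (T.P r) := by
  refine T.commute_P ?_ (T.commute_G_P (by omega) (by omega) (by omega) (by omega)).symm
    (T.commute_G_P (by omega) (by omega) (by omega) (by omega)).symm
  exact (T.commute_P (T.far h hr).symm (T.commute_U_G hr (by omega) (by omega) (by omega))
    (T.commute_U_G hr (by omega) (by omega) (by omega))).symm

variable {T}

theorem P_mul (hχ : ∀ k, χ k = 1 → k = 0) {p} (hp : p + 1 < n) {w a} (ha : T.On w a) :
    T.P p * a = if w (p + 1) = 1 - w p then T.X p (w p) * (T.W p (w p) * a) else 0 := by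
  have h1 : ∀ k, T.X p k * T.W p k * (spec χ (T.S (p + 1)) (1 - k) * spec χ (T.S p) k) * a =
      if w p = k then (if w (p + 1) = 1 - w p then T.X p (w p) * (T.W p (w p) * a) else 0)
      else 0 := fun k => by
    rw [mul_assoc, mul_assoc, mul_assoc, spec_mul hχ (ha p (by omega))]
    split_ifs with h2 h3
    · rw [← h2, spec_mul hχ (ha _ hp), if_pos h3]
    · rw [← h2, spec_mul hχ (ha _ hp), if_neg h3, mul_zero, mul_zero]
    · simp only [mul_zero]
  rw [P, Finset.sum_mul, Finset.sum_congr rfl fun k _ => h1 k]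
  simp

theorem V_W (hl : OddModulus l) (hχ : ∀ k, χ k = 1 → k = 0) (p k) (a : A) :
    T.V p k * (T.W p k * a) = a := by
  simp only [V_mul, W_mul, mul_sub, mul_smul_comm, y_sq_left]
  linear_combination (norm := module) coefConst_mul hl hχ k • a -
    coefLin_cross hl hχ k • (T.y p * a)

theorem W_V (hl : OddModulus l) (hχ : ∀ k, χ k = 1 → k = 0) (p k) (a : A) :
    T.W p k * (T.V p k * a) = a := by
  simp only [V_mul, W_mul, mul_add, mul_smul_comm, y_sq_left]
  linear_combination (norm := module) coefConst_mul hl hχ k • a -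
    coefLin_cross hl hχ k • (T.y p * a)

theorem U_mul (hl : OddModulus l) (hχ : ∀ k, χ k = 1 → k = 0) {p} (hp : p + 1 < n) {w a}
    (ha : T.On w a) (hw : w (p + 1) = 1 - w p) :
    T.U p * a = T.P p * (T.V p (w p) * a) + T.C p (w p) * (T.V p (w p) * a) := by
  rw [P_mul hχ hp (ha.V _ _), if_pos hw, W_V hl hχ, X]
  noncomm_ring

end TLAct

namespace TLAct
variable {l n : ℕ} {A : Type*} [Ring A] [Algebra ℂ A] {χ : AddChar (ZMod l) ℂ}
variable {T : TLAct χ n A}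

theorem y_comm_left (r s) (a : A) : T.y r * (T.y s * a) = T.y s * (T.y r * a) := by
  rw [← mul_assoc, T.commute_y_y, mul_assoc]

theorem CV_left {x : A} {p} (h : Commute x (T.y p)) (h' : Commute x (T.y (p + 1))) (k) (a : A) :
    x * (T.C p k * (T.V p k * a)) = T.C p k * (T.V p k * (x * a)) := by
  have h1 : Commute x (T.C p k * T.V p k) := (T.commute_C h h' k).mul_right (T.commute_V h k)
  simpa only [mul_assoc] using congrArg (· * a) h1.eq

theorem X_mul (p k) (a : A) : T.X p k * a = T.U p * a - T.C p k * (T.V p k * a) := by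
  rw [X, sub_mul, mul_assoc]

theorem S_mul (p) (a : A) : T.S p * a = T.G p * (a - T.y p * a) := by
  rw [S, mul_assoc, sub_mul, one_mul]

variable [NeZero l]

/-- On a weight space with `w p = k ≠ 0` and `w (p + 1) = 1 - k`, the element `C p k * V p k`
satisfies the equations which make `X p k` an intertwiner. -/
theorem CV_intertwine (hl : OddModulus l) (hχ : ∀ k, χ k = 1 → k = 0) {p} (hp : p + 1 < n) {w a}
    (ha : T.On w a) (hw : w (p + 1) = 1 - w p) (h0 : w p ≠ 0) :
    T.G p * (T.C p (w p) * (T.V p (w p) * a)) - T.H p * (T.C p (w p) * (T.V p (w p) * a)) =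
      T.G (p + 1) * a - χ (-1) • (T.G p * a) ∧
    T.G (p + 1) * (T.C p (w p) * (T.V p (w p) * a)) -
      χ 1 • (T.G p * (T.C p (w p) * (T.V p (w p) * a))) =
      T.G p * a - χ 1 • (T.G (p + 1) * a) := by
  have hp' : p < n := by omega
  have ts := char_mul_neg χ 1
  by_cases h1 : w p = 1
  · have c4 := sinh_coefConst_one hl hχ
    have c5 := sinh_coefLin_one hl hχ
    have hx : T.On w ((T.y p - T.y (p + 1)) * (T.V p 1 * a)) := by
      rw [sub_mul]
      exact ((ha.V p 1).y p).sub ((ha.V p 1).y (p + 1))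
    rw [h1, C, if_neg hl.ne1, if_pos rfl, G_mul hx hp', H_mul hx hp', G_mul hx hp, G_mul ha hp',
      G_mul ha hp, hw, h1, sub_self, AddChar.map_zero_eq_one]
    simp only [V_mul, sub_mul, mul_add, mul_sub, mul_smul_comm, y_sq_left, y_comm_left (p + 1) p,
      mul_zero, smul_zero]
    constructor
    · linear_combination (norm := module) (c4 • (T.y p * a) - c4 • (T.y (p + 1) * a)
        - c5 • (T.y p * (T.y (p + 1) * a)) + ts • (a + T.y p * a))
    · linear_combination (norm := module) ((-χ 1) • (c4 • (T.y p * a)) +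
        χ 1 • (c4 • (T.y (p + 1) * a)) + χ 1 • (c5 • (T.y p * (T.y (p + 1) * a)))) +
        (coefLin χ 1 - coefConst χ 1) • (ts • (T.y p * (T.y (p + 1) * a))) -
        coefConst χ 1 • (ts • (T.y p * a - T.y (p + 1) * a))
  · have c3 := sinh_coefConst hl hχ h0 h1
    have c4 := sinh_coefLin hl hχ h0 h1
    have hV := ha.V p (w p)
    have hy := step_opp hl hχ hp ha hw h1
    rw [C, if_neg h0, if_neg h1, one_mul, G_mul hV hp', H_mul hV hp', G_mul hV hp, G_mul ha hp',
      G_mul ha hp, hw, char_one_sub]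
    simp only [V_mul, mul_add, mul_sub, mul_smul_comm, y_sq_left, y_comm_left (p + 1) p, hy,
      mul_neg, mul_zero, smul_zero, neg_zero]
    constructor
    · linear_combination (norm := module) c3 • a + c4 • (T.y p * a)
    · linear_combination (norm := module) (-χ 1) • (c3 • a + c4 • (T.y p * a)) +
        χ (w p) • (ts • (a + T.y p * a))

theorem G_X (hl : OddModulus l) (hχ : ∀ k, χ k = 1 → k = 0) {p} (hp : p + 1 < n) {w a}
    (ha : T.On w a) (hw : w (p + 1) = 1 - w p) (h0 : w p ≠ 0) :
    T.G p * (T.X p (w p) * a) = T.X p (w p) * (T.H p * a) ∧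
      T.G (p + 1) * (T.X p (w p) * a) = χ 1 • (T.X p (w p) * (T.G p * a)) := by
  have hp' : p < n := by omega
  obtain ⟨h1, h2⟩ := CV_intertwine hl hχ hp ha hw h0
  have e1 := congrArg (· * a) (T.G_succ p)
  have e2 := congrArg (· * a) (T.jm hp).comm
  have e3 := congrArg (· * a) (T.jm hp).nextG_U
  rw [← G_succ] at e3
  rw [JMStep.nextG] at e1
  simp only [add_mul, sub_mul, smul_mul_assoc, mul_assoc] at e1 e2 e3
  have c1 := CV_left (T.commute_y_G p hp').symm (T.commute_y_G (p + 1) hp').symm (w p) a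
  have c2 := CV_left (T.commute_y_H p hp').symm (T.commute_y_H (p + 1) hp').symm (w p) a
  have ts := char_mul_neg χ 1
  simp only [X_mul, mul_sub, smul_sub]
  rw [← c1, ← c2]
  constructor
  · linear_combination (norm := module) -h1 - e1
  · linear_combination (norm := module) -h2 + e3 + χ 1 • e2 + χ 1 • e1 +
      ts • (T.G p * a)

theorem y_X (hl : OddModulus l) (hχ : ∀ k, χ k = 1 → k = 0) {p} (hp : p + 1 < n) {w a}
    (ha : T.On w a) (hw : w (p + 1) = 1 - w p) (h0 : w p ≠ 0) :
    T.y p * (T.X p (w p) * a) = -(T.X p (w p) * (T.y p * a)) ∧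
      T.y (p + 1) * (T.X p (w p) * a) = T.X p (w p) * (T.y p * a) := by
  have hp' : p < n := by omega
  have hl' : (l : ℂ) ≠ 0 := NeZero.ne _
  have hc : χ 1 ^ l = 1 := by
    rw [← AddChar.map_nsmul_eq_pow]
    simp
  have on1 : ∀ m : ℕ, T.On w (T.H p ^ m * a) := fun m =>
    ha.mul fun r hr => ((T.commute_S_H hr hp').pow_right m).symm
  have on2 : ∀ m : ℕ, T.On w (T.G p ^ m * a) := fun m =>
    ha.mul fun r hr => (T.commute_S (T.commute_G hp' hr)).pow_left m
  have k1 : ∀ m : ℕ, T.G p ^ m * (T.X p (w p) * a) = T.X p (w p) * (T.H p ^ m * a) := fun m => by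
    induction m with
    | zero => simp
    | succ m ih =>
      rw [pow_succ', mul_assoc, ih, (G_X hl hχ hp (on1 m) hw h0).1, pow_succ', mul_assoc]
  have k2 : ∀ m : ℕ, T.G (p + 1) ^ m * (T.X p (w p) * a) =
      χ 1 ^ m • (T.X p (w p) * (T.G p ^ m * a)) := fun m => by
    induction m with
    | zero => simp
    | succ m ih =>
      rw [pow_succ', mul_assoc, ih, mul_smul_comm, (G_X hl hχ hp (on2 m) hw h0).2, smul_smul,
        pow_succ' (T.G p), mul_assoc, ← pow_succ]
  have g1 : ∀ {r}, r < n → T.G r ^ l = 1 + (l : ℂ) • T.y r := fun hr => by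
    rw [T.smul_y hr]
    abel
  have g2 : T.H p ^ l = 1 - (l : ℂ) • T.y p := by
    rw [eq_sub_of_add_eq' (T.pow_add_pow hp'), T.smul_y hp', ← one_add_one_eq_two]
    abel
  have f1 := k1 l
  have f2 := k2 l
  rw [g1 hp', g2] at f1
  rw [g1 hp, g1 hp', hc, one_smul] at f2
  simp only [add_mul, sub_mul, mul_add, mul_sub, one_mul, smul_mul_assoc, mul_smul_comm] at f1 f2
  constructor
  · refine smul_right_injective A hl' ?_
    linear_combination (norm := module) f1
  · refine smul_right_injective A hl' ?_
    linear_combination (norm := module) f2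

theorem X_y_succ (hl : OddModulus l) {p} (hχ : ∀ k, χ k = 1 → k = 0) (hp : p + 1 < n) {w a}
    (ha : T.On w a) (hw : w (p + 1) = 1 - w p) :
    T.X p (w p) * (T.y (p + 1) * a) = -(T.X p (w p) * (T.y p * a)) := by
  have key : T.C p (w p) * (T.V p (w p) * (T.y (p + 1) * a)) =
      -(T.C p (w p) * (T.V p (w p) * (T.y p * a))) := by
    by_cases h1 : w p = 1
    · rw [h1, C, if_neg hl.ne1, if_pos rfl]
      simp only [V_mul, mul_add, sub_mul, mul_smul_comm, y_sq_left, y_comm_left (p + 1) p]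
      simp
    · simp only [step_opp hl hχ hp ha hw h1, mul_neg]
  rw [X_mul, X_mul, key, U_y_succ_left hp]
  abel

theorem On.X (hl : OddModulus l) (hχ : ∀ k, χ k = 1 → k = 0) {p} (hp : p + 1 < n) {w a}
    (ha : T.On w a) (hw : w (p + 1) = 1 - w p) (h0 : w p ≠ 0) :
    T.On (sw p w) (T.X p (w p) * a) := fun r hr => by
  have hp' : p < n := by omega
  by_cases h1 : r = p
  · subst h1
    obtain ⟨f1, -⟩ := y_X hl hχ hp ha hw h0
    rw [S_mul, f1, sub_neg_eq_add, ← mul_add, (G_X hl hχ hp (ha.add (ha.y r)) hw h0).1,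
      H_mul (ha.add (ha.y r)) hp', mul_add (T.y r), y_sq_left, sw_self, hw]
    simp [mul_smul_comm]
  by_cases h2 : r = p + 1
  · subst h2
    obtain ⟨-, f1⟩ := y_X hl hχ hp ha hw h0
    have := ha p hp'
    rw [S_mul] at this
    rw [S_mul, f1, ← mul_sub, (G_X hl hχ hp (ha.sub (ha.y p)) hw h0).2, this, sw_succ,
      AddChar.map_add_eq_mul, mul_smul_comm, smul_smul, mul_comm]
  · have : Commute (T.S r) (T.X p (w p)) := T.commute_X (T.commute_U_S hp hr h1 h2).symm
      (T.commute_y_S p hr).symm (T.commute_y_S _ hr).symm _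
    rw [← mul_assoc, this.eq, mul_assoc, ha r hr, mul_smul_comm, sw_of_ne _ _ h1 h2]

end TLAct

namespace TLAct
variable {l n : ℕ} {A : Type*} [Ring A] [Algebra ℂ A] {χ : AddChar (ZMod l) ℂ}
variable {T : TLAct χ n A}

theorem X_zero (p) : T.X p 0 = T.U p := by
  simp [TLAct.X, C]

variable [NeZero l]

theorem eq_zero_of_G_fixed (hχ : ∀ k, χ k = 1 → k = 0) {p} (hp : p < n) {k : ZMod l} (hk : k ≠ 0)
    {z : A} (hG : T.G p * z = z) (hS : T.S p * z = χ k • z) : z = 0 := by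
  have h : T.G p * (T.y p * z) = T.y p * z := by
    rw [← mul_assoc, ← T.commute_y_G p hp, mul_assoc, hG]
  rw [S_mul, mul_sub, hG, h] at hS
  refine eq_zero_of_unipotent (y := T.y p) (z := T.y p) (c := χ k - 1) (d := 1) (e := 0) (f := 0)
    (fun h' => hk (hχ k (sub_eq_zero.1 h'))) rfl (T.y_sq p) (T.y_sq p) ?_
  linear_combination (norm := module) -hS

theorem G_U_zero (hl : OddModulus l) (hχ : ∀ k, χ k = 1 → k = 0) {p} (hp : p + 1 < n) {w b}
    (hb : T.On w b) (hw : w (p + 1) = 1) (h0 : w p = 0) :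
    T.G p * (T.U p * b) = T.U p * b - T.U p * (T.y p * b) + (χ 1 - χ (-1)) • b -
      (χ 1 + χ (-1)) • (T.y p * b) := by
  have hp' : p < n := by omega
  have e1 := congrArg (· * b) (T.G_succ p)
  rw [JMStep.nextG] at e1
  simp only [add_mul, sub_mul, smul_mul_assoc, mul_assoc] at e1
  rw [G_mul hb hp, H_mul hb hp', G_mul hb hp', hw, h0, neg_zero, AddChar.map_zero_eq_one,
    step_opp hl hχ hp hb (by rw [hw, h0, sub_zero]) (by rw [h0]; exact hl.ne1.symm)] at e1
  simp only [mul_smul_comm, mul_sub] at e1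
  linear_combination (norm := module) -e1

theorem spec_U_zero (hl : OddModulus l) (hχ : ∀ k, χ k = 1 → k = 0) {p} (hp : p + 1 < n) {w b}
    (hb : T.On w b) (hw : w (p + 1) = 1) (h0 : w p = 0) :
    T.S p * (T.U p * b) = T.U p * b := by
  have hp' : p < n := by omega
  have main : ∀ k : ZMod l, k ≠ 0 → spec χ (T.S p) k * (T.U p * b) = 0 := fun k hk => by
    have hE : ∀ {c}, T.On w c → spec χ (T.S p) k * c = 0 := fun hc => by
      rw [spec_mul hχ (hc p hp'), h0, if_neg hk.symm]
    have hS : ∀ c, T.S p * (spec χ (T.S p) k * c) = χ k • (spec χ (T.S p) k * c) := fun c => by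
      rw [← mul_assoc, mul_spec (T.S_pow hp'), smul_mul_assoc]
    have hG : ∀ c, T.G p * (spec χ (T.S p) k * c) = spec χ (T.S p) k * (T.G p * c) := fun c => by
      rw [← mul_assoc, (commute_spec (T.commute_S (T.commute_G hp' hp')) k).eq, mul_assoc]
    have h1 : spec χ (T.S p) k * (T.U p * (T.y p * b)) = 0 := by
      refine eq_zero_of_G_fixed hχ hp' hk ?_ (hS _)
      rw [hG, G_U_zero hl hχ hp (hb.y p) hw h0, y_sq_left]
      simp [mul_sub, mul_add, hE (hb.y p)]
    refine eq_zero_of_G_fixed hχ hp' hk ?_ (hS _)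
    rw [hG, G_U_zero hl hχ hp hb hw h0]
    simp [mul_sub, mul_add, hE (hb.y p), hE hb, h1]
  have h2 : T.U p * b = spec χ (T.S p) 0 * (T.U p * b) := by
    conv_lhs => rw [← one_mul (T.U p * b), ← sum_spec hχ (T.S p), Finset.sum_mul]
    exact Finset.sum_eq_single _ (fun k _ => main k) (by simp)
  rw [h2, ← mul_assoc, mul_spec (T.S_pow hp'), AddChar.map_zero_eq_one, one_smul]

theorem y_U_zero (hl : OddModulus l) (hχ : ∀ k, χ k = 1 → k = 0) {p} (hp : p + 1 < n) {w b}
    (hb : T.On w b) (hw : w (p + 1) = 1) (h0 : w p = 0) :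
    T.y p * (T.U p * b) = -(T.U p * (T.y p * b)) - T.V p 0 * b := by
  have hp' : p < n := by omega
  have h1 := spec_U_zero hl hχ hp hb hw h0
  have h2 := G_U_zero hl hχ hp hb hw h0
  have h3 := congrArg (fun x => T.y p * x) h1
  have h4 : T.y p * (T.G p * (T.U p * b)) = T.G p * (T.y p * (T.U p * b)) := by
    rw [← mul_assoc, T.commute_y_G p hp', mul_assoc]
  simp only [S_mul, mul_sub, h4] at h1 h3
  rw [← mul_assoc (T.y p) (T.G p) (T.y p * _), T.commute_y_G p hp', mul_assoc, y_sq_left, mul_zero,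
    sub_zero] at h3
  rw [V_mul, coefConst, if_pos rfl, coefLin, if_pos rfl, sinh]
  linear_combination (norm := module) -h1 + h2 - h3

theorem S_succ_U_zero (hl : OddModulus l) (hχ : ∀ k, χ k = 1 → k = 0) {p} (hp : p + 1 < n) {w b}
    (hb : T.On w b) (hw : w (p + 1) = 1) (h0 : w p = 0) :
    T.S (p + 1) * (T.U p * b) = χ 1 • (T.U p * b) := by
  have hp' : p < n := by omega
  have h1 := spec_U_zero hl hχ hp hb hw h0
  have e3 := congrArg (· * b) (T.jm hp).nextG_U
  rw [← G_succ] at e3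
  simp only [smul_mul_assoc, mul_assoc] at e3
  have h2 : T.H p * (T.U p * b) = T.U p * b - T.y p * (T.U p * b) := by
    conv_lhs => rw [← h1, S_mul, ← mul_assoc, (T.GH_mul hp').2, one_mul]
  have h4 : ∀ a, T.G (p + 1) * (T.y (p + 1) * a) = T.y (p + 1) * (T.G (p + 1) * a) := fun a => by
    rw [← mul_assoc, ← T.commute_y_G _ hp, mul_assoc]
  have h5 := T.y_sq_left (p + 1) (T.U p * b)
  rw [h2, sub_eq_add_neg, ← y_succ_U_left hp] at e3
  rw [S_mul, mul_sub, h4, e3]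
  simp only [mul_smul_comm, mul_add, mul_sub, mul_neg, h5]
  module

theorem On.X_zero (hl : OddModulus l) (hχ : ∀ k, χ k = 1 → k = 0) {p} (hp : p + 1 < n) {w b}
    (hb : T.On w b) (hw : w (p + 1) = 1) (h0 : w p = 0) :
    T.On (sw p w) (T.U p * b) := fun r hr => by
  by_cases h1 : r = p
  · subst h1
    rw [spec_U_zero hl hχ hp hb hw h0, sw_self, hw, sub_self, AddChar.map_zero_eq_one, one_smul]
  by_cases h2 : r = p + 1
  · subst h2
    rw [S_succ_U_zero hl hχ hp hb hw h0, sw_succ, h0, zero_add]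
  · rw [← mul_assoc, ← (T.commute_U_S hp hr h1 h2).eq, mul_assoc, hb r hr, mul_smul_comm,
      sw_of_ne _ _ h1 h2]

theorem On.P (hl : OddModulus l) (hχ : ∀ k, χ k = 1 → k = 0) {p} (hp : p + 1 < n) {w a}
    (ha : T.On w a) : T.On (sw p w) (T.P p * a) := by
  rw [P_mul hχ hp ha]
  split_ifs with hw
  · by_cases h0 : w p = 0
    · rw [h0, sub_zero] at hw
      rw [h0, TLAct.X_zero]
      exact On.X_zero hl hχ hp (ha.W p _) hw h0
    · exact On.X hl hχ hp (ha.W p _) hw h0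
  · intro r _
    simp

theorem P_y (hχ : ∀ k, χ k = 1 → k = 0) {p} (hp : p + 1 < n) {w a} (ha : T.On w a)
    (hw : w (p + 1) = 1 - w p) :
    T.P p * (T.y p * a) = T.X p (w p) * (T.y p * (T.W p (w p) * a)) := by
  rw [P_mul hχ hp (ha.y p), if_pos hw, ← mul_assoc (T.W p _), ← (T.commute_W rfl (w p)).eq,
    mul_assoc]

theorem P_y_succ (hl : OddModulus l) (hχ : ∀ k, χ k = 1 → k = 0) {p} (hp : p + 1 < n) {w a}
    (ha : T.On w a) (hw : w (p + 1) = 1 - w p) :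
    T.P p * (T.y (p + 1) * a) = -(T.P p * (T.y p * a)) := by
  rw [P_y hχ hp ha hw, P_mul hχ hp (ha.y _), if_pos hw, ← mul_assoc (T.W p _),
    ← (T.commute_W (T.commute_y_y (p + 1) p) (w p)).eq, mul_assoc, X_y_succ hl hχ hp (ha.W p _) hw]

theorem y_P (hl : OddModulus l) (hχ : ∀ k, χ k = 1 → k = 0) {p} (hp : p + 1 < n) {w a}
    (ha : T.On w a) (hw : w (p + 1) = 1 - w p) (h0 : w p ≠ 0) :
    T.y p * (T.P p * a) = -(T.P p * (T.y p * a)) ∧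
      T.y (p + 1) * (T.P p * a) = T.P p * (T.y p * a) := by
  rw [P_y hχ hp ha hw, P_mul hχ hp ha, if_pos hw]
  exact y_X hl hχ hp (ha.W p _) hw h0

theorem y_P_zero (hl : OddModulus l) (hχ : ∀ k, χ k = 1 → k = 0) {p} (hp : p + 1 < n) {w a}
    (ha : T.On w a) (hw : w (p + 1) = 1) (h0 : w p = 0) :
    T.y p * (T.P p * a) = -(T.P p * (T.y p * a)) - a ∧
      T.y (p + 1) * (T.P p * a) = T.P p * (T.y p * a) + a := by
  have hw' : w (p + 1) = 1 - w p := by rw [hw, h0, sub_zero]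
  have h1 := y_U_zero hl hχ hp (ha.W p 0) hw h0
  rw [V_W hl hχ] at h1
  rw [P_y hχ hp ha hw', P_mul hχ hp ha, if_pos hw', h0, X_zero]
  refine ⟨h1, ?_⟩
  rw [y_succ_U_left hp, h1]
  abel

end TLAct

namespace TLAct
variable {l n : ℕ} {A : Type*} [Ring A] [Algebra ℂ A] {χ : AddChar (ZMod l) ℂ}
variable {T : TLAct χ n A}

theorem U_sq_left {p} (hp : p + 1 < n) (a : A) :
    T.U p * (T.U p * a) = -(χ 1 + χ (-1)) • (T.U p * a) := by
  rw [← mul_assoc, T.sq hp, smul_mul_assoc]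

variable [NeZero l]

theorem P_P_zero (hl : OddModulus l) (hχ : ∀ k, χ k = 1 → k = 0) {p} (hp : p + 1 < n) {w a}
    (ha : T.On w a) (hw : w (p + 1) = 1) (h0 : w p = 0) : T.P p * (T.P p * a) = 0 := by
  have hw' : w (p + 1) = 1 - w p := by rw [hw, h0, sub_zero]
  have hb := ha.W p 0
  have v0 : coefConst χ 0 = -(χ 1 - χ (-1)) := by simp [coefConst, sinh]
  have v1 : coefLin χ 0 = χ 1 + χ (-1) := by simp [coefLin]
  rw [P_mul hχ hp (ha.P hl hχ hp), sw_succ, sw_self, hw, h0, sub_self, zero_add, sub_zero,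
    if_pos rfl, P_mul hχ hp ha, if_pos hw', h0, X_zero, W_mul, sub_zero]
  generalize T.W p 0 * a = b at hb
  rw [y_U_zero hl hχ hp hb hw h0, V_mul, v0, v1]
  simp only [mul_sub, mul_add, mul_neg, mul_smul_comm, U_sq_left hp]
  have c5 := sinh_coefLin_one hl hχ
  linear_combination (norm := module) (-c5) • (T.U p * b)

/-- Two successive intertwiners in terms of the renormalised vector. -/
theorem P_P_eq (hl : OddModulus l) (hχ : ∀ k, χ k = 1 → k = 0) {p} (hp : p + 1 < n) {w a}
    (ha : T.On w a) (hw : w (p + 1) = 1 - w p) (h0 : w p ≠ 0) :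
    T.P p * (T.P p * a) =
      T.U p * (T.X p (w p) * (T.V p (1 + w p) * (T.W p (w p) * a))) -
        T.C p (-w p) * (T.X p (w p) * (T.W p (w p) * a)) := by
  have hb := ha.W p (w p)
  have e1 : 1 - -w p = 1 + w p := by ring
  have e2 : 1 - w p - 1 = -w p := by ring
  have key : T.W p (-w p) * (T.X p (w p) * (T.W p (w p) * a)) =
      T.X p (w p) * (T.V p (1 + w p) * (T.W p (w p) * a)) := by
    rw [W_mul, V_mul, (y_X hl hχ hp hb hw h0).1, mul_add, mul_smul_comm, mul_smul_comm, e1]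
    module
  rw [P_mul hχ hp (ha.P hl hχ hp), sw_succ, sw_self, hw, e2, if_pos (by ring), P_mul hχ hp ha,
    if_pos hw, ← key]
  rw [X_mul, V_W hl hχ]

/-- Two successive intertwiners, with the vector normalised to make all coefficients visible. -/
theorem P_P_eq' (hl : OddModulus l) (hχ : ∀ k, χ k = 1 → k = 0) {p} (hp : p + 1 < n) {w a}
    (ha : T.On w a) (hw : w (p + 1) = 1 - w p) (h0 : w p ≠ 0) :
    ∃ d, T.On w d ∧ a = T.V p (w p) * (T.W p (1 + w p) * d) ∧ T.P p * (T.P p * a) =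
      T.U p * (T.X p (w p) * d) - T.C p (-w p) * (T.X p (w p) * (T.W p (1 + w p) * d)) := by
  refine ⟨_, (ha.W p (w p)).V p (1 + w p), ?_, ?_⟩
  · rw [W_V hl hχ, V_W hl hχ]
  · rw [W_V hl hχ, P_P_eq hl hχ hp ha hw h0]

theorem P_P_far (hl : OddModulus l) (hχ : ∀ k, χ k = 1 → k = 0) {p} (hp : p + 1 < n) {w a}
    (ha : T.On w a) (hw : w (p + 1) = 1 - w p) (h0 : w p ≠ 0) (h1 : w p ≠ 1) (h2 : w p ≠ -1) :
    T.P p * (T.P p * a) = a := by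
  have h3 : -w p ≠ 1 := fun h => h2 (by rw [← h, neg_neg])
  obtain ⟨d, -, hd, h⟩ := P_P_eq' hl hχ hp ha hw h0
  rw [h, hd, C, if_neg (neg_ne_zero.2 h0), if_neg h3, one_mul]
  simp only [X_mul, C, if_neg h0, if_neg h1, one_mul, W_mul, V_mul, mul_add, mul_sub,
    mul_smul_comm, U_sq_left hp, show 1 - (1 + w p) = -w p by ring, y_sq_left]
  linear_combination (norm := module) -(coefConst_add_neg hl hχ h0 h1 h2) • (T.U p * d) +
    (coefLin_neg (χ := χ) h0 h1 h2) • (T.U p * (T.y p * d))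

theorem P_P_one (hl : OddModulus l) (hχ : ∀ k, χ k = 1 → k = 0) {p} (hp : p + 1 < n) {w a}
    (ha : T.On w a) (hw : w (p + 1) = 0) (h1 : w p = 1) :
    T.P p * (T.P p * a) = T.y p * a - T.y (p + 1) * a := by
  have h0 : w p ≠ 0 := h1 ▸ hl.ne1
  have hw' : w (p + 1) = 1 - w p := by rw [hw, h1, sub_self]
  obtain ⟨d, hd', hd, h⟩ := P_P_eq' hl hχ hp ha hw' h0
  rw [h, hd, h1, C, if_neg (neg_ne_zero.2 hl.ne1), if_neg (neg_one_ne_one hl), one_mul]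
  have c1 := coefConst_neg_one hl hχ
  have c2 := coefLin_neg_one hl hχ
  simp only [X_mul, C, if_neg hl.ne1, if_true, W_mul, V_mul, mul_add, mul_sub, sub_mul,
    mul_smul_comm, U_sq_left hp, show 1 - (1 + (1 : ZMod l)) = -1 by ring, y_sq_left,
    U_y_succ_left hp, mul_zero, smul_zero, y_comm_left p (p + 1), c1, c2, neg_zero]
  module

theorem P_P_neg_one (hl : OddModulus l) (hχ : ∀ k, χ k = 1 → k = 0) {p} (hp : p + 1 < n) {w a}
    (ha : T.On w a) (hw : w (p + 1) = 2) (h1 : w p = -1) :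
    T.P p * (T.P p * a) = T.y (p + 1) * a - T.y p * a := by
  have h0 : w p ≠ 0 := h1 ▸ neg_ne_zero.2 hl.ne1
  have hw' : w (p + 1) = 1 - w p := by rw [hw, h1]; ring
  have h2 : w p ≠ 1 := h1 ▸ neg_one_ne_one hl
  rw [step_opp hl hχ hp ha hw' h2]
  obtain ⟨d, hd', hd, h⟩ := P_P_eq' hl hχ hp ha hw' h0
  have hX := y_X hl hχ hp (hd'.W p (1 + w p)) hw' h0
  have hC : T.C p (-w p) = T.y p - T.y (p + 1) := by
    rw [C, if_neg (neg_ne_zero.2 h0), h1, neg_neg, if_pos rfl]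
  rw [h, hC, sub_mul, hX.1, hX.2, hd, h1]
  have c1 := coefConst_neg_one hl hχ
  have c2 := coefLin_neg_one hl hχ
  simp only [X_mul, C, neg_eq_zero, if_neg hl.ne1, if_neg (neg_one_ne_one hl), one_mul,
    W_mul, V_mul, mul_add, mul_sub, sub_mul,
    mul_smul_comm, U_sq_left hp, show 1 - (1 + (-1 : ZMod l)) = 1 by ring, y_sq_left,
    mul_zero, smul_zero, c1, c2, neg_zero]
  module

end TLAct

namespace TLAct
variable {l n : ℕ} {A : Type*} [Ring A] [Algebra ℂ A] {χ : AddChar (ZMod l) ℂ}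
variable {T : TLAct χ n A}

/-- Components in two different weights are independent. -/
theorem On.eq_of_add (hχ : ∀ k, χ k = 1 → k = 0) {p} (hp : p < n) {w w' : ℕ → ZMod l}
    {x x' z z' : A} (hx : T.On w x) (hx' : T.On w x') (hz : T.On w' z) (hz' : T.On w' z')
    (h : w p ≠ w' p) (e : x + z = x' + z') : x = x' := by
  have h1 := congrArg (T.S p * ·) e
  simp only [mul_add, hx p hp, hx' p hp, hz p hp, hz' p hp] at h1
  have h2 : (χ (w p) - χ (w' p)) • (x - x') = 0 := by
    have e' : z = x' + z' - x := by rw [← e]; abel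
    rw [e'] at h1
    linear_combination (norm := module) h1
  exact sub_eq_zero.1 ((smul_eq_zero.1 h2).resolve_left (char_ne hχ h))

theorem step_eq_succ {p} {w : ℕ → ZMod l} (h1 : w (p + 1) = w p + 1) (h0 : w p = 0) :
    w (p + 1) = 1 ∧ w (p + 1) = 1 - w p := by
  rw [h1, h0]; simp

variable [NeZero l]

theorem P_of_ne (hχ : ∀ k, χ k = 1 → k = 0) {p} (hp : p + 1 < n) {w a} (ha : T.On w a)
    (h : w (p + 1) ≠ 1 - w p) : T.P p * a = 0 := by
  rw [P_mul hχ hp ha, if_neg h]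

theorem step_eq_zero (hl : OddModulus l) (hχ : ∀ k, χ k = 1 → k = 0) {p} (hp : p + 1 < n) {w a}
    (ha : T.On w a) (h1 : w (p + 1) = w p + 1) (h0 : w p ≠ 0) : a = 0 :=
  step_zero hχ hp ha (by rw [h1]; exact fun h => hl.ne2 (by linear_combination h))
    (by rw [h1]; exact fun h => h0 (hl.two _ (by linear_combination h)))

theorem P_y_eq (hl : OddModulus l) (hχ : ∀ k, χ k = 1 → k = 0) {p} (hp : p + 1 < n) {w a}
    (ha : T.On w a) (h : w (p + 1) = w p + 1) :
    T.P p * (T.y (p + 1) * a) = T.y p * (T.P p * a) + a := by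
  by_cases h0 : w p = 0
  · obtain ⟨h1, h2⟩ := step_eq_succ h h0
    rw [P_y_succ hl hχ hp ha h2, (y_P_zero hl hχ hp ha h1 h0).1, sub_add_cancel]
  · simp [step_eq_zero hl hχ hp ha h h0]

theorem y_P_eq (hl : OddModulus l) (hχ : ∀ k, χ k = 1 → k = 0) {p} (hp : p + 1 < n) {w a}
    (ha : T.On w a) (h : w (p + 1) = w p + 1) :
    T.y (p + 1) * (T.P p * a) = T.P p * (T.y p * a) + a := by
  by_cases h0 : w p = 0
  · exact (y_P_zero hl hχ hp ha (step_eq_succ h h0).1 h0).2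
  · simp [step_eq_zero hl hχ hp ha h h0]

theorem P_y_ne (hl : OddModulus l) (hχ : ∀ k, χ k = 1 → k = 0) {p} (hp : p + 1 < n) {w a}
    (ha : T.On w a) (h : w (p + 1) ≠ w p + 1) :
    T.P p * (T.y (p + 1) * a) = T.y p * (T.P p * a) := by
  by_cases h1 : w (p + 1) = 1 - w p
  · have h0 : w p ≠ 0 := fun h0 => h (by rw [h1, h0]; ring)
    rw [P_y_succ hl hχ hp ha h1, (y_P hl hχ hp ha h1 h0).1]
  · rw [P_of_ne hχ hp (ha.y _) h1, P_of_ne hχ hp ha h1, mul_zero]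

theorem y_P_ne (hl : OddModulus l) (hχ : ∀ k, χ k = 1 → k = 0) {p} (hp : p + 1 < n) {w a}
    (ha : T.On w a) (h : w (p + 1) ≠ w p + 1) :
    T.y (p + 1) * (T.P p * a) = T.P p * (T.y p * a) := by
  by_cases h1 : w (p + 1) = 1 - w p
  · have h0 : w p ≠ 0 := fun h0 => h (by rw [h1, h0]; ring)
    exact (y_P hl hχ hp ha h1 h0).2
  · rw [P_of_ne hχ hp (ha.y _) h1, P_of_ne hχ hp ha h1, mul_zero]

theorem P_sq_eq (hl : OddModulus l) (hχ : ∀ k, χ k = 1 → k = 0) {p} (hp : p + 1 < n) {w a}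
    (ha : T.On w a) (h : w (p + 1) = w p + 1) : T.P p * (T.P p * a) = 0 := by
  by_cases h0 : w p = 0
  · exact P_P_zero hl hχ hp ha (step_eq_succ h h0).1 h0
  · simp [step_eq_zero hl hχ hp ha h h0]

theorem up_eq_zero (hl : OddModulus l) (hχ : ∀ k, χ k = 1 → k = 0) {p} (hp : p + 1 < n) {w a}
    (ha : T.On w a) (h : w (p + 1) = w p + 3) (h0 : w p ≠ -1) : a = 0 :=
  step_zero hχ hp ha (by rw [h]; exact fun h => hl.ne4 (by linear_combination h))
    (by rw [h]; exact fun h => h0 (hl.eq_of_two (by linear_combination h)))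

theorem P_sq_up (hl : OddModulus l) (hχ : ∀ k, χ k = 1 → k = 0) {p} (hp : p + 1 < n) {w a}
    (ha : T.On w a) (h : w (p + 1) = w p + 3) :
    T.P p * (T.P p * a) = T.y (p + 1) * a - T.y p * a := by
  by_cases h0 : w p = -1
  · exact P_P_neg_one hl hχ hp ha (by rw [h, h0]; ring) h0
  · simp [up_eq_zero hl hχ hp ha h h0]

theorem P_sq_down (hl : OddModulus l) (hχ : ∀ k, χ k = 1 → k = 0) {p} (hp : p + 1 < n) {w a}
    (ha : T.On w a) (h : w (p + 1) = w p - 1) :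
    T.P p * (T.P p * a) = T.y p * a - T.y (p + 1) * a := by
  by_cases h0 : w p = 1
  · exact P_P_one hl hχ hp ha (by rw [h, h0]; ring) h0
  · rw [step_same hl hχ hp ha h h0, sub_self, P_of_ne hχ hp ha, mul_zero]
    rw [h]
    exact fun h => h0 (hl.eq_of_two (by linear_combination h))

theorem P_sq_far (hl : OddModulus l) (hχ : ∀ k, χ k = 1 → k = 0) {p} (hp : p + 1 < n) {w a}
    (ha : T.On w a) (h1 : w (p + 1) ≠ w p + 1) (h2 : w (p + 1) ≠ w p + 3)
    (h3 : w (p + 1) ≠ w p - 1) : T.P p * (T.P p * a) = a := by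
  by_cases h : w (p + 1) = 1 - w p
  · rw [h] at h1 h2 h3
    exact P_P_far hl hχ hp ha h (fun h => h1 (by rw [h]; ring)) (fun h => h3 (by rw [h]))
      (fun h => h2 (by rw [h]; ring))
  · simp [step_zero hχ hp ha h3 h]

theorem triple_eq_zero (hl : OddModulus l) (hχ : ∀ k, χ k = 1 → k = 0) {p} (hp : p + 2 < n) {w a}
    (ha : T.On w a) (h : ¬ (w p = -1 ∧ w (p + 1) = 2 ∧ w (p + 2) = 1)) :
    T.P p * (T.P (p + 1) * (T.P p * a)) = 0 := by
  have h1 : p + 1 < n := by omega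
  by_cases e1 : w (p + 1) = 1 - w p
  · have ha1 := ha.P hl hχ h1
    by_cases e2 : w (p + 2) = - w p
    · refine P_of_ne hχ h1 (ha1.P hl hχ hp) fun e3 => h ?_
      rw [sw_self, sw_of_ne _ _ (by omega) (by omega),
        sw_of_ne _ _ (by omega) (by omega), sw_self, e2, e1] at e3
      have e4 : w p = -1 := hl.eq_of_two (by linear_combination -e3)
      rw [e2, e1, e4]
      refine ⟨rfl, by ring, by ring⟩
    · rw [P_of_ne hχ hp ha1, mul_zero]
      rw [sw_succ, sw_of_ne _ _ (by omega) (by omega)]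
      exact fun e => e2 (by linear_combination e)
  · rw [P_of_ne hχ h1 ha e1, mul_zero, mul_zero]

theorem triple_eq_zero' (hl : OddModulus l) (hχ : ∀ k, χ k = 1 → k = 0) {p} (hp : p + 2 < n)
    {w a} (ha : T.On w a) (h : ¬ (w p = 0 ∧ w (p + 1) = -1 ∧ w (p + 2) = 2)) :
    T.P (p + 1) * (T.P p * (T.P (p + 1) * a)) = 0 := by
  have h1 : p + 1 < n := by omega
  by_cases e1 : w (p + 2) = 1 - w (p + 1)
  · have ha1 := ha.P hl hχ hp
    by_cases e2 : w (p + 1) = w p - 1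
    · refine P_of_ne hχ hp (ha1.P hl hχ h1) fun e3 => h ?_
      rw [sw_succ, sw_of_ne _ _ (by omega) (by omega), sw_succ,
        sw_of_ne _ _ (by omega) (by omega), e2] at e3
      have e4 : w p = 0 := hl.eq_of_two (by linear_combination e3)
      rw [e1, e2, e4]
      refine ⟨rfl, by ring, by ring⟩
    · rw [P_of_ne hχ h1 ha1, mul_zero]
      rw [sw_self, sw_of_ne _ _ (by omega) (by omega), e1]
      exact fun e => e2 (by linear_combination -e)
  · rw [P_of_ne hχ hp ha e1, mul_zero, mul_zero]

end TLAct

namespace TLAct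
variable {l n : ℕ} {A : Type*} [Ring A] [Algebra ℂ A] {χ : AddChar (ZMod l) ℂ}
variable {T : TLAct χ n A}

theorem C_zero (p) : T.C p 0 = 0 := if_pos rfl

theorem C_neg_one (hl : OddModulus l) (p) : T.C p (-1) = 1 := by
  rw [C, if_neg (neg_ne_zero.2 hl.ne1), if_neg (neg_one_ne_one hl)]

theorem On.C {w a} (ha : T.On w a) (p k) : T.On w (T.C p k * a) := by
  rw [TLAct.C]
  split_ifs
  · rw [zero_mul]; exact fun r _ => by simp
  · rw [sub_mul]; exact (ha.y _).sub (ha.y _)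
  · rwa [one_mul]

variable [NeZero l]

theorem up_component (hl : OddModulus l) (hχ : ∀ k, χ k = 1 → k = 0) {p} (hp : p + 2 < n) {w a}
    (ha : T.On w a) (h0 : w p = -1) (h1 : w (p + 1) = 2) (h2 : w (p + 2) = 1) :
    T.P p * (T.V p 1 * (T.P (p + 1) * (T.V (p + 1) 0 * (T.P p * a)))) = a := by
  have hp1 : p + 1 < n := by omega
  obtain ⟨b, hb, rfl⟩ : ∃ b, T.On w b ∧ a = T.V p (-1) * b :=
    ⟨_, ha.W p (-1), (V_W hl hχ _ _ _).symm⟩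
  have u := T.up hp
  have e1 : T.U p * b = T.P p * (T.V p (-1) * b) + T.V p (-1) * b := by
    rw [U_mul hl hχ hp1 hb (by rw [h1, h0]; ring), h0, C_neg_one hl, one_mul]
  have e2 : T.U (p + 1) * (T.V p (-1) * b) = 0 :=
    U_of_ne hχ hp ha (by rw [h1, h2]; exact fun h => hl.ne2 (by linear_combination h))
  have hz := ha.P hl hχ hp1
  have z0 : sw p w p = 1 := by rw [sw_self, h1]; ring
  have z1 : sw p w (p + 1) = 0 := by rw [sw_succ, h0]; ring
  have z2 : sw p w (p + 2) = 1 := by rw [sw_of_ne _ _ (by omega) (by omega), h2]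
  have e3 := U_mul hl hχ hp hz (by rw [z1, z2, sub_zero])
  rw [z1, C_zero, zero_mul, add_zero] at e3
  have hz2 := (hz.V (p + 1) 0).P hl hχ hp
  rw [sw_eq_self (p + 1) (sw p w) (by rw [z1, z2, zero_add])] at hz2
  have e4 := U_mul hl hχ hp1 hz2 (by rw [z0, z1, sub_self])
  have hx := (hz2.V p 1).P hl hχ hp1
  have hy := (hz2.V p 1).C p 1
  rw [z0] at e4
  rw [sw_sw] at hx
  have e5 := congrArg (· * b) u
  simp only [mul_assoc] at e5
  rw [e1, mul_add, mul_add, e2, mul_zero, add_zero, e3, e4,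
    add_comm (T.P p * (T.V p (-1) * b))] at e5
  exact On.eq_of_add hχ (p := p) (by omega) hx ha hy hz
    (by rw [z0, h0]; exact neg_one_ne_one hl) e5

theorem down_component (hl : OddModulus l) (hχ : ∀ k, χ k = 1 → k = 0) {p} (hp : p + 2 < n)
    {w a} (ha : T.On w a) (h0 : w p = 0) (h1 : w (p + 1) = -1) (h2 : w (p + 2) = 2) :
    T.P (p + 1) * (T.V (p + 1) 1 * (T.P p * (T.V p 0 * (T.P (p + 1) * a)))) = a := by
  have hp1 : p + 1 < n := by omega
  obtain ⟨b, hb, rfl⟩ : ∃ b, T.On w b ∧ a = T.V (p + 1) (-1) * b :=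
    ⟨_, ha.W _ (-1), (V_W hl hχ _ _ _).symm⟩
  have u := T.down hp
  have e1 : T.U (p + 1) * b =
      T.P (p + 1) * (T.V (p + 1) (-1) * b) + T.V (p + 1) (-1) * b := by
    rw [U_mul hl hχ hp hb (by rw [h2, h1]; ring), h1, C_neg_one hl, one_mul]
  have e2 : T.U p * (T.V (p + 1) (-1) * b) = 0 :=
    U_of_ne hχ hp1 ha (by rw [h1, h0]; exact fun h => hl.ne2 (by linear_combination -h))
  have hz := ha.P hl hχ hp
  have z0 : sw (p + 1) w p = 0 := by rw [sw_of_ne _ _ (by omega) (by omega), h0]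
  have z1 : sw (p + 1) w (p + 1) = 1 := by rw [sw_self, h2]; ring
  have z2 : sw (p + 1) w (p + 2) = 0 := by rw [sw_succ, h1]; ring
  have e3 := U_mul hl hχ hp1 hz (by rw [z0, z1, sub_zero])
  rw [z0, C_zero, zero_mul, add_zero] at e3
  have hz2 := (hz.V p 0).P hl hχ hp1
  rw [sw_eq_self p (sw (p + 1) w) (by rw [z0, z1, zero_add])] at hz2
  have e4 := U_mul hl hχ hp hz2 (by rw [z1, z2, sub_self])
  have hx := (hz2.V (p + 1) 1).P hl hχ hp
  have hy := (hz2.V (p + 1) 1).C (p + 1) 1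
  rw [z1] at e4
  rw [sw_sw] at hx
  have e5 := congrArg (· * b) u
  simp only [mul_assoc] at e5
  rw [e1, mul_add, mul_add, e2, mul_zero, add_zero, e3, e4,
    add_comm (T.P (p + 1) * (T.V (p + 1) (-1) * b))] at e5
  exact On.eq_of_add hχ (p := p + 1) hp1 hx ha hy hz
    (by rw [z1, h1]; exact neg_one_ne_one hl) e5

theorem braid_up_special (hl : OddModulus l) (hχ : ∀ k, χ k = 1 → k = 0) {p} (hp : p + 2 < n)
    {w a} (ha : T.On w a) (h0 : w p = -1) (h1 : w (p + 1) = 2) (h2 : w (p + 2) = 1) :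
    T.P p * (T.P (p + 1) * (T.P p * a)) = a := by
  have hp1 : p + 1 < n := by omega
  have hw : w (p + 1) = 1 - w p := by rw [h1, h0]; ring
  have hn : w p ≠ 0 := h0 ▸ neg_ne_zero.2 hl.ne1
  have e1 := coefConst_mul hl hχ 0
  have e2 := coefLin_cross hl hχ 0
  rw [sub_zero] at e1 e2
  have hc (x : A) : T.y p * (T.P (p + 1) * x) = T.P (p + 1) * (T.y p * x) := by
    rw [← mul_assoc, (T.commute_y_P hp (by omega) (by omega)).eq, mul_assoc]
  have h := up_component hl hχ hp ha h0 h1 h2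
  have y1 := y_P hl hχ hp1 ha hw hn
  have y2 := y_P hl hχ hp1 (ha.y p) hw hn
  simp only [V_mul, mul_add, mul_smul_comm, hc, y1.1, y1.2, y2.1, y_sq_left, mul_neg,
    mul_zero, neg_zero] at h
  linear_combination (norm := module) h -
    e1 • (T.P p * (T.P (p + 1) * (T.P p * a))) +
    e2 • (T.P p * (T.P (p + 1) * (T.P p * (T.y p * a))))

theorem braid_down_special (hl : OddModulus l) (hχ : ∀ k, χ k = 1 → k = 0) {p} (hp : p + 2 < n)
    {w a} (ha : T.On w a) (h0 : w p = 0) (h1 : w (p + 1) = -1) (h2 : w (p + 2) = 2) :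
    T.P (p + 1) * (T.P p * (T.P (p + 1) * a)) = a := by
  have hp1 : p + 1 < n := by omega
  have e1 := coefConst_mul hl hχ 0
  have e2 := coefLin_cross hl hχ 0
  rw [sub_zero] at e1 e2
  have hc (x : A) : T.y p * (T.P (p + 1) * x) = T.P (p + 1) * (T.y p * x) := by
    rw [← mul_assoc, (T.commute_y_P hp (by omega) (by omega)).eq, mul_assoc]
  have z0 : sw (p + 1) w p = 0 := by rw [sw_of_ne _ _ (by omega) (by omega), h0]
  have z1 : sw (p + 1) w (p + 1) = 1 := by rw [sw_self, h2]; ring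
  have key : ∀ x, T.On w x → T.P (p + 1) * (T.P p * (T.P (p + 1) *
      (x + (2 * (coefConst χ 1 * coefLin χ 0)) • (T.y p * x)))) =
      x + (2 * (coefConst χ 1 * coefLin χ 0)) • (T.y p * x) := fun x hx => by
    have h := down_component hl hχ hp hx h0 h1 h2
    have y1 := (y_P_zero hl hχ hp1 (hx.P hl hχ hp) z1 z0).2
    have y2 := (y_P_zero hl hχ hp1 ((hx.y p).P hl hχ hp) z1 z0).2
    have s1 : T.P (p + 1) * (T.P (p + 1) * x) = -(2 : ℂ) • (T.y p * x) := by
      rw [P_P_neg_one hl hχ hp hx h2 h1, step_opp hl hχ hp hx (by rw [h2, h1]; ring)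
        (h1 ▸ neg_one_ne_one hl), step_same hl hχ hp1 hx (by rw [h1, h0]; ring)
        (h0 ▸ fun h => hl.ne1 h.symm)]
      module
    have s2 : T.P (p + 1) * (T.P (p + 1) * (T.y p * x)) = 0 := by
      rw [← hc, ← hc, s1, mul_smul_comm, y_sq_left, smul_zero]
    simp only [V_mul, mul_add, mul_smul_comm, hc, y1, y2, s1, s2, y_sq_left, smul_zero,
      mul_zero, add_zero] at h
    simp only [mul_add, mul_smul_comm]
    linear_combination (norm := module) h -
      e1 • (T.P (p + 1) * (T.P p * (T.P (p + 1) * x))) -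
      e2 • (T.P (p + 1) * (T.P p * (T.P (p + 1) * (T.y p * x)))) + (2 * e2) • (T.y p * x)
  have h := key (a - (2 * (coefConst χ 1 * coefLin χ 0)) • (T.y p * a)) (ha.sub ((ha.y p).smul _))
  simpa only [mul_sub, mul_smul_comm, y_sq_left, smul_zero, sub_zero, sub_add_cancel] using h

theorem braid_up (hl : OddModulus l) (hχ : ∀ k, χ k = 1 → k = 0) {p} (hp : p + 2 < n)
    {w a} (ha : T.On w a) (h1 : w (p + 1) = w p + 3) (h2 : w (p + 2) = w p + 2) :
    T.P p * (T.P (p + 1) * (T.P p * a)) = T.P (p + 1) * (T.P p * (T.P (p + 1) * a)) + a := by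
  by_cases h0 : w p = -1
  · rw [triple_eq_zero' hl hχ hp ha fun h => hl.ne1 (by linear_combination h0 - h.1), zero_add,
      braid_up_special hl hχ hp ha h0 (by rw [h1, h0]; ring) (by rw [h2, h0]; ring)]
  · simp [up_eq_zero hl hχ (by omega) ha h1 h0]

theorem braid_down (hl : OddModulus l) (hχ : ∀ k, χ k = 1 → k = 0) {p} (hp : p + 2 < n)
    {w a} (ha : T.On w a) (h1 : w (p + 1) = w p - 1) (h2 : w (p + 2) = w p + 2) :
    T.P p * (T.P (p + 1) * (T.P p * a)) = T.P (p + 1) * (T.P p * (T.P (p + 1) * a)) - a := by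
  by_cases h0 : w p = 0
  · rw [triple_eq_zero hl hχ hp ha fun h => hl.ne1 (by linear_combination h.1 - h0),
      braid_down_special hl hχ hp ha h0 (by rw [h1, h0]; ring) (by rw [h2, h0]; ring), sub_self]
  · rw [up_eq_zero hl hχ (p := p + 1) hp ha (by rw [h1, h2]; ring)
      (by rw [h1]; exact fun h => h0 (by linear_combination h))]
    simp

theorem braid_far (hl : OddModulus l) (hχ : ∀ k, χ k = 1 → k = 0) {p} (hp : p + 2 < n)
    {w a} (ha : T.On w a) (h1 : ¬ (w (p + 2) = w p + 2 ∧ w (p + 1) = w p + 3))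
    (h2 : ¬ (w (p + 2) = w p + 2 ∧ w (p + 1) = w p - 1)) :
    T.P p * (T.P (p + 1) * (T.P p * a)) = T.P (p + 1) * (T.P p * (T.P (p + 1) * a)) := by
  rw [triple_eq_zero hl hχ hp ha fun h => h1 (by rw [h.1, h.2.1, h.2.2]; constructor <;> ring),
    triple_eq_zero' hl hχ hp ha fun h => h2 (by rw [h.1, h.2.1, h.2.2]; constructor <;> ring)]

end TLAct

open Statement3.Rep in
/-- Every weight comes from a residue sequence. -/
theorem exists_isWt {l n : ℕ} [NeZero l] (hl : OddModulus l) (w : ℕ → ZMod l) :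
    ∃ i : Res l n, IsWt w i := by
  have h : Function.Surjective fun x : ZMod l => 2 * x :=
    Finite.injective_iff_surjective.1 fun x y h => hl.eq_of_two h
  choose f hf using h
  exact ⟨fun p => f (w p - p + 1), fun p hp => by linear_combination -(hf (w p - p + 1))⟩

namespace TLAct
open Statement3.Rep
variable {l n : ℕ} {A : Type*} [Ring A] [Algebra ℂ A] {χ : AddChar (ZMod l) ℂ}
variable {T : TLAct χ n A} [NeZero l]

variable (T) in
/-- The projection to the simultaneous eigenspace of the first `m` semisimple parts. -/
def proj (v : ℕ → ZMod l) : ℕ → A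
  | 0 => 1
  | m + 1 => proj v m * spec χ (T.S m) (v m)

theorem proj_mul (hχ : ∀ k, χ k = 1 → k = 0) (v : ℕ → ZMod l) {w a} (ha : T.On w a) {m}
    (hm : m ≤ n) : T.proj v m * a = if ∀ p < m, w p = v p then a else 0 := by
  induction m with
  | zero => simp [proj]
  | succ m ih =>
    rw [proj, mul_assoc, spec_mul hχ (ha m hm)]
    by_cases h : w m = v m
    · rw [if_pos h, ih (by omega)]
      simp only [Nat.lt_succ_iff_lt_or_eq, or_imp, forall_and, forall_eq, h, and_true]
    · rw [if_neg h, mul_zero, if_neg fun h' => h (h' m (by omega))]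

theorem commute_S_proj (v : ℕ → ZMod l) {p} (hp : p < n) {m} (hm : m ≤ n) :
    Commute (T.S p) (T.proj v m) := by
  induction m with
  | zero => exact Commute.one_right _
  | succ m ih => exact (ih (by omega)).mul_right (commute_spec (T.commute_S_S hp hm) _)

theorem S_proj (v : ℕ → ZMod l) {m} (hm : m ≤ n) {p} (hp : p < m) :
    T.S p * T.proj v m = χ (v p) • T.proj v m := by
  induction m with
  | zero => omega
  | succ m ih =>
    rw [proj]
    rcases Nat.lt_succ_iff_lt_or_eq.1 hp with h | rfl
    · rw [← mul_assoc, ih (by omega) h, smul_mul_assoc]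
    · rw [← mul_assoc, (commute_S_proj v hm (by omega)).eq, mul_assoc,
        mul_spec (T.S_pow hm), mul_smul_comm]

/-- An element which annihilates all weight vectors vanishes. -/
theorem ext_on (hχ : ∀ k, χ k = 1 → k = 0) {x : A} (h : ∀ w a, T.On w a → x * a = 0) : x = 0 := by
  have key : ∀ d m, m + d = n → ∀ (w : ℕ → ZMod l) (a : A),
      (∀ p < m, T.S p * a = χ (w p) • a) → x * a = 0 := by
    intro d
    induction d with
    | zero => exact fun m hm w a ha => h w a fun p hp => ha p (by omega)
    | succ d ih =>
      intro m hm w a ha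
      rw [← one_mul a, ← sum_spec hχ (T.S m), Finset.sum_mul, Finset.mul_sum]
      refine Finset.sum_eq_zero fun k _ => ih (m + 1) (by omega) (Function.update w m k) _ ?_
      intro p hp
      rcases Nat.lt_succ_iff_lt_or_eq.1 hp with h1 | rfl
      · rw [Function.update_of_ne h1.ne, ← mul_assoc,
          (commute_spec (T.commute_S_S (by omega) (by omega)) _).eq, mul_assoc, ha p h1,
          mul_smul_comm]
      · rw [Function.update_self, ← mul_assoc, mul_spec (T.S_pow (by omega)), smul_mul_assoc]
  simpa using key n 0 (by omega) (fun _ => 0) 1 (by omega)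

variable (T) in
/-- The image of the idempotent `e(i)`. -/
def E (i : Res l n) : A := T.proj (wt n i) n

theorem on_E (i : Res l n) : T.On (wt n i) (T.E i) := fun _ hp => S_proj _ le_rfl hp

theorem E_mul (hl : OddModulus l) (hχ : ∀ k, χ k = 1 → k = 0) {w a} (ha : T.On w a)
    {j : Res l n} (hj : IsWt w j) (i : Res l n) : T.E i * a = if i = j then a else 0 := by
  rw [E, proj_mul hχ _ ha le_rfl]
  refine if_congr ⟨fun h => ?_, ?_⟩ rfl rfl
  · exact IsWt.inj hl (w := w) (fun p hp => by rw [h p hp, isWt_wt i p hp]) hj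
  · rintro rfl p hp
    rw [hj p hp, isWt_wt i p hp]

theorem E_mul_E (hl : OddModulus l) (hχ : ∀ k, χ k = 1 → k = 0) (i j : Res l n) :
    T.E i * T.E j = if i = j then T.E j else 0 :=
  E_mul hl hχ (on_E j) (isWt_wt j) i

theorem sum_E (hl : OddModulus l) (hχ : ∀ k, χ k = 1 → k = 0) : ∑ i, T.E i = 1 := by
  rw [← sub_eq_zero]
  refine ext_on (T := T) hχ fun w a ha => ?_
  obtain ⟨j, hj⟩ := exists_isWt (n := n) hl w
  simp [sub_mul, Finset.sum_mul, E_mul hl hχ ha hj]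

theorem y_E (hl : OddModulus l) (hχ : ∀ k, χ k = 1 → k = 0) (r) (i : Res l n) :
    T.y r * T.E i = T.E i * T.y r := by
  rw [← sub_eq_zero]
  refine ext_on (T := T) hχ fun w a ha => ?_
  obtain ⟨j, hj⟩ := exists_isWt (n := n) hl w
  rw [sub_mul, mul_assoc, mul_assoc, E_mul hl hχ ha hj, E_mul hl hχ (ha.y r) hj]
  split_ifs <;> simp

theorem P_E (hl : OddModulus l) (hχ : ∀ k, χ k = 1 → k = 0) {r} (hr : r + 1 < n) (i : Res l n) :
    T.P r * T.E i = T.E (i ∘ Equiv.swap ⟨r, by omega⟩ ⟨r + 1, hr⟩) * T.P r := by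
  rw [← sub_eq_zero]
  refine ext_on (T := T) hχ fun w a ha => ?_
  obtain ⟨j, hj⟩ := exists_isWt (n := n) hl w
  rw [sub_mul, mul_assoc, mul_assoc, E_mul hl hχ ha hj, E_mul hl hχ (ha.P hl hχ hr) (hj.sw hr)]
  simp only [(Equiv.surjective _).injective_comp_right.eq_iff]
  split_ifs <;> simp

end TLAct

namespace TLAct
open Statement3.Rep
variable {l n : ℕ} {A : Type*} [Ring A] [Algebra ℂ A] {χ : AddChar (ZMod l) ℂ}
variable {T : TLAct χ n A} [NeZero l]

variable (T) in
/-- The images of the Khovanov–Lauda–Rouquier generators. -/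
def gen : KLRGen l n → A
  | .e i => T.E i
  | .y r => T.y r
  | .psi r => T.P r

variable (T) in
/-- The homomorphism from the free algebra which induces the inverse isomorphism. -/
def toRep : FreeAlgebra ℂ (KLRGen l n) →ₐ[ℂ] A := FreeAlgebra.lift ℂ T.gen

@[simp] theorem toRep_e (i) : T.toRep (eG l n i) = T.E i := FreeAlgebra.lift_ι_apply _ _
@[simp] theorem toRep_y (r) : T.toRep (yG l n r) = T.y r := FreeAlgebra.lift_ι_apply _ _
@[simp] theorem toRep_psi (r) : T.toRep (pG l n r) = T.P r := FreeAlgebra.lift_ι_apply _ _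

theorem isRep (hl : OddModulus l) (hχ : ∀ k, χ k = 1 → k = 0) (hn : 3 ≤ n) :
    IsRep hn T.toRep where
  rel {a b} h := by
    cases h with
    | cyc1 i r hr h =>
      rw [toRep_e, map_zero]
      obtain ⟨r, hr'⟩ := r
      obtain rfl : r = 0 := hr
      refine on_cyc hχ hr' (on_E i) fun h' => h (hl.two _ ?_)
      rw [isWt_wt i 0 hr'] at h'
      push_cast at h'
      linear_combination h'
    | cyc2 i r hr h => rw [map_mul, toRep_y, hr, y_zero (by omega), zero_mul, map_zero]
    | orth i j h => rw [map_mul, toRep_e, toRep_e, E_mul_E hl hχ, if_neg h, map_zero]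
    | idem i => rw [map_mul, toRep_e, E_mul_E hl hχ, if_pos rfl]
    | sum1 => simp only [map_sum, toRep_e, map_one]; exact sum_E hl hχ
    | ye r i => simp only [map_mul, toRep_e, toRep_y]; exact y_E hl hχ r i
    | psie r i =>
      have hr : r.val + 1 < n := by omega
      simp only [map_mul, toRep_e, toRep_psi]
      exact P_E hl hχ hr i
    | yy r s => simpa using (T.commute_y_y r s).eq
    | psiy r s h1 h2 => simpa using (T.commute_y_P (by omega) h1 h2).symm.eq
    | pp r s h =>
      simp only [map_mul, toRep_psi]
      rcases h with h | h
      exacts [(T.commute_P_P h (by omega)).eq, (T.commute_P_P h (by omega)).symm.eq]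
    | py r i =>
      have hr : r.val + 1 < n := by omega
      have ha := on_E (T := T) i
      simp only [map_mul, map_add, apply_ite T.toRep, map_one, map_zero, toRep_e, toRep_y,
        toRep_psi, ((isWt_wt i).succ_eq_iff hl hr), lo, hi]
      split_ifs with h
      · rw [P_y_eq hl hχ hr ha h, add_mul, one_mul, mul_assoc]
      · rw [P_y_ne hl hχ hr ha h, add_zero, mul_assoc]
    | yp r i =>
      have hr : r.val + 1 < n := by omega
      have ha := on_E (T := T) i
      simp only [map_mul, map_add, apply_ite T.toRep, map_one, map_zero, toRep_e, toRep_y,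
        toRep_psi, ((isWt_wt i).succ_eq_iff hl hr), lo, hi]
      split_ifs with h
      · rw [y_P_eq hl hχ hr ha h, add_mul, one_mul, mul_assoc]
      · rw [y_P_ne hl hχ hr ha h, add_zero, mul_assoc]
    | psisq r i =>
      have hr : r.val + 1 < n := by omega
      have ha := on_E (T := T) i
      simp only [map_mul, map_sub, apply_ite T.toRep, map_one, map_zero, toRep_e, toRep_y,
        toRep_psi, lo, hi, ((isWt_wt i).succ_up_iff hl hr),
        ((isWt_wt i).succ_down_iff hl hr)]
      have key := (isWt_wt i).succ_eq_iff hl hr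
      rw [mul_assoc]
      split_ifs with h1 h2 h3
      · rw [P_sq_eq hl hχ hr ha (key.1 h1.symm), zero_mul]
      · rw [P_sq_up hl hχ hr ha h2, sub_mul]
      · rw [P_sq_down hl hχ hr ha h3, sub_mul]
      · rw [P_sq_far hl hχ hr ha (fun h => h1 (key.2 h).symm) h2 h3, one_mul]
    | braid r s h i =>
      obtain ⟨s, hs⟩ := s
      obtain rfl : s = r.val + 1 := h
      have hr : r.val + 2 < n := by omega
      have hr' : r.val + 1 < n := by omega
      have ha := on_E (T := T) i
      simp only [map_mul, map_add, map_neg, apply_ite T.toRep, map_one, map_zero, toRep_e,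
        toRep_psi, lo, hi, ((isWt_wt i).succ_succ_iff hl hr),
        ((isWt_wt i).succ_up_iff hl hr'), ((isWt_wt i).succ_down_iff hl hr')]
      simp only [mul_assoc, add_mul]
      split_ifs with h1 h2
      · rw [braid_up hl hχ hr ha h1.2 h1.1, one_mul]
      · rw [braid_down hl hχ hr ha h2.2 h2.1, neg_one_mul, sub_eq_add_neg]
      · rw [braid_far hl hχ hr ha h1 h2, zero_mul, add_zero]
  bad {i} h := by
    rw [toRep_e]
    obtain ⟨-, h1, h2⟩ := h
    have w1 := isWt_wt i 1 (by omega)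
    have w2 := isWt_wt i 2 (by omega)
    rw [h1] at w1
    rw [h2] at w2
    push_cast at w1 w2
    refine step_zero hχ (p := 1) (by omega) (on_E i) ?_ ?_ <;> rw [w1, w2]
    · exact fun h => hl.ne4 (by linear_combination h)
    · exact fun h => hl.ne6 (by linear_combination h)

end TLAct

section
open Statement3.Rep
section
variable {l n : ℕ} {A : Type*} [Ring A] [Algebra ℂ A] {χ : AddChar (ZMod l) ℂ}

variable (n) in
/-- The generator `U_p` of the Temperley–Lieb algebra, `0` if `p` is out of range. -/
def tlU (q : ℂ) (p : ℕ) : TL q n := if h : p < n - 1 then UmkTL q n ⟨p, h⟩ else 0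

theorem tlU_of_lt {q : ℂ} {p : ℕ} (h : p + 1 < n) :
    tlU n q p = UmkTL q n ⟨p, by omega⟩ := dif_pos _

/-- The Temperley–Lieb action which a homomorphism from the Temperley–Lieb algebra defines. -/
def TLAct.ofHom (u : TL (χ 1) n →ₐ[ℂ] A) : TLAct χ n A where
  U p := u (tlU n (χ 1) p)
  sq {p} hp := by
    have := RingQuot.mkAlgHom_rel ℂ (TLRel.Usq (q := χ 1) (n := n) ⟨p, by omega⟩)
    rw [map_mul, map_smul] at this
    rw [tlU_of_lt hp, ← map_mul, AddChar.map_neg_eq_inv, ← map_smul]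
    exact congrArg u this
  up {p} hp := by
    have := RingQuot.mkAlgHom_rel ℂ (TLRel.UUU (q := χ 1) (n := n) ⟨p, by omega⟩ ⟨p + 1, by omega⟩
      (.inl rfl))
    rw [map_mul, map_mul, mul_assoc] at this
    rw [tlU_of_lt (by omega), tlU_of_lt (by omega), ← map_mul, ← map_mul]
    exact congrArg u this
  down {p} hp := by
    have := RingQuot.mkAlgHom_rel ℂ (TLRel.UUU (q := χ 1) (n := n) ⟨p + 1, by omega⟩ ⟨p, by omega⟩
      (.inr rfl))
    rw [map_mul, map_mul, mul_assoc] at this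
    rw [tlU_of_lt (by omega), tlU_of_lt (by omega), ← map_mul, ← map_mul]
    exact congrArg u this
  far {p r} hp hr := by
    have := RingQuot.mkAlgHom_rel ℂ (TLRel.Ucomm (q := χ 1) (n := n) ⟨p, by omega⟩ ⟨r, by omega⟩
      (.inl hp))
    rw [map_mul, map_mul] at this
    rw [tlU_of_lt (by omega), tlU_of_lt hr, commute_iff_eq, ← map_mul, ← map_mul]
    exact congrArg u this

/-- A homomorphism from the Temperley–Lieb algebra to itself is determined by the generators. -/
theorem TL_hom_ext {q : ℂ} {B : Type*} [Semiring B] [Algebra ℂ B]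
    {f g : TL q n →ₐ[ℂ] B} (h : ∀ i, f (UmkTL q n i) = g (UmkTL q n i)) :
    f = g := by
  ext i
  exact h i

end

variable {l n : ℕ} [NeZero l] {hn : 3 ≤ n} {A B : Type*} [Ring A] [Algebra ℂ A] [Ring B]
  [Algebra ℂ B] {χ : AddChar (ZMod l) ℂ} {T : TLAct χ n A}
  {φ : FreeAlgebra ℂ (KLRGen l n) →ₐ[ℂ] B}

namespace TLAct

theorem map_U (hφ : IsRep hn φ) (hl : OddModulus l) (hχ : ∀ k, χ k = 1 → k = 0)
    {g : B →ₐ[ℂ] A} (hg : ∀ x, g (φ x) = T.toRep x) {p} (hp : p + 1 < n) :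
    g ((act hφ hl).U χ p) = T.U p := by
  have he : ∀ i, g (e φ i) = T.E i := fun i => (hg _).trans (toRep_e i)
  have hy : ∀ r, r < n → g ((act hφ hl).y r) = T.y r := fun r hr => by
    rw [show (act hφ hl).y r = Rep.y φ r from rfl, ← map_yG hr, hg, toRep_y]
  have hψ : g ((act hφ hl).P p) = T.P p := by
    rw [show (act hφ hl).P p = psi φ p from rfl, ← map_pG (show p < n - 1 by omega), hg,
      toRep_psi]
  have hV : ∀ k, g ((act hφ hl).V χ p k) = T.V p k := fun k => by
    simp [KAct.V, V, hy p (by omega)]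
  have hC : ∀ k, g ((act hφ hl).C p k) = T.C p k := fun k => by
    simp only [KAct.C, C, apply_ite g, map_zero, map_one, map_sub, hy p (by omega), hy _ hp]
  rw [← mul_one (g _), ← mul_one (T.U p), ← sum_E hl hχ, Finset.mul_sum, Finset.mul_sum]
  refine Finset.sum_congr rfl fun i _ => ?_
  have hi : (act hφ hl).On (wt n i) (e φ i) :=
    ⟨i, isWt_wt i, by rw [e_mul hφ, if_pos rfl]⟩
  rw [← he, ← map_mul]
  by_cases h : wt n i (p + 1) = 1 - wt n i p
  · rw [KAct.U_of_eq hp hi h, he, U_mul hl hχ hp (on_E i) h]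
    simp only [map_add, map_mul, hψ, hV, hC, he]
  · rw [KAct.U_of_ne hp hi h, he, U_of_ne hχ hp (on_E i) h, map_zero]

end TLAct

theorem isRep_bmk (hn : 3 ≤ n) :
    letI : Ring (BQuot l n (Lam1 l) (badSet1 l n hn)) := Algebra.semiringToRing ℂ
    IsRep hn (bmk l n (Lam1 l) (badSet1 l n hn)) := by
  let _ : Ring (BQuot l n (Lam1 l) (badSet1 l n hn)) := Algebra.semiringToRing ℂ
  constructor
  · intro a b h
    exact congrArg (RingQuot.mkAlgHom ℂ _) (RingQuot.mkAlgHom_rel ℂ h)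
  · intro i h
    refine (RingQuot.mkAlgHom_rel ℂ (s := quotRel l n (Lam1 l) (badSet1 l n hn))
      ⟨rfl, i, h, rfl⟩).trans (map_zero _)

theorem bmk_surjective (hn : 3 ≤ n) : Function.Surjective (bmk l n (Lam1 l) (badSet1 l n hn)) :=
  (RingQuot.mkAlgHom_surjective ℂ _).comp (RingQuot.mkAlgHom_surjective ℂ _)

/-- The homomorphism out of the quotient which a representation induces. -/
def IsRep.lift {ψ : FreeAlgebra ℂ (KLRGen l n) →ₐ[ℂ] A} (h : IsRep hn ψ) :
    BQuot l n (Lam1 l) (badSet1 l n hn) →ₐ[ℂ] A :=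
  RingQuot.liftAlgHom ℂ ⟨RingQuot.liftAlgHom ℂ ⟨ψ, fun _ _ => h.rel⟩, fun x y => by
    rintro ⟨rfl, i, hi, rfl⟩
    rw [RingQuot.liftAlgHom_mkAlgHom_apply, map_zero, h.bad hi]⟩

theorem IsRep.lift_bmk {ψ : FreeAlgebra ℂ (KLRGen l n) →ₐ[ℂ] A} (h : IsRep hn ψ) (x) :
    h.lift (bmk l n (Lam1 l) (badSet1 l n hn) x) = ψ x := by
  simp [IsRep.lift, bmk]

theorem nonempty_algEquiv (hn : 3 ≤ n) (hl : OddModulus l) (hχ : ∀ k, χ k = 1 → k = 0) :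
    Nonempty (TL (χ 1) n ≃ₐ[ℂ] BQuot l n (Lam1 l) (badSet1 l n hn)) := by
  let _ : Ring (BQuot l n (Lam1 l) (badSet1 l n hn)) := Algebra.semiringToRing ℂ
  let _ : Ring (TL (χ 1) n) := Algebra.semiringToRing ℂ
  let T : TLAct χ n (TL (χ 1) n) := TLAct.ofHom (AlgHom.id ℂ _)
  have hφ := isRep_bmk (l := l) hn
  let f := (act hφ hl).ofTL (χ := χ) hl hχ
  let g := (TLAct.isRep (T := T) hl hχ hn).lift
  have hgf : g.comp f = AlgHom.id ℂ _ := TL_hom_ext fun i => by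
    have hi : i.1 + 1 < n := by omega
    exact (congrArg g ((act hφ hl).ofTL_U hl hχ i)).trans
      ((TLAct.map_U hφ hl hχ (g := g) (IsRep.lift_bmk _) hi).trans (tlU_of_lt hi))
  refine ⟨AlgEquiv.ofBijective f
    ⟨Function.LeftInverse.injective (g := g) fun x => congrArg (· x) hgf, fun x => ?_⟩⟩
  obtain ⟨x, rfl⟩ := bmk_surjective hn x
  exact map_mem_of_U hφ hl hχ (R := f.range) (fun p hp =>
    ⟨UmkTL _ _ ⟨p, by omega⟩, (act hφ hl).ofTL_U hl hχ ⟨p, by omega⟩⟩) x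

end

section internal
variable {R A ι : Type*} [CommSemiring R] [Semiring A] [Algebra R A] [AddMonoid ι]

/-- The elements of degree `k` for a homomorphism `Φ` to the monoid algebra. -/
def homog (Φ : A →ₐ[R] AddMonoidAlgebra A ι) (k : ι) : Submodule R A :=
  LinearMap.eqLocus Φ.toLinearMap (AddMonoidAlgebra.lsingle k)

theorem mem_homog {Φ : A →ₐ[R] AddMonoidAlgebra A ι} {k : ι} {a : A} :
    a ∈ homog Φ k ↔ Φ a = AddMonoidAlgebra.single k a := Iff.rfl

instance (Φ : A →ₐ[R] AddMonoidAlgebra A ι) : SetLike.GradedMonoid (homog Φ) where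
  one_mem := by rw [mem_homog, map_one, AddMonoidAlgebra.one_def]
  mul_mem i j a b ha hb := by
    rw [mem_homog] at *
    rw [map_mul, ha, hb, AddMonoidAlgebra.single_mul_single]

variable [DecidableEq ι]

theorem map_coe_homog (Φ : A →ₐ[R] AddMonoidAlgebra A ι) (x : DirectSum ι fun i => homog Φ i)
    (k : ι) : (Φ (DirectSum.coeAlgHom (homog Φ) x)).coeff k = x k := by
  induction x using DirectSum.induction_on with
  | zero => simp
  | of i x =>
    rw [DirectSum.coeAlgHom_of, mem_homog.1 x.2, AddMonoidAlgebra.coeff_single,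
      Finsupp.single_apply, DirectSum.of_apply]
    split_ifs with h
    · subst h; rfl
    · rfl
  | add x y hx hy =>
    rw [map_add, map_add, AddMonoidAlgebra.coeff_add, Finsupp.add_apply, hx, hy]
    rfl

theorem nonempty_gradedAlgebra {Φ : A →ₐ[R] AddMonoidAlgebra A ι}
    (h : Function.Surjective (DirectSum.coeAlgHom (homog Φ))) :
    Nonempty (GradedAlgebra (homog Φ)) := by
  have : DirectSum.IsInternal (homog Φ) := by
    refine ⟨fun x y hxy => ?_, h⟩
    refine DFinsupp.ext fun k => Subtype.ext ?_
    rw [← map_coe_homog, ← map_coe_homog]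
    exact congrArg (fun a => (Φ a).coeff k) hxy
  exact ⟨{ this.chooseDecomposition with }⟩

end internal

section grading
variable {l n : ℕ} {A : Type*} [Ring A] [Algebra ℂ A]

open AddMonoidAlgebra (single single_mul_single)

theorem cartan_self (a : ZMod l) : cartan l a a = 2 := if_pos rfl

theorem cartan_comm (a b : ZMod l) : cartan l a b = cartan l b a := by
  simp only [cartan, eq_comm (a := a) (b := b)]
  congr 2
  rw [or_comm]
  simp only [eq_sub_iff_add_eq, eq_comm]

theorem cartan_add_one (h1 : (1 : ZMod l) ≠ 0) (a : ZMod l) : cartan l a (a + 1) = -1 := by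
  rw [cartan, if_neg fun h => h1 (by linear_combination -h), if_pos (.inl rfl)]

theorem cartan_sub_one (h1 : (1 : ZMod l) ≠ 0) (a : ZMod l) : cartan l a (a - 1) = -1 := by
  rw [cartan, if_neg fun h => h1 (by linear_combination h), if_pos (.inr rfl)]

theorem comp_swap_lo (i : Res l n) (r) : (i ∘ Equiv.swap (lo r) (hi r)) (lo r) = i (hi r) :=
  congrArg i (Equiv.swap_apply_left _ _)

theorem comp_swap_hi (i : Res l n) (r) : (i ∘ Equiv.swap (lo r) (hi r)) (hi r) = i (lo r) :=
  congrArg i (Equiv.swap_apply_right _ _)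

theorem comp_swap_of_ne (i : Res l n) (r : Fin (n - 1)) {p : Fin n} (h1 : p.val ≠ r.val)
    (h2 : p.val ≠ r.val + 1) : (i ∘ Equiv.swap (lo r) (hi r)) p = i p :=
  congrArg i (Equiv.swap_apply_of_ne_of_ne (Fin.ne_of_val_ne h1) (Fin.ne_of_val_ne h2))

variable [NeZero l] (φ : FreeAlgebra ℂ (KLRGen l n) →ₐ[ℂ] A)

/-- The images of the generators under the coaction of the grading. -/
def degGen : KLRGen l n → AddMonoidAlgebra A ℤ
  | .e i => single 0 (φ (eG l n i))
  | .y r => single 2 (φ (yG l n r))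
  | .psi r => ∑ i, single (-(cartan l (i (lo r)) (i (hi r)))) (φ (pG l n r * eG l n i))

/-- The coaction of the grading. -/
def degHom : FreeAlgebra ℂ (KLRGen l n) →ₐ[ℂ] AddMonoidAlgebra A ℤ := FreeAlgebra.lift ℂ (degGen φ)

theorem degHom_e (i) : degHom φ (eG l n i) = single 0 (φ (eG l n i)) :=
  FreeAlgebra.lift_ι_apply _ _
theorem degHom_y (r) : degHom φ (yG l n r) = single 2 (φ (yG l n r)) :=
  FreeAlgebra.lift_ι_apply _ _

variable {φ}

theorem degHom_psi_mul {hn : 3 ≤ n} (hφ : IsRep hn φ) (r k) (i : Res l n) {a : A}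
    (ha : φ (eG l n i) * a = a) : degHom φ (pG l n r) * single k a =
      single (-(cartan l (i (lo r)) (i (hi r))) + k) (φ (pG l n r) * a) := by
  rw [show degHom φ (pG l n r) = _ from FreeAlgebra.lift_ι_apply _ _, degGen, Finset.sum_mul,
    Finset.sum_eq_single i]
  · rw [AddMonoidAlgebra.single_mul_single, map_mul, mul_assoc, ha]
  · intro j _ hj
    have := hφ.rel (.orth j i hj)
    rw [map_mul, map_zero] at this
    rw [AddMonoidAlgebra.single_mul_single, map_mul, mul_assoc, ← ha, ← mul_assoc (φ (eG l n j)),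
      this, zero_mul, mul_zero, AddMonoidAlgebra.single_zero]
  · simp

theorem psi_mul {hn : 3 ≤ n} (hφ : IsRep hn φ) (r) (i : Res l n) {a : A}
    (ha : φ (eG l n i) * a = a) :
    φ (eG l n (i ∘ Equiv.swap (lo r) (hi r))) * (φ (pG l n r) * a) = φ (pG l n r) * a := by
  have := hφ.rel (.psie r i)
  rw [map_mul, map_mul] at this
  rw [← mul_assoc, ← this, mul_assoc, ha]

theorem y_mul {hn : 3 ≤ n} (hφ : IsRep hn φ) (r) (i : Res l n) {a : A}
    (ha : φ (eG l n i) * a = a) : φ (eG l n i) * (φ (yG l n r) * a) = φ (yG l n r) * a := by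
  have := hφ.rel (.ye r i)
  rw [map_mul, map_mul] at this
  rw [← mul_assoc, ← this, mul_assoc, ha]

theorem degHom_ext {hn : 3 ≤ n} (hφ : IsRep hn φ) {x y : AddMonoidAlgebra A ℤ}
    (h : ∀ i, x * single 0 (φ (eG l n i)) = y * single 0 (φ (eG l n i))) : x = y := by
  have key : ∑ i, single (0 : ℤ) (φ (eG l n i)) = 1 := by
    have := hφ.rel .sum1
    rw [map_sum, map_one] at this
    rw [AddMonoidAlgebra.one_def, ← this]
    exact (map_sum (AddMonoidAlgebra.singleAddHom (0 : ℤ)) _ _).symm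
  rw [← mul_one x, ← mul_one y, ← key, Finset.mul_sum, Finset.mul_sum]
  exact Finset.sum_congr rfl fun i _ => h i

theorem isRep_degHom (h1 : (1 : ZMod l) ≠ 0) {hn : 3 ≤ n} (hφ : IsRep hn φ) :
    IsRep hn (degHom φ) where
  rel {a b} h := by
    have he : ∀ i, φ (eG l n i) * φ (eG l n i) = φ (eG l n i) := fun i => by
      rw [← map_mul]
      exact hφ.rel (.idem i)
    have h' := hφ.rel h
    cases h with
    | cyc1 i r hr h =>
      rw [degHom_e, h', map_zero, map_zero, AddMonoidAlgebra.single_zero]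
    | cyc2 i r hr h =>
      rw [map_mul, degHom_e, degHom_y, single_mul_single, ← map_mul, h', map_zero, map_zero,
        AddMonoidAlgebra.single_zero]
    | orth i j h =>
      rw [map_mul, degHom_e, degHom_e, single_mul_single, ← map_mul, h', map_zero, map_zero,
        AddMonoidAlgebra.single_zero]
    | idem i =>
      rw [map_mul, degHom_e, single_mul_single, he, zero_add]
    | sum1 =>
      rw [map_sum, map_one] at *
      simp only [degHom_e]
      rw [AddMonoidAlgebra.one_def, ← h']
      exact (map_sum (AddMonoidAlgebra.singleAddHom (0 : ℤ)) _ _).symm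
    | ye r i =>
      rw [map_mul, map_mul] at *
      rw [degHom_e, degHom_y, single_mul_single, single_mul_single, h', add_comm]
    | psie r i =>
      refine degHom_ext hφ fun j => ?_
      rw [map_mul, map_mul] at *
      rw [mul_assoc, mul_assoc, degHom_psi_mul hφ r 0 j (he j), degHom_e, degHom_e,
        single_mul_single, single_mul_single, ← mul_assoc, ← h', mul_assoc, add_zero, zero_add]
      by_cases hij : i = j
      · subst hij
        rw [degHom_psi_mul hφ r 0 i (by rw [he, he]), add_zero]
      · have := hφ.rel (.orth i j hij)
        rw [map_mul, map_zero] at this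
        rw [← mul_assoc, mul_assoc (φ (pG l n r)), this, mul_zero, AddMonoidAlgebra.single_zero,
          AddMonoidAlgebra.single_zero, mul_zero]
    | yy r s =>
      rw [map_mul, map_mul] at *
      rw [degHom_y, degHom_y, single_mul_single, single_mul_single, h']
    | psiy r s h1 h2 =>
      refine degHom_ext hφ fun j => ?_
      rw [map_mul, map_mul] at *
      rw [mul_assoc, mul_assoc, degHom_psi_mul hφ r 0 j (he j), degHom_y, single_mul_single,
        single_mul_single, degHom_psi_mul hφ r _ j (y_mul hφ s j (he j)), ← mul_assoc, h',
        mul_assoc]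
      congr 1
      ring
    | pp r s h =>
      refine degHom_ext hφ fun j => ?_
      rw [map_mul, map_mul] at *
      rw [mul_assoc, mul_assoc, degHom_psi_mul hφ r 0 j (he j), degHom_psi_mul hφ s 0 j (he j),
        degHom_psi_mul hφ r _ _ (psi_mul hφ s j (he j)),
        degHom_psi_mul hφ s _ _ (psi_mul hφ r j (he j)), ← mul_assoc, h', mul_assoc]
      rw [comp_swap_of_ne, comp_swap_of_ne, comp_swap_of_ne, comp_swap_of_ne]
      · congr 1
        ring
      all_goals simp only [lo, hi]; omega
    | py r i =>
      simp only [map_mul, map_add, apply_ite φ, apply_ite (degHom φ), map_one, map_zero, degHom_e,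
        degHom_y, add_mul] at *
      rw [mul_assoc, degHom_psi_mul hφ r 0 i (he i), single_mul_single, single_mul_single,
        degHom_psi_mul hφ r _ i (y_mul hφ _ i (he i)), h', ← mul_assoc, AddMonoidAlgebra.single_add]
      split_ifs with h
      · rw [h, cartan_self]
        simp
      · simp [add_comm]
    | yp r i =>
      simp only [map_mul, map_add, apply_ite φ, apply_ite (degHom φ), map_one, map_zero, degHom_e,
        degHom_y, add_mul] at *
      rw [mul_assoc, degHom_psi_mul hφ r 0 i (he i), single_mul_single, single_mul_single,
        degHom_psi_mul hφ r _ i (y_mul hφ _ i (he i)), h', ← mul_assoc, AddMonoidAlgebra.single_add]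
      split_ifs with h
      · rw [h, cartan_self]
        simp
      · simp [add_comm]
    | psisq r i =>
      simp only [map_mul, map_sub, apply_ite φ, apply_ite (degHom φ), map_one, map_zero, degHom_e,
        degHom_y] at *
      rw [mul_assoc, degHom_psi_mul hφ r 0 i (he i),
        degHom_psi_mul hφ r _ _ (psi_mul hφ r i (he i)), ← mul_assoc, h', comp_swap_lo,
        comp_swap_hi, cartan_comm (i (hi r))]
      split_ifs with h2 h3 h4
      · simp
      · rw [h3, cartan_add_one h1, sub_mul, sub_mul, single_mul_single, single_mul_single,
          AddMonoidAlgebra.single_sub]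
        rfl
      · rw [h4, cartan_sub_one h1, sub_mul, sub_mul, single_mul_single, single_mul_single,
          AddMonoidAlgebra.single_sub]
        rfl
      · rw [cartan, if_neg (Ne.symm h2), if_neg (by tauto)]
        simp
    | braid r s h i =>
      simp only [map_mul, map_add, map_neg, apply_ite φ, apply_ite (degHom φ), map_one, map_zero,
        degHom_e, add_mul] at *
      simp only [mul_assoc] at *
      rw [degHom_psi_mul hφ r 0 i (he i), degHom_psi_mul hφ s 0 i (he i),
        degHom_psi_mul hφ s _ _ (psi_mul hφ r i (he i)),
        degHom_psi_mul hφ r _ _ (psi_mul hφ s i (he i)),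
        degHom_psi_mul hφ s _ _ (psi_mul hφ r _ (psi_mul hφ s i (he i))),
        degHom_psi_mul hφ r _ _ (psi_mul hφ s _ (psi_mul hφ r i (he i))), h',
        AddMonoidAlgebra.single_add]
      have hs : lo s = hi r := Fin.ext h
      have r3 : ∀ j : Res l n, (j ∘ Equiv.swap (lo r) (hi r)) (hi s) = j (hi s) := fun j =>
        comp_swap_of_ne j r (by simp only [hi]; omega) (by simp only [hi]; omega)
      have s1 : ∀ j : Res l n, (j ∘ Equiv.swap (lo s) (hi s)) (lo r) = j (lo r) := fun j =>
        comp_swap_of_ne j s (by simp only [lo]; omega) (by simp only [lo]; omega)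
      have s2 : ∀ j : Res l n, (j ∘ Equiv.swap (lo s) (hi s)) (lo s) = j (hi s) := fun j =>
        comp_swap_lo j s
      have s3 : ∀ j : Res l n, (j ∘ Equiv.swap (lo s) (hi s)) (hi s) = j (lo s) := fun j =>
        comp_swap_hi j s
      simp only [hs] at s1 s2 s3
      simp only [hs, r3, s1, s2, s3, comp_swap_lo, comp_swap_hi]
      congr 1
      · congr 1
        ring
      · split_ifs with h2 h3
        · rw [h2.1, h2.2, cartan_self, cartan_add_one h1, cartan_comm, cartan_add_one h1]
          simp
        · rw [h3.1, h3.2, cartan_self, cartan_sub_one h1, cartan_comm, cartan_sub_one h1]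
          simp
        · simp
  bad {i} h := by rw [degHom_e, hφ.bad h, AddMonoidAlgebra.single_zero]

end grading

section
open AddMonoidAlgebra (single)

theorem exists_grading {l n : ℕ} [NeZero l] (h1 : (1 : ZMod l) ≠ 0) (hn : 3 ≤ n) :
    ∃ 𝒜 : ℤ → Submodule ℂ (BQuot l n (Lam1 l) (badSet1 l n hn)),
      Nonempty (GradedAlgebra 𝒜) ∧
      (∀ i : Res l n, bmk l n (Lam1 l) (badSet1 l n hn) (eG l n i) ∈ 𝒜 0) ∧
      (∀ r : Fin n, bmk l n (Lam1 l) (badSet1 l n hn) (yG l n r) ∈ 𝒜 2) ∧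
      (∀ (r : Fin (n - 1)) (i : Res l n),
        bmk l n (Lam1 l) (badSet1 l n hn) (pG l n r * eG l n i) ∈
          𝒜 (-(cartan l (i (lo r)) (i (hi r))))) := by
  let _ : Ring (BQuot l n (Lam1 l) (badSet1 l n hn)) := Algebra.semiringToRing ℂ
  have hφ := isRep_bmk (l := l) hn
  have hΦ := isRep_degHom h1 hφ
  have he : ∀ i, bmk l n (Lam1 l) (badSet1 l n hn) (eG l n i) ∈ homog hΦ.lift 0 := fun i =>
    (hΦ.lift_bmk _).trans (degHom_e _ i)
  have hy : ∀ r, bmk l n (Lam1 l) (badSet1 l n hn) (yG l n r) ∈ homog hΦ.lift 2 := fun r =>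
    (hΦ.lift_bmk _).trans (degHom_y _ r)
  have hp : ∀ r i, bmk l n (Lam1 l) (badSet1 l n hn) (pG l n r * eG l n i) ∈
      homog hΦ.lift (-(cartan l (i (lo r)) (i (hi r)))) := fun r i => by
    refine (hΦ.lift_bmk _).trans ?_
    rw [map_mul, degHom_e, degHom_psi_mul hφ r 0 i, add_zero, ← map_mul]
    · rfl
    · rw [← map_mul]
      exact hφ.rel (.idem i)
  have hmem : ∀ {k a}, a ∈ homog hΦ.lift k → a ∈ (DirectSum.coeAlgHom (homog hΦ.lift)).range :=
    fun {k a} ha => ⟨DirectSum.of (fun i => homog hΦ.lift i) k ⟨a, ha⟩,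
      DirectSum.coeAlgHom_of (homog hΦ.lift) k ⟨a, ha⟩⟩
  refine ⟨homog hΦ.lift, nonempty_gradedAlgebra fun x => ?_, he, hy, hp⟩
  obtain ⟨x, rfl⟩ := bmk_surjective hn x
  refine Rep.map_mem (φ := bmk l n (Lam1 l) (badSet1 l n hn))
    (R := (DirectSum.coeAlgHom (homog hΦ.lift)).range) (fun i => hmem (he i)) (fun r hr => ?_)
    (fun r hr => ?_) x
  · rw [← Rep.map_yG hr]
    exact hmem (hy _)
  · rw [← Rep.map_pG (show r < n - 1 by omega), ← mul_one (pG l n _), map_mul, map_one,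
      ← Rep.sum_e hφ, Finset.mul_sum]
    refine sum_mem fun i _ => ?_
    rw [← Rep.map_eG, ← map_mul]
    exact hmem (hp _ i)

theorem oddModulus {l : ℕ} (hl : 5 ≤ l) (hodd : Odd l) : OddModulus l where
  two x hx := by
    have : IsUnit ((2 : ℕ) : ZMod l) := (ZMod.isUnit_iff_coprime _ _).2 hodd.coprime_two_left
    exact (this.mul_right_eq_zero).1 (by exact_mod_cast hx)
  ne3 h := by
    have : l ∣ 3 := (ZMod.natCast_eq_zero_iff 3 l).1 (by exact_mod_cast h)
    exact absurd (Nat.le_of_dvd (by norm_num) this) (by omega)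

theorem exists_addChar {l : ℕ} [NeZero l] {q : ℂ} (hq : IsPrimitiveRoot q l) (hl : 1 < l) :
    ∃ χ : AddChar (ZMod l) ℂ, χ 1 = q ∧ ∀ k, χ k = 1 → k = 0 := by
  have : Fact (1 < l) := ⟨hl⟩
  refine ⟨AddChar.zmodChar l hq.pow_eq_one, ?_, fun k hk => ?_⟩
  · rw [AddChar.zmodChar_apply, ZMod.val_one, pow_one]
  · rw [AddChar.zmodChar_apply] at hk
    have := Nat.eq_zero_of_dvd_of_lt (hq.dvd_of_pow_eq_one _ hk) (ZMod.val_lt k)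
    exact (ZMod.val_eq_zero k).1 this

end

/-- Let `l ≥ 5` be odd, `q` a primitive `l`-th root of unity and `n ≥ 3`.
Then the Temperley–Lieb algebra `Tl_n(q)` is isomorphic as a `ℂ`-algebra to the quotient of
the level-one cyclotomic KLR algebra by the two-sided ideal generated by the idempotents
`e(i)` with `(i₁, i₂, i₃) ≡ (0, 1, 2) (mod l)`; in particular this quotient carries a
`ℤ`-grading induced from the KLR grading, so `Tl_n(q)` inherits a `ℤ`-grading. -/
theorem statement3 (l : ℕ) [NeZero l] (hl : 5 ≤ l) (hodd : Odd l)
    (q : ℂ) (hq : IsPrimitiveRoot q l) (n : ℕ) (hn : 3 ≤ n) :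
    Nonempty (TL q n ≃ₐ[ℂ] BQuot l n (Lam1 l) (badSet1 l n hn)) ∧
    ∃ 𝒜 : ℤ → Submodule ℂ (BQuot l n (Lam1 l) (badSet1 l n hn)),
      Nonempty (GradedAlgebra 𝒜) ∧
      (∀ i : Res l n, bmk l n (Lam1 l) (badSet1 l n hn) (eG l n i) ∈ 𝒜 0) ∧
      (∀ r : Fin n, bmk l n (Lam1 l) (badSet1 l n hn) (yG l n r) ∈ 𝒜 2) ∧
      (∀ (r : Fin (n - 1)) (i : Res l n),
        bmk l n (Lam1 l) (badSet1 l n hn) (pG l n r * eG l n i) ∈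
          𝒜 (-(cartan l (i (lo r)) (i (hi r))))) := by
  obtain ⟨χ, rfl, hχ⟩ := exists_addChar hq (by omega)
  have hm := oddModulus hl hodd
  exact ⟨nonempty_algEquiv hn hm hχ, exists_grading hm.ne1 hn⟩

end Statement3
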